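/- Let f and g be holomorphic functions on the open unit disk 𝔻 = {z ∈ ℂ : |z| < 1} with sup_{z∈𝔻}|f(z)| ≤ 1, sup_{z∈𝔻}|g(z)| ≤ 1, and inf_{z∈𝔻}(|f(z)| + |g(z)|) = δ > 0. Then there exist a constant C > 0 depending only on δ and a holomorphic function G on 𝔻 such that sup_{z∈𝔻}|G(z)| ≤ C and |f(z) + g(z)G(z)| ≥ 1/C for all z ∈ 𝔻 (so that Φ = f + gG is invertible in H∞ with ‖Φ⁻¹‖_{H∞} ≤ C). Formally: for every δ > 0 there exists C > 0 such that the above holds for all such f, g. -/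

import Mathlib

open Set Metric MeasureTheory Filter Topology Complex
open scoped ComplexConjugate Real

namespace Treil

section

/-- The real-linear map `v ↦ a v + b v̄`. -/
noncomputable def wirt (a b : ℂ) : ℂ →L[ℝ] ℂ :=
  a • ContinuousLinearMap.id ℝ ℂ + b • (conjCLE : ℂ →L[ℝ] ℂ)

@[simp] theorem wirt_apply (a b v : ℂ) : wirt a b v = a * v + b * conj v := by
  simp [wirt]

/-- `F` is real differentiable at `z` with `∂F = a` and `∂̄F = b`. -/
def HasW (F : ℂ → ℂ) (a b z : ℂ) : Prop := HasFDerivAt F (wirt a b) z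

variable {F G : ℂ → ℂ} {a b c d z : ℂ}

theorem HasW.continuousAt (h : HasW F a b z) : ContinuousAt F z := HasFDerivAt.continuousAt h

theorem HasW.congr_coeff (h : HasW F a b z) (ha : a = c) (hb : b = d) : HasW F c d z :=
  ha ▸ hb ▸ h

theorem HasW.congr (h : HasW F a b z) (hG : G =ᶠ[𝓝 z] F) : HasW G a b z :=
  HasFDerivAt.congr_of_eventuallyEq h hG

theorem hasW_const (k z : ℂ) : HasW (fun _ => k) 0 0 z := by
  have h : wirt 0 0 = 0 := by ext1 v; simp
  unfold HasW; rw [h]; exact hasFDerivAt_const k z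

theorem hasW_of_hasDerivAt {f : ℂ → ℂ} {f' z : ℂ} (h : HasDerivAt f f' z) : HasW f f' 0 z := by
  refine (h.hasFDerivAt.restrictScalars ℝ).congr_fderiv ?_
  ext1 v; simp [mul_comm]

theorem hasW_id (z : ℂ) : HasW (fun w => w) 1 0 z := hasW_of_hasDerivAt (hasDerivAt_id z)

theorem HasW.hasDerivAt (h : HasW F a 0 z) : HasDerivAt F a z := by
  have h1 : HasFDerivAt F ((ContinuousLinearMap.toSpanSingleton ℂ a).restrictScalars ℝ) z := by
    refine HasFDerivAt.congr_fderiv h ?_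
    ext1 v; simp [mul_comm]
  have h2 : HasFDerivAt F (ContinuousLinearMap.toSpanSingleton ℂ a) z :=
    hasFDerivAt_of_restrictScalars ℝ h1 rfl
  simpa using h2.hasDerivAt

theorem HasW.add (hF : HasW F a b z) (hG : HasW G c d z) :
    HasW (fun w => F w + G w) (a + c) (b + d) z := by
  refine (HasFDerivAt.add hF hG).congr_fderiv ?_
  ext1 v; simp; ring

theorem HasW.neg (hF : HasW F a b z) : HasW (fun w => -F w) (-a) (-b) z := by
  refine (HasFDerivAt.neg hF).congr_fderiv ?_
  ext1 v; simp; ring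

theorem HasW.sub (hF : HasW F a b z) (hG : HasW G c d z) :
    HasW (fun w => F w - G w) (a - c) (b - d) z := by
  refine (HasFDerivAt.sub hF hG).congr_fderiv ?_
  ext1 v; simp; ring

theorem HasW.mul (hF : HasW F a b z) (hG : HasW G c d z) :
    HasW (fun w => F w * G w) (a * G z + F z * c) (b * G z + F z * d) z := by
  refine (HasFDerivAt.mul hF hG).congr_fderiv ?_
  ext1 v; simp; ring

theorem HasW.conj (hF : HasW F a b z) :
    HasW (fun w => conj (F w)) (conj b) (conj a) z := by
  refine ((conjCLE : ℂ →L[ℝ] ℂ).hasFDerivAt.comp z hF).congr_fderiv ?_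
  ext1 v; simp; ring

/-- Holomorphic outer function. -/
theorem HasW.hol_comp {h : ℂ → ℂ} {h' : ℂ} (hh : HasDerivAt h h' (F z)) (hF : HasW F a b z) :
    HasW (fun w => h (F w)) (h' * a) (h' * b) z := by
  refine ((hh.hasFDerivAt.restrictScalars ℝ).comp z hF).congr_fderiv ?_
  ext1 v; simp; ring

/-- Holomorphic inner function. -/
theorem HasW.comp_hol {h : ℂ → ℂ} {h' : ℂ} (hF : HasW F a b (h z)) (hh : HasDerivAt h h' z) :
    HasW (fun w => F (h w)) (a * h') (b * conj h') z := by
  refine (HasFDerivAt.comp z hF (hh.hasFDerivAt.restrictScalars ℝ)).congr_fderiv ?_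
  ext1 v; simp; ring

/-- Smooth real function of the squared modulus of a holomorphic function. -/
theorem hasW_normSq {χ : ℝ → ℝ} {χ' : ℝ} {h : ℂ → ℂ} {h' : ℂ}
    (hχ : HasDerivAt χ χ' (normSq (h z))) (hh : HasDerivAt h h' z) :
    HasW (fun w => (χ (normSq (h w)) : ℂ)) (χ' * conj (h z) * h') (χ' * h z * conj h') z := by
  have h1 : HasFDerivAt (fun w => normSq (h w))
      (reCLM.comp (wirt (h' * conj (h z)) (h z * conj h'))) z := by
    have := (hasW_of_hasDerivAt hh).mul (HasW.conj (hasW_of_hasDerivAt hh))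
    have h2 := (reCLM.hasFDerivAt (x := h z * conj (h z))).comp z this
    refine (h2.congr_fderiv ?_).congr_of_eventuallyEq (Eventually.of_forall fun w => ?_)
    · ext1 v; simp
    · simp [normSq_apply]
  have h3 := (ofRealCLM.hasFDerivAt (x := χ (normSq (h z)))).comp z
    ((hχ.hasFDerivAt).comp z h1)
  refine h3.congr_fderiv ?_
  ext1 v
  apply Complex.ext <;> simp <;> ring

theorem HasW.div (hF : HasW F a b z) (hG : HasW G c d z) (h0 : G z ≠ 0) :
    HasW (fun w => F w / G w) ((a * G z - F z * c) / G z ^ 2) ((b * G z - F z * d) / G z ^ 2) z := by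
  have := hF.mul (HasW.hol_comp (hasDerivAt_inv h0) hG)
  refine HasW.congr_coeff (F := fun w => F w / G w) (by simpa only [div_eq_mul_inv] using this) ?_ ?_
    <;> field_simp <;> ring

end

theorem integral_ball_polar {b : ℂ → ℂ} (hb : ContinuousOn b (closedBall 0 1)) :
    ∫ z in ball (0 : ℂ) 1, b z =
      ∫ r in (0 : ℝ)..1, ∫ θ in (-π)..π, (r : ℂ) * b (r * cexp (θ * I)) := by
  have key : ∀ p : ℝ × ℝ, Complex.polarCoord.symm p = p.1 * cexp (p.2 * I) := fun p => by
    rw [Complex.polarCoord_symm_apply, exp_mul_I]; push_cast; ring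
  have hcont : ContinuousOn (fun p : ℝ × ℝ => (p.1 : ℂ) * b (p.1 * cexp (p.2 * I)))
      (Icc 0 1 ×ˢ Icc (-π) π) := by
    refine ContinuousOn.mul (by fun_prop) (hb.comp (by fun_prop) ?_)
    rintro ⟨r, θ⟩ ⟨hr, -⟩
    simp only [mem_closedBall, dist_zero_right, norm_mul, norm_real, Real.norm_eq_abs,
      norm_exp_ofReal_mul_I, mul_one]
    rw [abs_of_nonneg hr.1]; exact hr.2
  have hint : IntegrableOn (fun p : ℝ × ℝ => (p.1 : ℂ) * b (p.1 * cexp (p.2 * I)))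
      (Ioc 0 1 ×ˢ Ioc (-π) π) :=
    (hcont.integrableOn_compact (isCompact_Icc.prod isCompact_Icc)).mono_set
      (prod_mono Ioc_subset_Icc_self Ioc_subset_Icc_self)
  rw [← integral_indicator measurableSet_ball, ← Complex.integral_comp_polarCoord_symm]
  have h1 : ∀ p ∈ polarCoord.target,
      p.1 • (ball (0 : ℂ) 1).indicator b (Complex.polarCoord.symm p) =
      (Ioo (0 : ℝ) 1 ×ˢ (univ : Set ℝ)).indicator
        (fun p : ℝ × ℝ => (p.1 : ℂ) * b (p.1 * cexp (p.2 * I))) p := by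
    rintro ⟨r, θ⟩ hp
    simp only [polarCoord_target, mem_prod, mem_Ioi, mem_Ioo] at hp
    rw [key]
    by_cases hr : r < 1
    · rw [indicator_of_mem, indicator_of_mem]
      · simp
      · simp [hp.1, hr]
      · simpa [abs_of_pos hp.1] using hr
    · rw [indicator_of_notMem, indicator_of_notMem]
      · simp
      · simp [hr]
      · simpa [abs_of_pos hp.1] using hr
  rw [setIntegral_congr_fun (by rw [polarCoord_target]; measurability) h1,
    setIntegral_indicator (by measurability), polarCoord_target]
  have h2 : Ioi (0 : ℝ) ×ˢ Ioo (-π) π ∩ Ioo (0 : ℝ) 1 ×ˢ univ = Ioo 0 1 ×ˢ Ioo (-π) π := by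
    ext ⟨r, θ⟩; simp only [mem_inter_iff, mem_prod, mem_Ioi, mem_Ioo, mem_univ]; tauto
  rw [h2, Measure.volume_eq_prod, setIntegral_prod _
    (by rw [← Measure.volume_eq_prod]
        exact hint.mono_set (prod_mono Ioo_subset_Ioc_self Ioo_subset_Ioc_self)),
    intervalIntegral.integral_of_le zero_le_one, integral_Ioc_eq_integral_Ioo]
  congr 1; ext r
  rw [intervalIntegral.integral_of_le (by linarith [Real.pi_pos]), integral_Ioc_eq_integral_Ioo]

theorem stokes_aux {F a b : ℂ → ℂ} (hF : ContinuousOn F (closedBall 0 1))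
    (hW : ∀ z ∈ ball (0 : ℂ) 1, HasW F (a z) (b z) z) (hb : ContinuousOn b (closedBall 0 1)) :
    ∫ θ in (-π)..π, I * cexp (θ * I) * F (cexp (θ * I)) = 2 * I * ∫ z in ball (0 : ℂ) 1, b z := by
  set ζ : ℝ × ℝ → ℂ := fun p => p.1 * cexp (p.2 * I) with hζ
  have hpi : -π ≤ π := by linarith [Real.pi_pos]
  have hmap : MapsTo ζ (uIcc (0:ℝ) 1 ×ˢ uIcc (-π) π) (closedBall 0 1) := by
    rintro ⟨r, θ⟩ ⟨hr, -⟩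
    rw [uIcc_of_le zero_le_one] at hr
    simp only [hζ, mem_closedBall, dist_zero_right, norm_mul, norm_real, Real.norm_eq_abs,
      norm_exp_ofReal_mul_I, mul_one]
    rw [abs_of_nonneg hr.1]; exact hr.2
  have hFζ : ContinuousOn (fun p => F (ζ p)) (uIcc (0:ℝ) 1 ×ˢ uIcc (-π) π) :=
    hF.comp (by fun_prop) hmap
  have hbζ : ContinuousOn (fun p => b (ζ p)) (uIcc (0:ℝ) 1 ×ˢ uIcc (-π) π) :=
    hb.comp (by fun_prop) hmap
  let e : ℝ × ℝ → ℂ := fun p => cexp (p.2 * I)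
  let e' : ℝ × ℝ → ℝ × ℝ →L[ℝ] ℂ := fun p =>
    (ContinuousLinearMap.snd ℝ ℝ ℝ).smulRight (I * e p)
  have he : ∀ p, HasFDerivAt e (e' p) p := fun p => by
    have h1 : HasFDerivAt (fun p : ℝ × ℝ => (p.2 : ℂ) * I)
        ((ContinuousLinearMap.snd ℝ ℝ ℝ).smulRight I) p :=
      ((ContinuousLinearMap.snd ℝ ℝ ℝ).smulRight I).hasFDerivAt.congr_of_eventuallyEq
        (.of_forall fun q => by simp)
    have h2 := ((Complex.hasDerivAt_exp ((p.2 : ℂ) * I)).hasFDerivAt.restrictScalars ℝ).comp p h1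
    refine h2.congr_fderiv (ContinuousLinearMap.ext fun v => ?_)
    simp [e', e]; ring
  have hre : ∀ p : ℝ × ℝ, HasFDerivAt (fun p : ℝ × ℝ => (p.1 : ℂ))
      ((ContinuousLinearMap.fst ℝ ℝ ℝ).smulRight (1:ℂ)) p := fun p =>
    ((ContinuousLinearMap.fst ℝ ℝ ℝ).smulRight (1:ℂ)).hasFDerivAt.congr_of_eventuallyEq
        (.of_forall fun q => by simp)
  let ζ' : ℝ × ℝ → ℝ × ℝ →L[ℝ] ℂ := fun p =>
    (p.1 : ℂ) • e' p + e p • (ContinuousLinearMap.fst ℝ ℝ ℝ).smulRight (1:ℂ)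
  have hζ' : ∀ p, HasFDerivAt ζ (ζ' p) p := fun p => (hre p).mul (he p)
  have hopen : ∀ x ∈ Ioo (min (0:ℝ) 1) (max 0 1) ×ˢ Ioo (min (-π) π) (max (-π) π),
      ζ x ∈ ball (0:ℂ) 1 := by
    rintro ⟨r, θ⟩ ⟨hr, -⟩
    simp only [zero_le_one, inf_of_le_left, sup_of_le_right, mem_Ioo] at hr
    simp only [hζ, mem_ball, dist_zero_right, norm_mul, norm_real, Real.norm_eq_abs,
      norm_exp_ofReal_mul_I, mul_one]
    rw [abs_of_pos hr.1]; exact hr.2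
  let F' : ℝ × ℝ → ℝ × ℝ →L[ℝ] ℂ := fun p => (wirt (a (ζ p)) (b (ζ p))).comp (ζ' p)
  have hFd : ∀ x ∈ Ioo (min (0:ℝ) 1) (max 0 1) ×ˢ Ioo (min (-π) π) (max (-π) π),
      HasFDerivAt (fun p => F (ζ p)) (F' x) x := fun x hx =>
    HasFDerivAt.comp x (hW _ (hopen x hx)) (hζ' x)
  have hsum : ∀ x : ℝ × ℝ,
      ((I * ζ x) • F' x + F (ζ x) • (I • ζ' x)) (1, 0) +
        (-(e x • F' x + F (ζ x) • e' x)) (0, 1) = 2 * I * (x.1 * b (ζ x)) := fun x => by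
    have h1 : e x * conj (e x) = 1 := by
      rw [mul_conj, normSq_eq_norm_sq]; simp [e, norm_exp_ofReal_mul_I]
    have h2 : ζ x = x.1 * e x := rfl
    simp only [F', ζ', e', add_apply, smul_apply,
      neg_apply, ContinuousLinearMap.comp_apply, wirt_apply,
      ContinuousLinearMap.smulRight_apply, ContinuousLinearMap.coe_fst',
      ContinuousLinearMap.coe_snd', smul_eq_mul, real_smul, ofReal_one, ofReal_zero, map_add,
      map_mul, map_one, map_zero, conj_I, conj_ofReal]
    rw [h2]
    linear_combination (2 * I * (x.1 * b (x.1 * e x))) * h1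
  have hint : IntegrableOn (fun x : ℝ × ℝ =>
      ((I * ζ x) • F' x + F (ζ x) • (I • ζ' x)) (1, 0) +
        (-(e x • F' x + F (ζ x) • e' x)) (0, 1)) (uIcc (0:ℝ) 1 ×ˢ uIcc (-π) π) := by
    simp_rw [hsum]
    refine ContinuousOn.integrableOn_compact (isCompact_uIcc.prod isCompact_uIcc) ?_
    exact continuousOn_const.mul (ContinuousOn.mul (by fun_prop) hbζ)
  have main := integral2_divergence_prod_of_hasFDerivAt (fun p => I * ζ p * F (ζ p))
    (fun p => -(e p * F (ζ p))) (fun x => (I * ζ x) • F' x + F (ζ x) • (I • ζ' x))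
    (fun x => -(e x • F' x + F (ζ x) • e' x)) 0 (-π) 1 π
    ((by fun_prop : ContinuousOn (fun p => I * ζ p) _).mul hFζ)
    ((ContinuousOn.mul (by fun_prop) hFζ).neg)
    (fun x hx => ((hζ' x).const_mul I).mul (hFd x hx))
    (fun x hx => ((he x).mul (hFd x hx)).neg) hint
  simp_rw [hsum] at main
  simp only [intervalIntegral.integral_const_mul] at main
  rw [integral_ball_polar hb]
  simp only [intervalIntegral.integral_const_mul]
  rw [main]
  have e1 : cexp ((π : ℂ) * I) = -1 := exp_pi_mul_I
  simp [ζ, e, e1]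

/-- Stokes' theorem on the unit disk. -/
theorem stokes {F a b : ℂ → ℂ} (hF : ContinuousOn F (closedBall 0 1))
    (hW : ∀ z ∈ ball (0 : ℂ) 1, HasW F (a z) (b z) z) (hb : ContinuousOn b (closedBall 0 1)) :
    ∫ θ in (0:ℝ)..2 * π, cexp (θ * I) * F (cexp (θ * I)) = 2 * ∫ z in ball (0 : ℂ) 1, b z := by
  have h := stokes_aux hF hW hb
  have hper : Function.Periodic (fun θ : ℝ => cexp (θ * I) * F (cexp (θ * I))) (2 * π) :=
    fun θ => by
      have : cexp ((θ + 2 * π : ℝ) * I) = cexp (θ * I) := by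
        push_cast; rw [add_mul, exp_add, exp_two_pi_mul_I, mul_one]
      simp only [this]
  have h1 := hper.intervalIntegral_add_eq 0 (-π)
  rw [zero_add, show -π + 2 * π = π by ring] at h1
  rw [h1]
  simp_rw [mul_assoc I, intervalIntegral.integral_const_mul, mul_comm 2 I, mul_assoc I] at h
  exact mul_left_cancel₀ I_ne_zero h

/-- Functions vanishing on the circle have `∫ ∂F = 0`. -/
theorem integral_del_eq_zero {F a b : ℂ → ℂ} (hF : ContinuousOn F (closedBall 0 1))
    (hW : ∀ z ∈ ball (0 : ℂ) 1, HasW F (a z) (b z) z) (ha : ContinuousOn a (closedBall 0 1))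
    (h0 : ∀ z ∈ sphere (0 : ℂ) 1, F z = 0) :
    ∫ z in ball (0 : ℂ) 1, a z = 0 := by
  have := stokes (F := fun z => conj (F z)) (a := fun z => conj (b z)) (b := fun z => conj (a z))
    (continuous_conj.comp_continuousOn hF) (fun z hz => (hW z hz).conj)
    (continuous_conj.comp_continuousOn ha)
  rw [intervalIntegral.integral_congr (g := fun _ => 0) fun θ _ => by
    simp only; rw [h0 _ (by simp [norm_exp_ofReal_mul_I])]; simp] at this
  rw [integral_conj] at this
  simpa using this.symm

theorem fact_two_pi_pos : Fact (0 < 2 * π) := ⟨Real.two_pi_pos⟩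
attribute [local instance] fact_two_pi_pos

/-- The exponential `e^{ikθ}`. -/
noncomputable def ex (k : ℤ) (θ : ℝ) : ℂ := cexp (k * θ * I)

theorem continuous_ex (k : ℤ) : Continuous (ex k) := by unfold ex; fun_prop

theorem ex_add (k l : ℤ) (θ : ℝ) : ex (k + l) θ = ex k θ * ex l θ := by
  rw [ex, ex, ex, ← exp_add]; push_cast; ring_nf

theorem ex_sub_arg (k : ℤ) (θ t : ℝ) : ex k (θ - t) = ex k θ * ex (-k) t := by
  rw [ex, ex, ex, ← exp_add]; push_cast; ring_nf

theorem ex_natCast (n : ℕ) (θ : ℝ) : ex n θ = cexp (θ * I) ^ n := by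
  rw [ex, ← exp_nat_mul]; push_cast; ring_nf

theorem conj_ex (k : ℤ) (θ : ℝ) : conj (ex k θ) = ex (-k) θ := by
  rw [ex, ex, ← exp_conj]; simp

theorem fourier_eq_ex (k : ℤ) (θ : ℝ) : fourier k (θ : AddCircle (2 * π)) = ex k θ := by
  rw [fourier_coe_apply, ex]; congr 1; push_cast; field_simp

theorem integral_ex_sub (k : ℤ) (t : ℝ) :
    ∫ θ in (0:ℝ)..2 * π, ex k (θ - t) = if k = 0 then 2 * (π : ℂ) else 0 := by
  split_ifs with h
  · simp [h, ex]
  · simp_rw [ex_sub_arg, intervalIntegral.integral_mul_const]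
    have h0 : (k : ℂ) * I ≠ 0 := mul_ne_zero (by exact_mod_cast h) I_ne_zero
    have h1 : ∀ θ : ℝ, ex k θ = cexp ((k : ℂ) * I * θ) := fun θ => by rw [ex]; ring_nf
    simp_rw [h1]
    rw [integral_exp_mul_complex h0]
    have h2 : (k : ℂ) * I * ((2 * π : ℝ) : ℂ) = k * (2 * π * I) := by push_cast; ring
    rw [h2, exp_int_mul_two_pi_mul_I]; simp

theorem integral_sum_sum (N : ℕ) {u : ℕ → ℕ → ℝ → ℂ}
    (hu : ∀ j k, IntervalIntegrable (u j k) volume 0 (2 * π)) :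
    ∫ θ in (0:ℝ)..2 * π, ∑ j ∈ Finset.range N, ∑ k ∈ Finset.range N, u j k θ =
      ∑ j ∈ Finset.range N, ∑ k ∈ Finset.range N, ∫ θ in (0:ℝ)..2 * π, u j k θ := by
  rw [intervalIntegral.integral_finsetSum fun j _ => ?_]
  · exact Finset.sum_congr rfl fun j _ => intervalIntegral.integral_finsetSum fun k _ => hu j k
  · simpa only [Finset.sum_fn] using
      IntervalIntegrable.sum (Finset.range N) (fun k _ => hu j k)

abbrev CC := C(AddCircle (2 * π), ℂ)

/-- The Fejér kernel. -/
noncomputable def fejer (N : ℕ) (x : ℝ) : ℂ :=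
  (N : ℂ)⁻¹ * ∑ j ∈ Finset.range N, ∑ k ∈ Finset.range N, ex ((j : ℤ) - k) x

theorem norm_fejer (N : ℕ) (x : ℝ) : (‖fejer N x‖ : ℂ) = fejer N x := by
  have h : fejer N x = ((N : ℝ)⁻¹ * ‖∑ j ∈ Finset.range N, ex (j : ℤ) x‖ ^ 2 : ℝ) := by
    rw [fejer]; push_cast; congr 1
    rw [← conj_mul', map_sum, Finset.sum_mul_sum, Finset.sum_comm]
    refine Finset.sum_congr rfl fun j _ => Finset.sum_congr rfl fun k _ => ?_
    rw [conj_ex, ← ex_add]; ring_nf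
  rw [h, norm_real, Real.norm_of_nonneg (by positivity)]

theorem integral_norm_fejer {N : ℕ} (hN : 0 < N) (t : ℝ) :
    ∫ θ in (0:ℝ)..2 * π, ‖fejer N (θ - t)‖ = 2 * π := by
  have hc : ∀ k, Continuous fun θ : ℝ => ex k (θ - t) := fun k => (continuous_ex k).comp (by fun_prop)
  have : (∫ θ in (0:ℝ)..2 * π, fejer N (θ - t)) = 2 * π := by
    simp only [fejer, intervalIntegral.integral_const_mul]
    rw [intervalIntegral.integral_finsetSum fun j _ =>
      (continuous_finsetSum _ fun k _ => hc _).intervalIntegrable _ _]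
    simp_rw [intervalIntegral.integral_finsetSum fun k _ => (hc _).intervalIntegrable _ _,
      integral_ex_sub, sub_eq_zero, Nat.cast_inj]
    have : (N : ℂ) ≠ 0 := by exact_mod_cast hN.ne'
    rw [Finset.sum_congr rfl fun j hj => by rw [Finset.sum_ite_eq, if_pos hj]]
    simp; field_simp
  rw [← intervalIntegral.integral_congr fun θ _ => norm_fejer N (θ - t)] at this
  rw [intervalIntegral.integral_ofReal] at this
  exact_mod_cast this

/-- The Fejér means of a functional. -/
noncomputable def fejerMean (ℓ : CC →L[ℂ] ℂ) (N : ℕ) (θ : ℝ) : ℂ :=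
  (N : ℂ)⁻¹ * ∑ j ∈ Finset.range N, ∑ k ∈ Finset.range N,
    ex ((j : ℤ) - k) θ * ℓ (fourier ((k : ℤ) - j))

theorem continuous_fejerMean (ℓ : CC →L[ℂ] ℂ) (N : ℕ) : Continuous (fejerMean ℓ N) := by
  have := continuous_ex
  unfold fejerMean; fun_prop

theorem integral_mul_fejerMean (ℓ : CC →L[ℂ] ℂ) (N : ℕ) {s : ℝ → ℂ}
    (hs : IntervalIntegrable s volume 0 (2 * π)) :
    ∫ θ in (0:ℝ)..2 * π, s θ * fejerMean ℓ N θ = (N : ℂ)⁻¹ * ∑ j ∈ Finset.range N,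
      ∑ k ∈ Finset.range N, (∫ θ in (0:ℝ)..2 * π, s θ * ex ((j : ℤ) - k) θ) *
        ℓ (fourier ((k : ℤ) - j)) := by
  have hi : ∀ k, IntervalIntegrable (fun θ => s θ * ex k θ) volume 0 (2 * π) := fun k =>
    hs.mul_continuousOn (continuous_ex k).continuousOn
  simp_rw [fejerMean, mul_left_comm (s _), Finset.mul_sum _ _ (s _), ← mul_assoc (s _)]
  rw [intervalIntegral.integral_const_mul, integral_sum_sum N fun j k => (hi _).mul_const _]
  simp_rw [intervalIntegral.integral_mul_const]

theorem norm_integral_mul_fejerMean_le (ℓ : CC →L[ℂ] ℂ) {N : ℕ} (hN : 0 < N) {s : ℝ → ℂ}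
    (hs : IntervalIntegrable s volume 0 (2 * π)) {B : ℝ} (hB : ∀ θ, ‖s θ‖ ≤ B) :
    ‖∫ θ in (0:ℝ)..2 * π, s θ * fejerMean ℓ N θ‖ ≤ ‖ℓ‖ * (2 * π * B) := by
  have hi : ∀ k, IntervalIntegrable (fun θ => s θ * ex k θ) volume 0 (2 * π) := fun k =>
    hs.mul_continuousOn (continuous_ex k).continuousOn
  have hB0 : 0 ≤ B := (norm_nonneg _).trans (hB 0)
  set Φ : CC := (N : ℂ)⁻¹ • ∑ j ∈ Finset.range N, ∑ k ∈ Finset.range N,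
    (∫ θ in (0:ℝ)..2 * π, s θ * ex ((j : ℤ) - k) θ) • fourier ((k : ℤ) - j) with hΦ
  have h1 : ∫ θ in (0:ℝ)..2 * π, s θ * fejerMean ℓ N θ = ℓ Φ := by
    rw [integral_mul_fejerMean ℓ N hs, hΦ]
    simp [map_sum]
  rw [h1]
  refine (ℓ.le_opNorm Φ).trans (mul_le_mul_of_nonneg_left ?_ (norm_nonneg _))
  refine (ContinuousMap.norm_le _ (by positivity)).2 fun x => ?_
  induction x using QuotientAddGroup.induction_on with | H t => ?_
  have h2 : Φ (t : AddCircle (2 * π)) = ∫ θ in (0:ℝ)..2 * π, s θ * fejer N (θ - t) := by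
    simp_rw [fejer, mul_left_comm (s _), Finset.mul_sum _ _ (s _), ex_sub_arg, ← mul_assoc (s _)]
    rw [intervalIntegral.integral_const_mul, integral_sum_sum N fun j k => (hi _).mul_const _]
    simp_rw [intervalIntegral.integral_mul_const]
    simp only [hΦ, ContinuousMap.smul_apply, ContinuousMap.sum_apply, smul_eq_mul, fourier_eq_ex,
      neg_sub]
  rw [h2]
  have hfc : Continuous fun θ : ℝ => fejer N (θ - t) := by
    have := continuous_ex
    unfold fejer; fun_prop
  calc _ ≤ ∫ θ in (0:ℝ)..2 * π, ‖s θ * fejer N (θ - t)‖ :=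
        intervalIntegral.norm_integral_le_integral_norm Real.two_pi_pos.le
    _ ≤ ∫ θ in (0:ℝ)..2 * π, B * ‖fejer N (θ - t)‖ := by
        refine intervalIntegral.integral_mono Real.two_pi_pos.le
          (hs.mul_continuousOn hfc.continuousOn).norm
          ((by fun_prop : Continuous _).intervalIntegrable _ _) fun θ => ?_
        rw [norm_mul]; exact mul_le_mul_of_nonneg_right (hB θ) (norm_nonneg _)
    _ = 2 * π * B := by
        rw [intervalIntegral.integral_const_mul, integral_norm_fejer hN]; ring

theorem integral_norm_fejerMean_le (ℓ : CC →L[ℂ] ℂ) {N : ℕ} (hN : 0 < N) :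
    ∫ θ in (0:ℝ)..2 * π, ‖fejerMean ℓ N θ‖ ≤ ‖ℓ‖ * (2 * π) := by
  set H := fejerMean ℓ N
  have hHc : Continuous H := continuous_fejerMean ℓ N
  set s : ℝ → ℂ := fun θ => conj (H θ) / ‖H θ‖ with hs
  have hsB : ∀ θ, ‖s θ‖ ≤ 1 := fun θ => by
    rw [hs]; simp only [norm_div, RCLike.norm_conj, norm_real, norm_norm]
    exact div_self_le_one _
  have hsm : Measurable s := by
    have := hHc.measurable
    exact ((continuous_conj.measurable.comp this)).div (by fun_prop)
  have hsi : IntervalIntegrable s volume 0 (2 * π) := by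
    refine (intervalIntegrable_const (c := (1:ℝ))).mono_fun hsm.aestronglyMeasurable ?_
    filter_upwards with θ; simpa using hsB θ
  have h := norm_integral_mul_fejerMean_le ℓ hN hsi hsB
  have h2 : ∀ θ, s θ * fejerMean ℓ N θ = ((‖H θ‖ : ℝ) : ℂ) := fun θ => by
    change conj (H θ) / ‖H θ‖ * H θ = _
    by_cases h0 : H θ = 0
    · simp [h0]
    · have : (‖H θ‖ : ℂ) ≠ 0 := by simpa using h0
      rw [div_mul_eq_mul_div, conj_mul']; field_simp
  simp_rw [h2] at h
  rw [intervalIntegral.integral_ofReal, norm_real, mul_one] at h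
  exact (le_abs_self _).trans h

theorem card_bound (N : ℕ) (m : ℤ) :
    |(∑ j ∈ Finset.range N, ∑ k ∈ Finset.range N, if (k : ℤ) - j = m then (1:ℝ) else 0) - N| ≤
      |(m : ℝ)| := by
  have h1 : ∀ j : ℕ, (∑ k ∈ Finset.range N, if (k : ℤ) - j = m then (1:ℝ) else 0) =
      if 0 ≤ m + j ∧ m + j < N then 1 else 0 := fun j => by
    split_ifs with h
    · rw [Finset.sum_eq_single (m + j).toNat]
      · rw [if_pos (by omega)]
      · intro b _ hb; rw [if_neg (by omega)]
      · intro hb; exact absurd (Finset.mem_range.2 (by omega)) hb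
    · refine Finset.sum_eq_zero fun k hk => if_neg ?_
      have := Finset.mem_range.1 hk
      omega
  simp_rw [h1]
  rw [← Finset.sum_filter, Finset.sum_const, nsmul_eq_mul, mul_one]
  have h2 : (Finset.range N).filter (fun j : ℕ => 0 ≤ m + j ∧ m + j < N) =
      Finset.Ico (-m).toNat (min N (N - m).toNat) := by
    ext j; simp only [Finset.mem_filter, Finset.mem_range, Finset.mem_Ico]; omega
  rw [h2, Nat.card_Ico]
  have h3 : |((min N (N - m).toNat - (-m).toNat : ℕ) : ℤ) - N| ≤ |m| := by
    rcases abs_cases m with h | h <;> rw [abs_le] <;> omega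
  exact_mod_cast h3

theorem integral_ex_mul_fejerMean (ℓ : CC →L[ℂ] ℂ) (m : ℤ) :
    Tendsto (fun N => ∫ θ in (0:ℝ)..2 * π, ex m θ * fejerMean ℓ N θ) atTop
      (𝓝 (2 * π * ℓ (fourier m))) := by
  have h1 : ∀ N, ∫ θ in (0:ℝ)..2 * π, ex m θ * fejerMean ℓ N θ =
      (((N : ℝ)⁻¹ * ∑ j ∈ Finset.range N, ∑ k ∈ Finset.range N,
        if (k : ℤ) - j = m then (1:ℝ) else 0 : ℝ) : ℂ) * (2 * π * ℓ (fourier m)) := fun N => by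
    rw [integral_mul_fejerMean ℓ N ((continuous_ex m).intervalIntegrable _ _)]
    push_cast
    rw [mul_assoc, Finset.sum_mul]
    congr 1
    refine Finset.sum_congr rfl fun j _ => ?_
    rw [Finset.sum_mul]
    refine Finset.sum_congr rfl fun k _ => ?_
    have h := integral_ex_sub (m + ((j : ℤ) - k)) 0
    simp only [sub_zero, ex_add m] at h
    rw [h]
    by_cases hm : (k : ℤ) - j = m
    · rw [if_pos (by omega), if_pos hm, hm]; simp
    · rw [if_neg (by omega), if_neg hm]; simp
  simp_rw [h1]
  have h2 : Tendsto (fun N : ℕ => (N : ℝ)⁻¹ * ∑ j ∈ Finset.range N, ∑ k ∈ Finset.range N,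
        if (k : ℤ) - j = m then (1:ℝ) else 0) atTop (𝓝 1) := by
    rw [tendsto_iff_norm_sub_tendsto_zero]
    refine squeeze_zero' (.of_forall fun _ => norm_nonneg _) ?_
      (tendsto_const_div_atTop_nhds_zero_nat |(m : ℝ)|)
    filter_upwards [eventually_gt_atTop 0] with N hN
    have hN' : (0:ℝ) < N := by exact_mod_cast hN
    have h := card_bound N m
    rw [Real.norm_eq_abs, le_div_iff₀ hN', ← abs_of_pos hN', ← abs_mul, abs_of_pos hN']
    refine le_trans (le_of_eq ?_) h
    congr 1; field_simp
  have h3 := (continuous_ofReal.tendsto (1:ℝ)).comp h2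
  simpa using h3.mul_const (2 * π * ℓ (fourier m))

theorem integral_mul_fejerMean_tendsto (ℓ : CC →L[ℂ] ℂ) (v : CC) :
    Tendsto (fun N => ∫ θ in (0:ℝ)..2 * π, v (θ : AddCircle (2 * π)) * fejerMean ℓ N θ) atTop
      (𝓝 (2 * π * ℓ v)) := by
  have hint : ∀ (w : CC) N, IntervalIntegrable
      (fun θ : ℝ => w (θ : AddCircle (2 * π)) * fejerMean ℓ N θ) volume 0 (2 * π) := fun w N =>
    ((w.continuous.comp (AddCircle.continuous_mk' _)).mul
      (continuous_fejerMean ℓ N)).intervalIntegrable _ _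
  have hspan : ∀ τ ∈ Submodule.span ℂ (range (fourier (T := 2 * π))),
      Tendsto (fun N => ∫ θ in (0:ℝ)..2 * π, τ (θ : AddCircle (2 * π)) * fejerMean ℓ N θ) atTop
      (𝓝 (2 * π * ℓ τ)) := fun τ hτ => by
    induction hτ using Submodule.span_induction with
    | mem x hx =>
      obtain ⟨m, rfl⟩ := hx
      simp_rw [fourier_eq_ex]
      exact integral_ex_mul_fejerMean ℓ m
    | zero => simp
    | add x y _ _ hx hy =>
      simp only [ContinuousMap.add_apply, add_mul, map_add, mul_add]
      simp_rw [intervalIntegral.integral_add (hint x _) (hint y _)]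
      exact hx.add hy
    | smul c x _ hx =>
      simp only [ContinuousMap.smul_apply, smul_eq_mul, mul_assoc, map_smul,
        intervalIntegral.integral_const_mul]
      have := hx.const_mul c
      convert this using 2; ring
  have hdense : v ∈ (Submodule.span ℂ (range (fourier (T := 2 * π)))).topologicalClosure := by
    rw [span_fourier_closure_eq_top]; trivial
  rw [← SetLike.mem_coe, Submodule.topologicalClosure_coe, mem_closure_iff_nhds_basis
    Metric.nhds_basis_ball] at hdense
  rw [Metric.tendsto_atTop]
  intro ε hε
  have hK : 0 < ‖ℓ‖ * (2 * π) + 1 := by positivity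
  obtain ⟨τ, hτ, hvτ⟩ := hdense (ε / 3 / (‖ℓ‖ * (2 * π) + 1)) (by positivity)
  rw [mem_ball, dist_eq_norm] at hvτ
  obtain ⟨N0, hN0⟩ := Metric.tendsto_atTop.1 (hspan τ hτ) (ε / 3) (by positivity)
  refine ⟨N0 + 1, fun N hN => ?_⟩
  have h1 := hN0 N (by omega)
  have hb : ‖τ - v‖ * (‖ℓ‖ * (2 * π) + 1) < ε / 3 := by
    rwa [lt_div_iff₀ hK] at hvτ
  have hb' : ‖ℓ‖ * (2 * π * ‖τ - v‖) ≤ ‖τ - v‖ * (‖ℓ‖ * (2 * π) + 1) := by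
    nlinarith [norm_nonneg (τ - v)]
  have h2 : ‖(∫ θ in (0:ℝ)..2 * π, τ (θ : AddCircle (2 * π)) * fejerMean ℓ N θ) -
      ∫ θ in (0:ℝ)..2 * π, v (θ : AddCircle (2 * π)) * fejerMean ℓ N θ‖ ≤
      ‖ℓ‖ * (2 * π * ‖τ - v‖) := by
    rw [← intervalIntegral.integral_sub (hint τ N) (hint v N)]
    simp_rw [← sub_mul]
    refine norm_integral_mul_fejerMean_le ℓ (by omega)
      (s := fun θ : ℝ => τ (θ : AddCircle (2 * π)) - v (θ : AddCircle (2 * π))) ?_ fun θ => ?_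
    · exact (((τ - v).continuous).comp (AddCircle.continuous_mk' _)).intervalIntegrable _ _
    · exact (τ - v).norm_coe_le_norm _
  have h3 : ‖2 * (π : ℂ) * ℓ τ - 2 * π * ℓ v‖ ≤ ‖ℓ‖ * (2 * π * ‖τ - v‖) := by
    rw [← mul_sub, ← map_sub, norm_mul]
    have : ‖2 * (π : ℂ)‖ = 2 * π := by simp [abs_of_pos Real.pi_pos]
    rw [this]
    nlinarith [ℓ.le_opNorm (τ - v), Real.pi_pos]
  rw [dist_eq_norm] at h1 ⊢
  calc _ = ‖-((∫ θ in (0:ℝ)..2 * π, τ (θ : AddCircle (2 * π)) * fejerMean ℓ N θ) -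
      ∫ θ in (0:ℝ)..2 * π, v (θ : AddCircle (2 * π)) * fejerMean ℓ N θ) +
      ((∫ θ in (0:ℝ)..2 * π, τ (θ : AddCircle (2 * π)) * fejerMean ℓ N θ) - 2 * π * ℓ τ) +
      (2 * (π : ℂ) * ℓ τ - 2 * π * ℓ v)‖ := by congr 1; ring
    _ < ε := by
      refine (norm_add₃_le).trans_lt ?_
      rw [norm_neg]; linarith

theorem fejerMean_eq_poly (ℓ : CC →L[ℂ] ℂ) (h0 : ∀ n : ℕ, ℓ (fourier n) = 0) (N : ℕ) :
    ∃ p : Polynomial ℂ, ∀ θ : ℝ, fejerMean ℓ N θ = cexp (θ * I) * p.eval (cexp (θ * I)) := by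
  refine ⟨Polynomial.C (N : ℂ)⁻¹ * ∑ j ∈ Finset.range N, ∑ k ∈ Finset.range N,
    Polynomial.C (ℓ (fourier ((k : ℤ) - j))) * Polynomial.X ^ (j - k - 1), fun θ => ?_⟩
  rw [fejerMean, Polynomial.eval_mul, Polynomial.eval_C, mul_left_comm, Polynomial.eval_finsetSum,
    Finset.mul_sum _ _ (cexp (θ * I))]
  congr 1
  refine Finset.sum_congr rfl fun j _ => ?_
  rw [Polynomial.eval_finsetSum, Finset.mul_sum]
  refine Finset.sum_congr rfl fun k _ => ?_
  simp only [Polynomial.eval_mul, Polynomial.eval_C, Polynomial.eval_pow, Polynomial.eval_X]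
  by_cases hjk : k < j
  · have : (j : ℤ) - k = ((j - k - 1 + 1 : ℕ) : ℤ) := by omega
    rw [this, ex_natCast, pow_succ]; ring
  · have : (k : ℤ) - j = ((k - j : ℕ) : ℤ) := by omega
    rw [this, h0]; simp

/-- Duality between `C(𝕋)/A` and `H¹₀`. -/
theorem exists_poly_near {v : ℂ → ℂ} (hv : ContinuousOn v (sphere 0 1)) {C : ℝ}
    (hC : ∀ p : Polynomial ℂ,
      ‖∫ θ in (0:ℝ)..2 * π, v (cexp (θ * I)) * (cexp (θ * I) * p.eval (cexp (θ * I)))‖ ≤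
        C * ∫ θ in (0:ℝ)..2 * π, ‖p.eval (cexp (θ * I))‖) :
    ∃ p : Polynomial ℂ, ∀ z ∈ sphere (0 : ℂ) 1, ‖v z + p.eval z‖ ≤ C + 1 := by
  have hC0 : 0 ≤ C := by
    have := hC (Polynomial.C 1)
    simp only [Polynomial.eval_C, norm_one, intervalIntegral.integral_const, sub_zero,
      smul_eq_mul, mul_one] at this
    have h2 := (norm_nonneg _).trans this
    exact nonneg_of_mul_nonneg_left h2 Real.two_pi_pos
  have hco : ∀ θ : ℝ, ((AddCircle.toCircle (θ : AddCircle (2 * π)) : Circle) : ℂ) =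
      cexp (θ * I) := fun θ => by
    rw [AddCircle.toCircle_apply_mk, Circle.coe_exp]; congr 2; push_cast; field_simp
  have hcirc : ∀ p : Polynomial ℂ, Continuous fun x : AddCircle (2 * π) =>
      p.eval ((AddCircle.toCircle x : Circle) : ℂ) := fun p =>
    p.continuous.comp (continuous_subtype_val.comp AddCircle.continuous_toCircle)
  let V : CC := ⟨fun x => v (AddCircle.toCircle x : Circle),
    hv.comp_continuous (continuous_subtype_val.comp AddCircle.continuous_toCircle) fun x => by
      rw [mem_sphere_zero_iff_norm]; exact Circle.norm_coe _⟩
  let Φ : Polynomial ℂ →ₗ[ℂ] CC :=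
    { toFun := fun p => ⟨_, hcirc p⟩
      map_add' := fun p q => by ext x; simp
      map_smul' := fun c p => by ext x; simp }
  let P := LinearMap.range Φ
  obtain ⟨g, hg1, hg2⟩ := exists_dual_vector'' ℂ (Submodule.Quotient.mk V : CC ⧸ P)
  let Q : CC →L[ℂ] CC ⧸ P := LinearMap.mkContinuous P.mkQ 1 fun x => by
    simpa using Submodule.Quotient.norm_mk_le P x
  let ℓ : CC →L[ℂ] ℂ := g.comp Q
  have hℓ1 : ‖ℓ‖ ≤ 1 := by
    refine (g.opNorm_comp_le Q).trans ?_
    exact mul_le_one₀ hg1 (norm_nonneg _) (LinearMap.mkContinuous_norm_le _ zero_le_one _)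
  have hℓ0 : ∀ n : ℕ, ℓ (fourier n) = 0 := fun n => by
    have hmem : fourier n ∈ P := by
      refine ⟨Polynomial.X ^ n, ?_⟩
      ext x
      simp [Φ, fourier_apply, AddCircle.toCircle_nsmul]
    change g (Submodule.Quotient.mk _) = 0
    rw [(Submodule.Quotient.mk_eq_zero P).2 hmem, map_zero]
  have hlim := (integral_mul_fejerMean_tendsto ℓ V).norm
  have hbound : ‖2 * (π : ℂ) * ℓ V‖ ≤ C * (2 * π) := by
    refine le_of_tendsto hlim ?_
    filter_upwards [eventually_gt_atTop 0] with N hN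
    obtain ⟨p, hp⟩ := fejerMean_eq_poly ℓ hℓ0 N
    have h1 := hC p
    have h2 := integral_norm_fejerMean_le ℓ hN
    simp_rw [hp, norm_mul, norm_exp_ofReal_mul_I, one_mul] at h2
    simp_rw [hp]
    have h3 : ∀ θ : ℝ, V (θ : AddCircle (2 * π)) = v (cexp (θ * I)) := fun θ => by
      simp only [V, ContinuousMap.coe_mk, hco]
    simp_rw [h3]
    refine h1.trans (mul_le_mul_of_nonneg_left (h2.trans ?_) hC0)
    nlinarith [Real.pi_pos]
  have hnorm : ‖(Submodule.Quotient.mk V : CC ⧸ P)‖ ≤ C := by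
    have h1 : ℓ V = (‖(Submodule.Quotient.mk V : CC ⧸ P)‖ : ℂ) := hg2
    rw [h1] at hbound
    simp only [norm_mul, norm_real, Real.norm_eq_abs, abs_of_pos Real.pi_pos,
      Complex.norm_ofNat] at hbound
    have h2 := le_abs_self ‖(Submodule.Quotient.mk V : CC ⧸ P)‖
    nlinarith [Real.pi_pos]
  obtain ⟨w, hw, hw'⟩ := Submodule.Quotient.norm_mk_lt (Submodule.Quotient.mk V : CC ⧸ P) one_pos
  rw [Submodule.Quotient.eq] at hw
  obtain ⟨p, hp⟩ := hw
  refine ⟨p, fun z hz => ?_⟩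
  have hz1 : ‖z‖ = 1 := by simpa using hz
  have hwz : w (z.arg : AddCircle (2 * π)) = v z + p.eval z := by
    have h1 : (cexp (z.arg * I)) = z := by
      conv_rhs => rw [← norm_mul_exp_arg_mul_I z, hz1]
      simp
    have h2 := DFunLike.congr_fun hp (z.arg : AddCircle (2 * π))
    simp only [Φ, LinearMap.coe_mk, AddHom.coe_mk, ContinuousMap.coe_mk, ContinuousMap.sub_apply, V,
      hco, h1] at h2
    rw [h2]; ring
  rw [← hwz]
  exact (w.norm_coe_le_norm _).trans (by linarith)

theorem green {U a b c e : ℂ → ℂ} (hU : ContinuousOn U (closedBall 0 1))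
    (hb : ContinuousOn b (closedBall 0 1)) (hc : ContinuousOn c (closedBall 0 1))
    (hWU : ∀ z ∈ ball (0 : ℂ) 1, HasW U (a z) (b z) z)
    (hWb : ∀ z ∈ ball (0 : ℂ) 1, HasW b (c z) (e z) z) :
    ∫ z in ball (0 : ℂ) 1, ((1 - normSq z : ℝ) : ℂ) * c z =
      (∫ θ in (0 : ℝ)..2 * π, U (cexp (θ * I))) / 2 - ∫ z in ball (0 : ℂ) 1, U z := by
  have hint : ∀ {F : ℂ → ℂ}, ContinuousOn F (closedBall 0 1) → IntegrableOn F (ball 0 1) :=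
    fun h => (h.integrableOn_compact (isCompact_closedBall _ _)).mono_set ball_subset_closedBall
  have hx : Continuous fun z : ℂ => ((1 - normSq z : ℝ) : ℂ) := by fun_prop
  have hcj : Continuous fun z : ℂ => conj z := continuous_conj
  have h1 := integral_del_eq_zero (F := fun z => ((1 - normSq z : ℝ) : ℂ) * b z)
    (a := fun z => -(conj z * b z) + ((1 - normSq z : ℝ) : ℂ) * c z)
    (b := fun z => -z * b z + ((1 - normSq z : ℝ) : ℂ) * e z)
    (hx.continuousOn.mul hb) (fun z hz => by
      refine HasW.congr_coeff (HasW.mul (hasW_normSq (χ := fun s => 1 - s) (χ' := -1)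
        (by simpa using (hasDerivAt_id (normSq z)).const_sub 1) (hasDerivAt_id z)) (hWb z hz)) ?_ ?_
        <;> simp)
    (((hcj.continuousOn.mul hb).neg).add (hx.continuousOn.mul hc)) (fun z hz => by
      have : normSq z = 1 := by
        rw [normSq_eq_norm_sq]; simp only [mem_sphere, dist_zero_right] at hz; simp [hz]
      simp [this])
  have h2 := stokes (F := fun z => conj z * U z) (a := fun z => conj z * a z)
    (b := fun z => U z + conj z * b z) (hcj.continuousOn.mul hU) (fun z hz => by
      refine HasW.congr_coeff (HasW.mul (HasW.conj (hasW_id z)) (hWU z hz)) ?_ ?_ <;> simp)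
    (hU.add (hcj.continuousOn.mul hb))
  rw [integral_add (f := fun z => -(conj z * b z)) (g := fun z => ((1 - normSq z : ℝ) : ℂ) * c z)
    (hint (hcj.continuousOn.mul hb).neg) (hint (hx.continuousOn.mul hc)), integral_neg] at h1
  rw [integral_add (f := U) (g := fun z => conj z * b z) (hint hU)
    (hint (hcj.continuousOn.mul hb))] at h2
  have h3 : ∀ θ : ℝ, cexp (θ * I) * (conj (cexp (θ * I)) * U (cexp (θ * I))) = U (cexp (θ * I)) := by
    intro θ
    rw [← mul_assoc, mul_conj, normSq_eq_norm_sq, norm_exp_ofReal_mul_I]; simp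
  simp only [h3] at h2
  rw [h2]
  linear_combination h1

/-- Green's formula for `e^V √(|h|² + τ)`. -/
theorem uchiyama {V Q : ℂ → ℝ} {Vb e : ℂ → ℂ} {h : ℂ → ℂ} {τ : ℝ} (hτ : 0 < τ)
    (hh : Differentiable ℂ h)
    (hV : ContinuousOn V (closedBall 0 1)) (hVb : ContinuousOn Vb (closedBall 0 1))
    (hQ : ContinuousOn Q (closedBall 0 1))
    (hWV : ∀ z ∈ ball (0 : ℂ) 1, HasW (fun w => (V w : ℂ)) (conj (Vb z)) (Vb z) z)
    (hWb : ∀ z ∈ ball (0 : ℂ) 1, HasW Vb (Q z) (e z) z) :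
    ∫ z in ball (0 : ℂ) 1, (1 - normSq z) * (Real.exp (V z) * √(normSq (h z) + τ) *
        (normSq (Vb z + h z * conj (deriv h z) / (2 * (normSq (h z) + τ) : ℝ)) + Q z +
          τ * normSq (deriv h z) / (2 * (normSq (h z) + τ) ^ 2))) ≤
      (∫ θ in (0 : ℝ)..2 * π, Real.exp (V (cexp (θ * I))) *
        √(normSq (h (cexp (θ * I))) + τ)) / 2 := by
  have hApos : ∀ z, 0 < normSq (h z) + τ := fun z => by have := normSq_nonneg (h z); linarith
  have hhc := hh.continuous
  have hh' : Differentiable ℂ (deriv h) := hh.contDiff.differentiable_deriv_two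
  have hh'c := hh'.continuous
  set A : ℂ → ℝ := fun z => normSq (h z) + τ with hA
  have hAc : Continuous A := by fun_prop
  set U : ℂ → ℝ := fun z => Real.exp (V z) * √(A z) with hU
  set T : ℂ → ℂ := fun z => Vb z + h z * conj (deriv h z) / (2 * A z : ℝ) with hT
  set c : ℂ → ℝ := fun z => U z * (normSq (T z) + Q z +
    τ * normSq (deriv h z) / (2 * A z ^ 2)) with hc
  have hUc : ContinuousOn U (closedBall 0 1) :=
    (Real.continuous_exp.comp_continuousOn hV).mul (by fun_prop)
  have hTc : ContinuousOn T (closedBall 0 1) := by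
    refine hVb.add (Continuous.continuousOn (Continuous.div ?_ (by fun_prop) fun z => ?_))
    · exact hhc.mul (continuous_conj.comp hh'c)
    · exact_mod_cast (by have := hApos z; simp only [hA]; positivity : (2 * A z) ≠ 0)
  have hcc : ContinuousOn c (closedBall 0 1) := by
    refine hUc.mul (((continuous_normSq.comp_continuousOn hTc).add hQ).add
      (Continuous.continuousOn (Continuous.div (by fun_prop) (by fun_prop) fun z => ?_)))
    have := hApos z; simp only [hA]; positivity
  have hWA : ∀ z, HasW (fun w => (A w : ℂ)) (conj (h z) * deriv h z) (h z * conj (deriv h z)) z := by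
    intro z
    refine HasW.congr_coeff (hasW_normSq (χ := fun s => s + τ) (χ' := 1)
      (by simpa using (hasDerivAt_id (normSq (h z))).add_const τ) (hh z).hasDerivAt) ?_ ?_ <;> simp
  have hWU : ∀ z ∈ ball (0 : ℂ) 1, HasW (fun w => (U w : ℂ)) (U z * conj (T z)) (U z * T z) z := by
    intro z hz
    have hs := hasW_normSq (χ := fun s => √(s + τ)) (χ' := 1 / (2 * √(A z)))
      (by simpa using ((hasDerivAt_id (normSq (h z))).add_const τ).sqrt (hApos z).ne')
      (hh z).hasDerivAt
    have h1 := (HasW.hol_comp (Complex.hasDerivAt_exp _) (hWV z hz)).mul hs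
    have hsq : (√(A z) : ℂ) * √(A z) = A z := by
      exact_mod_cast Real.mul_self_sqrt (hApos z).le
    have hs0 : (√(A z) : ℂ) ≠ 0 := by exact_mod_cast (Real.sqrt_pos.2 (hApos z)).ne'
    refine HasW.congr_coeff (h1.congr (Eventually.of_forall fun w => ?_)) ?_ ?_
    · simp [hU, hA]
    · simp only [hU, hT, hA] at hsq hs0 ⊢
      push_cast at hsq hs0 ⊢
      simp only [map_add, map_div₀, map_mul, conj_conj, conj_ofReal, map_ofNat]
      rw [← hsq]; field_simp
    · simp only [hU, hT, hA] at hsq hs0 ⊢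
      push_cast at hsq hs0 ⊢
      rw [← hsq]; field_simp
  have hWT : ∀ z ∈ ball (0 : ℂ) 1, ∃ e', HasW T ((Q z + τ * normSq (deriv h z) / (2 * A z ^ 2) : ℝ)) e' z := by
    intro z hz
    have hA0 : (A z : ℂ) ≠ 0 := by exact_mod_cast (hApos z).ne'
    have h1 := (hWb z hz).add (HasW.div ((hasW_of_hasDerivAt (hh z).hasDerivAt).mul
      (HasW.conj (hasW_of_hasDerivAt (hh' z).hasDerivAt))) ((hasW_const 2 z).mul (hWA z))
      (mul_ne_zero two_ne_zero hA0))
    refine ⟨_, HasW.congr_coeff (h1.congr (Eventually.of_forall fun w => ?_)) ?_ rfl⟩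
    · simp [hT]
    · have e1 : (A z : ℂ) = h z * conj (h z) + τ := by simp [hA, mul_conj]
      have e2 : (normSq (deriv h z) : ℂ) = deriv h z * conj (deriv h z) := by simp [mul_conj]
      push_cast
      rw [e2]
      field_simp
      rw [e1]; simp; ring
  choose! e' he' using hWT
  have hg := green (U := fun z => (U z : ℂ)) (a := fun z => U z * conj (T z))
    (b := fun z => U z * T z) (c := fun z => (c z : ℂ))
    (continuous_ofReal.comp_continuousOn hUc)
    ((continuous_ofReal.comp_continuousOn hUc).mul hTc)
    (continuous_ofReal.comp_continuousOn hcc) hWU (e := fun z => U z * T z * T z + U z * e' z)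
    (fun z hz => by
      refine HasW.congr_coeff ((hWU z hz).mul (he' z hz)) ?_ rfl
      simp only [hc]; push_cast
      rw [← mul_conj (T z)]; ring)
  have hg' : ∫ z in ball (0 : ℂ) 1, (1 - normSq z) * c z =
      (∫ θ in (0 : ℝ)..2 * π, U (cexp (θ * I))) / 2 - ∫ z in ball (0 : ℂ) 1, U z := by
    have := hg
    simp only [← ofReal_mul] at this
    rw [intervalIntegral.integral_ofReal, integral_complex_ofReal, integral_complex_ofReal] at this
    exact_mod_cast this
  have hUn : 0 ≤ ∫ z in ball (0 : ℂ) 1, U z :=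
    integral_nonneg fun z => by positivity
  have : ∫ z in ball (0 : ℂ) 1, (1 - normSq z) * c z ≤
    (∫ θ in (0 : ℝ)..2 * π, U (cexp (θ * I))) / 2 := by linarith
  exact this

theorem integrableOn_ball_of_continuousOn {E : Type*} [NormedAddCommGroup E] {F : ℂ → E}
    (h : ContinuousOn F (closedBall 0 1)) : IntegrableOn F (ball 0 1) :=
  (h.integrableOn_compact (isCompact_closedBall _ _)).mono_set ball_subset_closedBall

theorem one_sub_normSq_nonneg {z : ℂ} (hz : z ∈ ball (0 : ℂ) 1) : 0 ≤ 1 - normSq z := by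
  rw [normSq_eq_norm_sq]; simp only [mem_ball, dist_zero_right] at hz
  nlinarith [norm_nonneg z]

theorem le_of_sqrt_limit {h : ℂ → ℂ} (hh : Continuous h) {X K : ℝ} (hK : 0 ≤ K)
    (H : ∀ τ : ℝ, 0 < τ →
      X ≤ K * ∫ θ in (0 : ℝ)..2 * π, √(normSq (h (cexp (θ * I))) + τ)) :
    X ≤ K * ∫ θ in (0 : ℝ)..2 * π, ‖h (cexp (θ * I))‖ := by
  have h1 : ∀ s : ℝ, 0 < s → X ≤ K * (∫ θ in (0 : ℝ)..2 * π, ‖h (cexp (θ * I))‖) + K * (2 * π * s) := by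
    intro s hs
    refine (H (s ^ 2) (by positivity)).trans ?_
    rw [← mul_add]
    refine mul_le_mul_of_nonneg_left ?_ hK
    have hc : Continuous fun θ : ℝ => ‖h (cexp (θ * I))‖ := by fun_prop
    have : ∫ θ in (0 : ℝ)..2 * π, (‖h (cexp (θ * I))‖ + s) =
        (∫ θ in (0 : ℝ)..2 * π, ‖h (cexp (θ * I))‖) + 2 * π * s := by
      rw [intervalIntegral.integral_add (hc.intervalIntegrable _ _) (by simp)]; simp
    rw [← this]
    refine intervalIntegral.integral_mono_on Real.two_pi_pos.le
      (Continuous.intervalIntegrable (by fun_prop) _ _)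
      (Continuous.intervalIntegrable (by fun_prop) _ _) fun θ _ => ?_
    rw [normSq_eq_norm_sq]
    refine Real.sqrt_le_iff.2 ⟨by positivity, ?_⟩
    nlinarith [norm_nonneg (h (cexp (θ * I)))]
  have hc : Continuous fun s : ℝ =>
      K * (∫ θ in (0 : ℝ)..2 * π, ‖h (cexp (θ * I))‖) + K * (2 * π * s) := by fun_prop
  have ht := (hc.tendsto 0).mono_left (nhdsWithin_le_nhds (s := Ioi 0))
  simp only [mul_zero, add_zero] at ht
  exact ge_of_tendsto ht (eventually_nhdsWithin_of_forall fun s hs => h1 s hs)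

theorem uchiyama_weight {V Q : ℂ → ℝ} {Vb e : ℂ → ℂ} {h : ℂ → ℂ} {τ B : ℝ} (hτ : 0 < τ)
    (hh : Differentiable ℂ h)
    (hV : ContinuousOn V (closedBall 0 1)) (hVb : ContinuousOn Vb (closedBall 0 1))
    (hQ : ContinuousOn Q (closedBall 0 1))
    (hWV : ∀ z ∈ ball (0 : ℂ) 1, HasW (fun w => (V w : ℂ)) (conj (Vb z)) (Vb z) z)
    (hWb : ∀ z ∈ ball (0 : ℂ) 1, HasW Vb (Q z) (e z) z)
    (hQ0 : ∀ z ∈ ball (0 : ℂ) 1, 0 ≤ Q z) (hV1 : ∀ z ∈ closedBall (0 : ℂ) 1, V z ≤ 0)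
    (hV2 : ∀ z ∈ closedBall (0 : ℂ) 1, -B ≤ V z) :
    ∫ z in ball (0 : ℂ) 1, (1 - normSq z) * (Q z * √(normSq (h z) + τ)) ≤
      Real.exp B / 2 * ∫ θ in (0 : ℝ)..2 * π, √(normSq (h (cexp (θ * I))) + τ) := by
  have hu := uchiyama hτ hh hV hVb hQ hWV hWb
  have hApos : ∀ z, 0 < normSq (h z) + τ := fun z => by have := normSq_nonneg (h z); linarith
  have hhc := hh.continuous
  have hh'c := hh.contDiff.differentiable_deriv_two.continuous
  have hEV : ContinuousOn (fun z => Real.exp (V z)) (closedBall 0 1) :=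
    Real.continuous_exp.comp_continuousOn hV
  have h1 : ∫ z in ball (0 : ℂ) 1, Real.exp (-B) * ((1 - normSq z) * (Q z * √(normSq (h z) + τ))) ≤
      ∫ z in ball (0 : ℂ) 1, (1 - normSq z) * (Real.exp (V z) * √(normSq (h z) + τ) *
        (normSq (Vb z + h z * conj (deriv h z) / (2 * (normSq (h z) + τ) : ℝ)) + Q z +
          τ * normSq (deriv h z) / (2 * (normSq (h z) + τ) ^ 2))) := by
    refine setIntegral_mono_on (integrableOn_ball_of_continuousOn ?_)
      (integrableOn_ball_of_continuousOn ?_) measurableSet_ball fun z hz => ?_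
    · exact continuousOn_const.mul (ContinuousOn.mul (by fun_prop) (hQ.mul (by fun_prop)))
    · refine ContinuousOn.mul (by fun_prop) ((hEV.mul (by fun_prop)).mul
        (((continuous_normSq.comp_continuousOn (hVb.add (Continuous.continuousOn
          (Continuous.div ?_ (by fun_prop) fun z => ?_)))).add hQ).add
        (Continuous.continuousOn (Continuous.div (by fun_prop) (by fun_prop) fun z => ?_))))
      · exact hhc.mul (continuous_conj.comp hh'c)
      · exact_mod_cast (mul_pos two_pos (hApos z)).ne'
      · have := hApos z; positivity
    · rw [mul_left_comm]
      refine mul_le_mul_of_nonneg_left ?_ (one_sub_normSq_nonneg hz)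
      have e1 : Real.exp (-B) ≤ Real.exp (V z) :=
        Real.exp_le_exp.2 (hV2 z (ball_subset_closedBall hz))
      have e2 := hApos z
      have e3 := normSq_nonneg (Vb z + h z * conj (deriv h z) / (2 * (normSq (h z) + τ) : ℝ))
      have e4 : 0 ≤ τ * normSq (deriv h z) / (2 * (normSq (h z) + τ) ^ 2) := by
        have := normSq_nonneg (deriv h z); positivity
      have e5 := hQ0 z hz
      calc Real.exp (-B) * (Q z * √(normSq (h z) + τ))
          ≤ Real.exp (V z) * (Q z * √(normSq (h z) + τ)) := by gcongr
        _ = Real.exp (V z) * √(normSq (h z) + τ) * Q z := by ring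
        _ ≤ _ := mul_le_mul_of_nonneg_left (by linarith) (by positivity)
  have h2 : ∫ θ in (0 : ℝ)..2 * π, Real.exp (V (cexp (θ * I))) * √(normSq (h (cexp (θ * I))) + τ) ≤
      ∫ θ in (0 : ℝ)..2 * π, √(normSq (h (cexp (θ * I))) + τ) := by
    have hmem : ∀ θ : ℝ, cexp (θ * I) ∈ closedBall (0 : ℂ) 1 := fun θ => by
      simp [norm_exp_ofReal_mul_I]
    refine intervalIntegral.integral_mono_on Real.two_pi_pos.le
      (Continuous.intervalIntegrable (Continuous.mul
        (hEV.comp_continuous (by fun_prop) hmem) (by fun_prop)) _ _)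
      (Continuous.intervalIntegrable (by fun_prop) _ _) fun θ _ => ?_
    exact mul_le_of_le_one_left (Real.sqrt_nonneg _) (Real.exp_le_one_iff.2 (hV1 _ (hmem θ)))
  rw [integral_const_mul] at h1
  have h3 := (h1.trans hu).trans (div_le_div_of_nonneg_right h2 zero_le_two)
  have := mul_le_mul_of_nonneg_left h3 (Real.exp_pos B).le
  rw [← mul_assoc, ← Real.exp_add] at this
  simp only [add_neg_cancel, Real.exp_zero, one_mul] at this
  linarith

/-- Littlewood-Paley type inequality for `√(|h|² + τ)`. -/
theorem integral_deriv_sqrt_le {h : ℂ → ℂ} {τ : ℝ} (hτ : 0 < τ) (hh : Differentiable ℂ h) :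
    ∫ z in ball (0 : ℂ) 1, (1 - normSq z) * (normSq (deriv h z) / √(normSq (h z) + τ)) ≤
      2 * ∫ θ in (0 : ℝ)..2 * π, √(normSq (h (cexp (θ * I))) + τ) := by
  have hu := uchiyama (V := fun _ => 0) (Q := fun _ => 0) (Vb := fun _ => 0) (e := fun _ => 0) hτ hh
    continuousOn_const continuousOn_const continuousOn_const
    (fun z _ => by simpa using hasW_const 0 z) (fun z _ => by simpa using hasW_const 0 z)
  simp only [Real.exp_zero, one_mul, zero_add, add_zero] at hu
  have hApos : ∀ z, 0 < normSq (h z) + τ := fun z => by have := normSq_nonneg (h z); linarith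
  have hhc := hh.continuous
  have hh'c := hh.contDiff.differentiable_deriv_two.continuous
  have h1 : ∫ z in ball (0 : ℂ) 1, (1 / 4 : ℝ) * ((1 - normSq z) * (normSq (deriv h z) / √(normSq (h z) + τ))) ≤
      (∫ θ in (0 : ℝ)..2 * π, √(normSq (h (cexp (θ * I))) + τ)) / 2 := by
    refine le_trans (setIntegral_mono_on (integrableOn_ball_of_continuousOn
      (Continuous.continuousOn ?_))
      (integrableOn_ball_of_continuousOn (Continuous.continuousOn ?_)) measurableSet_ball
      fun z hz => ?_) hu
    · refine continuous_const.mul (Continuous.mul (by fun_prop) (Continuous.div (by fun_prop)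
        (by fun_prop) fun z => ?_))
      exact (Real.sqrt_pos.2 (hApos z)).ne'
    · refine Continuous.mul (by fun_prop) (Continuous.mul (by fun_prop) (Continuous.add
        (continuous_normSq.comp (Continuous.div ?_ (by fun_prop) fun z => ?_))
        (Continuous.div (by fun_prop) (by fun_prop) fun z => ?_)))
      · exact hhc.mul (continuous_conj.comp hh'c)
      · exact_mod_cast (mul_pos two_pos (hApos z)).ne'
      · have := hApos z; positivity
    · rw [mul_left_comm]
      refine mul_le_mul_of_nonneg_left ?_ (one_sub_normSq_nonneg hz)
      have e2 := hApos z
      have e3 := normSq_nonneg (h z)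
      have e4 := normSq_nonneg (deriv h z)
      set s := √(normSq (h z) + τ) with hs
      have hs0 : 0 < s := Real.sqrt_pos.2 e2
      have hs2 : normSq (h z) + τ = s ^ 2 := (Real.sq_sqrt e2.le).symm
      rw [map_div₀, map_mul, normSq_conj, normSq_ofReal, hs2]
      have : s * (normSq (h z) * normSq (deriv h z) / (2 * s ^ 2 * (2 * s ^ 2)) +
          τ * normSq (deriv h z) / (2 * (s ^ 2) ^ 2)) =
          normSq (deriv h z) / s ^ 3 * (s ^ 2 + τ) / 4 := by
        rw [show normSq (h z) = s ^ 2 - τ by linarith]; field_simp; ring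
      rw [this]
      have h5 : 1 / 4 * (normSq (deriv h z) / s) = normSq (deriv h z) / s ^ 3 * s ^ 2 / 4 := by
        field_simp
      rw [h5]
      have : 0 ≤ normSq (deriv h z) / s ^ 3 := by positivity
      nlinarith
  rw [integral_const_mul] at h1
  linarith

theorem continuous_normSq_deriv_div {h : ℂ → ℂ} {τ : ℝ} (hτ : 0 < τ) (hh : Differentiable ℂ h) :
    Continuous fun z => normSq (deriv h z) / √(normSq (h z) + τ) := by
  have hhc := hh.continuous
  have hh'c := hh.contDiff.differentiable_deriv_two.continuous
  exact Continuous.div (by fun_prop) (by fun_prop) fun z =>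
    (Real.sqrt_pos.2 (by have := normSq_nonneg (h z); linarith)).ne'

/-- Carleson embedding for `(1 - |z|²)|g'|²`, `g` in the unit ball of the disk algebra. -/
theorem integral_deriv_sq_weight_le {g h : ℂ → ℂ} {τ : ℝ} (hτ : 0 < τ) (hh : Differentiable ℂ h)
    {g' g'' : ℂ → ℂ} (hg : ∀ z ∈ closedBall (0 : ℂ) 1, HasDerivAt g (g' z) z)
    (hg' : ∀ z ∈ closedBall (0 : ℂ) 1, HasDerivAt g' (g'' z) z)
    (hg1 : ∀ z ∈ closedBall (0 : ℂ) 1, ‖g z‖ ≤ 1) :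
    ∫ z in ball (0 : ℂ) 1, (1 - normSq z) * (normSq (g' z) * √(normSq (h z) + τ)) ≤
      2 * ∫ θ in (0 : ℝ)..2 * π, √(normSq (h (cexp (θ * I))) + τ) := by
  have hgc : ContinuousOn g (closedBall 0 1) := fun z hz => (hg z hz).continuousAt.continuousWithinAt
  have hg'c : ContinuousOn g' (closedBall 0 1) :=
    fun z hz => (hg' z hz).continuousAt.continuousWithinAt
  have hw := uchiyama_weight (V := fun z => normSq (g z) - 1) (Q := fun z => normSq (g' z))
    (Vb := fun z => g z * conj (g' z)) (e := fun z => g z * conj (g'' z)) (B := 1) hτ hh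
    ((continuous_normSq.comp_continuousOn hgc).sub continuousOn_const)
    (hgc.mul (continuous_conj.comp_continuousOn hg'c))
    (continuous_normSq.comp_continuousOn hg'c)
    (fun z hz => by
      have hz := ball_subset_closedBall hz
      refine HasW.congr_coeff (hasW_normSq (χ := fun s => s - 1) (χ' := 1)
        (by simpa using (hasDerivAt_id (normSq (g z))).sub_const 1) (hg z hz)) ?_ ?_ <;> simp)
    (fun z hz => by
      have hz := ball_subset_closedBall hz
      refine HasW.congr_coeff ((hasW_of_hasDerivAt (hg z hz)).mul
        (HasW.conj (hasW_of_hasDerivAt (hg' z hz)))) ?_ ?_ <;> simp [mul_conj])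
    (fun z _ => normSq_nonneg _)
    (fun z hz => by have := hg1 z hz; rw [normSq_eq_norm_sq]; nlinarith [norm_nonneg (g z)])
    (fun z hz => by have := normSq_nonneg (g z); linarith)
  refine hw.trans (mul_le_mul_of_nonneg_right ?_ (intervalIntegral.integral_nonneg
    Real.two_pi_pos.le fun θ _ => Real.sqrt_nonneg _))
  have := Real.exp_one_lt_d9
  linarith

/-- Wolff's estimate. -/
theorem wolff {g h G a b g' g'' : ℂ → ℂ} (hh : Differentiable ℂ h)
    (hg : ∀ z ∈ closedBall (0 : ℂ) 1, HasDerivAt g (g' z) z)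
    (hg' : ∀ z ∈ closedBall (0 : ℂ) 1, HasDerivAt g' (g'' z) z)
    (hg1 : ∀ z ∈ closedBall (0 : ℂ) 1, ‖g z‖ ≤ 1)
    (hG : ∀ z ∈ closedBall (0 : ℂ) 1, HasW G (a z) (b z) z)
    (ha : ContinuousOn a (closedBall 0 1)) {C₁ C₂ : ℝ} (hC₁ : 0 ≤ C₁) (hC₂ : 0 ≤ C₂)
    (hGb : ∀ z ∈ ball (0 : ℂ) 1, ‖G z‖ ≤ C₁ * ‖g' z‖)
    (hab : ∀ z ∈ ball (0 : ℂ) 1, ‖a z‖ ≤ C₂ * ‖g' z‖ ^ 2) :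
    ‖∫ z in ball (0 : ℂ) 1, G z * h z‖ ≤
      (10 * C₁ + 2 * C₂) * ∫ θ in (0 : ℝ)..2 * π, ‖h (cexp (θ * I))‖ := by
  have hhc := hh.continuous
  have hh' : Differentiable ℂ (deriv h) := hh.contDiff.differentiable_deriv_two
  have hh'c := hh'.continuous
  have hGc : ContinuousOn G (closedBall 0 1) :=
    fun z hz => (hG z hz).continuousAt.continuousWithinAt
  have hg'c : ContinuousOn g' (closedBall 0 1) :=
    fun z hz => (hg' z hz).continuousAt.continuousWithinAt
  refine le_of_sqrt_limit hhc (by positivity) fun τ hτ => ?_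
  set S := ∫ θ in (0 : ℝ)..2 * π, √(normSq (h (cexp (θ * I))) + τ) with hS
  have hApos : ∀ z, 0 < normSq (h z) + τ := fun z => by have := normSq_nonneg (h z); linarith
  have I1 := integral_deriv_sq_weight_le hτ hh hg hg' hg1
  have I2 := integral_deriv_sq_weight_le (g := fun z => z) (g' := fun _ => 1) (g'' := fun _ => 0)
    hτ hh (fun z _ => hasDerivAt_id z) (fun z _ => hasDerivAt_const z 1)
    (fun z hz => by simpa using hz)
  have I3 := integral_deriv_sqrt_le hτ hh
  have hx : Continuous fun z : ℂ => 1 - normSq z := by fun_prop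
  have h1 := integral_del_eq_zero (F := fun z => ((1 - normSq z : ℝ) : ℂ) * (G z * (z * h z)))
    (a := fun z => -(normSq z * (G z * h z)) + ((1 - normSq z : ℝ) : ℂ) *
      (a z * (z * h z) + G z * (h z + z * deriv h z)))
    (b := fun z => -z * (G z * (z * h z)) + ((1 - normSq z : ℝ) : ℂ) * (b z * (z * h z)))
    ((continuous_ofReal.comp hx).continuousOn.mul (hGc.mul (by fun_prop))) (fun z hz => by
      refine HasW.congr_coeff (HasW.mul (hasW_normSq (χ := fun s => 1 - s) (χ' := -1)
        (by simpa using (hasDerivAt_id (normSq z)).const_sub 1) (hasDerivAt_id z))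
        ((hG z (ball_subset_closedBall hz)).mul ((hasW_id z).mul
          (hasW_of_hasDerivAt (hh z).hasDerivAt)))) ?_ ?_
      · simp [← mul_conj]; ring
      · simp)
    (((by fun_prop : Continuous fun z : ℂ => (normSq z : ℂ)).continuousOn.mul
      (hGc.mul (by fun_prop))).neg.add ((continuous_ofReal.comp hx).continuousOn.mul
        ((ha.mul (by fun_prop)).add (hGc.mul (by fun_prop))))) (fun z hz => by
      have : normSq z = 1 := by
        rw [normSq_eq_norm_sq]; simp only [mem_sphere, dist_zero_right] at hz; simp [hz]
      simp [this])
  have h2 : ∫ z in ball (0 : ℂ) 1, G z * h z =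
      ∫ z in ball (0 : ℂ) 1, ((1 - normSq z : ℝ) : ℂ) *
        (G z * h z + a z * (z * h z) + G z * (h z + z * deriv h z)) := by
    have j1 : ContinuousOn (fun z => G z * h z) (closedBall 0 1) := hGc.mul hhc.continuousOn
    have j2 : ContinuousOn (fun z => ((1 - normSq z : ℝ) : ℂ) *
        (G z * h z + a z * (z * h z) + G z * (h z + z * deriv h z))) (closedBall 0 1) :=
      (continuous_ofReal.comp hx).continuousOn.mul
        ((j1.add (ha.mul (by fun_prop))).add (hGc.mul (by fun_prop)))
    have j3 := integral_sub (integrableOn_ball_of_continuousOn j2)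
      (integrableOn_ball_of_continuousOn j1)
    have j4 : ∀ z, ((1 - normSq z : ℝ) : ℂ) *
        (G z * h z + a z * (z * h z) + G z * (h z + z * deriv h z)) - G z * h z =
        -(normSq z * (G z * h z)) + ((1 - normSq z : ℝ) : ℂ) *
          (a z * (z * h z) + G z * (h z + z * deriv h z)) := fun z => by push_cast; ring
    simp only [j4] at j3
    rw [h1] at j3
    exact (sub_eq_zero.1 j3.symm).symm
  rw [h2]
  have cs : ContinuousOn (fun z => (1 - normSq z) * (normSq (g' z) * √(normSq (h z) + τ)))
      (closedBall 0 1) :=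
    hx.continuousOn.mul ((continuous_normSq.comp_continuousOn hg'c).mul (by fun_prop))
  have c2 : ContinuousOn (fun z : ℂ => (1 - normSq z) * (normSq (1 : ℂ) * √(normSq (h z) + τ)))
      (closedBall 0 1) := by fun_prop
  have c3 : ContinuousOn (fun z => (1 - normSq z) * (normSq (deriv h z) / √(normSq (h z) + τ)))
      (closedBall 0 1) := hx.continuousOn.mul (continuous_normSq_deriv_div hτ hh).continuousOn
  have i1 := (integrableOn_ball_of_continuousOn cs).const_mul (3 / 2 * C₁ + C₂)
  have i2 := (integrableOn_ball_of_continuousOn c2).const_mul C₁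
  have i3 := (integrableOn_ball_of_continuousOn c3).const_mul (1 / 2 * C₁)
  refine (norm_integral_le_of_norm_le ((i1.add i2).add i3)
    (ae_restrict_of_forall_mem measurableSet_ball fun z hz => ?_)).trans ?_
  · have e0 := one_sub_normSq_nonneg hz
    have e1 : ‖z‖ ≤ 1 := by simpa using (ball_subset_closedBall hz)
    have e2 := hGb z hz
    have e3 := hab z hz
    have e4 := hApos z
    set s := √(normSq (h z) + τ) with hs
    have hs0 : 0 < s := Real.sqrt_pos.2 e4
    have e5 : ‖h z‖ ≤ s := Real.le_sqrt_of_sq_le (by rw [normSq_eq_norm_sq]; linarith)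
    simp only [Pi.add_apply, ← hs]
    simp only [normSq_eq_norm_sq, norm_one, one_pow, one_mul] at e0 ⊢
    rw [norm_mul, norm_real, Real.norm_eq_abs, abs_of_nonneg e0]
    have : ‖G z * h z + a z * (z * h z) + G z * (h z + z * deriv h z)‖ ≤
        C₁ * ‖g' z‖ * s + C₂ * ‖g' z‖ ^ 2 * s + C₁ * ‖g' z‖ * (s + ‖deriv h z‖) := by
      refine (norm_add₃_le).trans ?_
      simp only [norm_mul]
      gcongr
      · exact (mul_le_of_le_one_left (norm_nonneg _) e1).trans e5
      · refine (norm_add_le _ _).trans ?_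
        rw [norm_mul]
        exact add_le_add e5 (mul_le_of_le_one_left (norm_nonneg _) e1)
    refine (mul_le_mul_of_nonneg_left this e0).trans ?_
    have k1 : 2 * ‖g' z‖ ≤ 1 + ‖g' z‖ ^ 2 := by nlinarith [sq_nonneg (‖g' z‖ - 1)]
    have k2 : 2 * (‖g' z‖ * ‖deriv h z‖) ≤ ‖g' z‖ ^ 2 * s + ‖deriv h z‖ ^ 2 / s := by
      rw [← sub_nonneg]
      have : ‖g' z‖ ^ 2 * s + ‖deriv h z‖ ^ 2 / s - 2 * (‖g' z‖ * ‖deriv h z‖) =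
          (‖g' z‖ * s - ‖deriv h z‖) ^ 2 / s := by field_simp; ring
      rw [this]; positivity
    have k3 : C₁ * ‖g' z‖ * s + C₂ * ‖g' z‖ ^ 2 * s + C₁ * ‖g' z‖ * (s + ‖deriv h z‖) ≤
        (3 / 2 * C₁ + C₂) * (‖g' z‖ ^ 2 * s) + C₁ * s + 1 / 2 * C₁ * (‖deriv h z‖ ^ 2 / s) := by
      nlinarith [mul_le_mul_of_nonneg_left k2 hC₁,
        mul_le_mul_of_nonneg_left k1 (mul_nonneg hC₁ hs0.le)]
    nlinarith [mul_le_mul_of_nonneg_left k3 e0]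
  · rw [integral_add' (i1.add i2) i3, integral_add' i1 i2, integral_const_mul, integral_const_mul,
      integral_const_mul]
    have hS0 : 0 ≤ S := intervalIntegral.integral_nonneg Real.two_pi_pos.le
      fun θ _ => Real.sqrt_nonneg _
    nlinarith [mul_le_mul_of_nonneg_left I1 (by positivity : 0 ≤ 3 / 2 * C₁ + C₂),
      mul_le_mul_of_nonneg_left I2 hC₁, mul_le_mul_of_nonneg_left I3 (by positivity : 0 ≤ 1 / 2 * C₁),
      mul_nonneg hC₁ hS0]

theorem sum_log_one_add_le {T : ℝ} (hT : 0 ≤ T) (K : ℕ) :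
    ∑ k ∈ Finset.range K, Real.log (1 + T ^ 2 / ((k : ℝ) + 1) ^ 2) ≤ π * T := by
  rcases hT.eq_or_lt with rfl | hT
  · simp
  have hpos : ∀ k : ℕ, 1 ≤ 1 + T ^ 2 / ((k : ℝ) + 1) ^ 2 := fun k => by
    have : 0 ≤ T ^ 2 / ((k : ℝ) + 1) ^ 2 := by positivity
    linarith
  set P : ℕ → ℝ := fun n => ∏ k ∈ Finset.range n, (1 + T ^ 2 / ((k : ℝ) + 1) ^ 2) with hP
  have hP0 : ∀ n, 0 < P n := fun n => Finset.prod_pos fun k _ => by linarith [hpos k]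
  have hmono : Monotone P := monotone_nat_of_le_succ fun n => by
    simp only [hP, Finset.prod_range_succ]
    exact le_mul_of_one_le_right (hP0 n).le (hpos n)
  have hlim : Tendsto (fun n => π * T * P n) atTop (𝓝 (Real.sinh (π * T))) := by
    have h := (Complex.tendsto_euler_sin_prod (T * I)).norm
    have e1 : ‖Complex.sin (π * (T * I))‖ = Real.sinh (π * T) := by
      rw [show (π : ℂ) * (T * I) = ((π * T : ℝ) : ℂ) * I by push_cast; ring, Complex.sin_mul_I,
        ← Complex.ofReal_sinh]
      rw [norm_mul, norm_I, mul_one, norm_real, Real.norm_eq_abs,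
        abs_of_pos (Real.sinh_pos_iff.2 (mul_pos Real.pi_pos hT))]
    rw [e1] at h
    refine h.congr fun n => ?_
    have e2 : ∏ j ∈ Finset.range n, (1 - ((T : ℂ) * I) ^ 2 / ((j : ℂ) + 1) ^ 2) = (P n : ℂ) := by
      simp only [hP]; push_cast
      refine Finset.prod_congr rfl fun k _ => ?_
      rw [mul_pow, I_sq]; ring
    rw [e2]
    simp [abs_of_pos (hP0 n), abs_of_pos hT, abs_of_pos Real.pi_pos]
  have hle : π * T * P K ≤ Real.sinh (π * T) :=
    ge_of_tendsto hlim (eventually_atTop.2 ⟨K, fun n hn => by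
      have := hmono hn; have := Real.pi_pos; gcongr⟩)
  have hx : 0 < π * T := mul_pos Real.pi_pos hT
  have hs : Real.sinh (π * T) ≤ π * T * Real.exp (π * T) := by
    have h1 := Real.add_one_le_exp (-(2 * (π * T)))
    have h2 : Real.exp (-(2 * (π * T))) * Real.exp (π * T) = Real.exp (-(π * T)) := by
      rw [← Real.exp_add]; ring_nf
    rw [Real.sinh_eq]
    have := mul_le_mul_of_nonneg_right h1 (Real.exp_pos (π * T)).le
    nlinarith
  have hfin : P K ≤ Real.exp (π * T) := by
    have := hle.trans hs
    rwa [mul_le_mul_iff_right₀ hx] at this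
  rw [← Real.log_prod fun k _ => by linarith [hpos k]]
  exact (Real.log_le_iff_le_exp (hP0 K)).2 hfin

theorem normSq_moebius (w z : ℂ) :
    normSq (1 - conj w * z) = normSq (z - w) + (1 - normSq w) * (1 - normSq z) := by
  simp [normSq_apply]; ring

theorem one_sub_conj_mul_ne_zero {w z : ℂ} (hw : ‖w‖ < 1) (hz : ‖z‖ ≤ 1) : 1 - conj w * z ≠ 0 := by
  intro h
  have : ‖conj w * z‖ = 1 := by rw [← sub_eq_zero.1 h]; simp
  rw [norm_mul, norm_conj] at this
  nlinarith [norm_nonneg w, norm_nonneg z]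

theorem log_green_le {s y D c x : ℝ} (hs : 0 < s) (hy : 0 < y) (hc : 0 < c) (hx : 0 < x)
    (h1 : |y - s| ≤ D) (h2 : c * x ≤ D) :
    1 / s * Real.log (1 + 4 * s * y / D ^ 2) ≤ 32 / y * Real.log (1 + 8 * y ^ 2 / (c * x) ^ 2) := by
  have hcx : 0 < c * x := mul_pos hc hx
  have hD : 0 < D := hcx.trans_le h2
  by_cases h : y / 2 ≤ s ∧ s ≤ 2 * y
  · have e1 : 1 / s ≤ 32 / y := by
      rw [div_le_div_iff₀ hs hy]; nlinarith
    have e2 : 4 * s * y / D ^ 2 ≤ 8 * y ^ 2 / (c * x) ^ 2 := by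
      exact div_le_div₀ (by positivity) (by nlinarith) (by positivity) (by gcongr)
    have e3 : 0 ≤ Real.log (1 + 4 * s * y / D ^ 2) := Real.log_nonneg (by
      have : 0 ≤ 4 * s * y / D ^ 2 := by positivity
      linarith)
    have : 0 < 4 * s * y / D ^ 2 := by positivity
    gcongr
  · have hd : y / 2 ≤ D := by
      refine le_trans ?_ h1
      by_cases h3 : y / 2 ≤ s
      · have : 2 * y < s := by by_contra h4; exact h ⟨h3, not_lt.1 h4⟩
        rw [abs_of_neg (by linarith)]; linarith
      · exact le_trans (by linarith) (le_abs_self _)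
    have e1 : Real.log (1 + 4 * s * y / D ^ 2) ≤ 4 * s * y / D ^ 2 := by
      have := Real.log_le_sub_one_of_pos (x := 1 + 4 * s * y / D ^ 2) (by positivity)
      linarith
    have e2 : 1 / s * Real.log (1 + 4 * s * y / D ^ 2) ≤ 4 * y / D ^ 2 := by
      calc _ ≤ 1 / s * (4 * s * y / D ^ 2) := by gcongr
        _ = _ := by field_simp
    refine e2.trans ?_
    set t := 8 * y ^ 2 / (c * x) ^ 2 with ht
    have ht0 : 0 < t := by positivity
    have e3 : t / (1 + t) ≤ Real.log (1 + t) := by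
      have := Real.one_sub_inv_le_log_of_pos (x := 1 + t) (by positivity)
      have e : t / (1 + t) = 1 - (1 + t)⁻¹ := by field_simp; ring
      rw [e]; exact this
    have e4 : t / (1 + t) = 8 * y ^ 2 / ((c * x) ^ 2 + 8 * y ^ 2) := by
      rw [ht]; field_simp
    rw [e4] at e3
    calc 4 * y / D ^ 2 ≤ 32 / y * (8 * y ^ 2 / ((c * x) ^ 2 + 8 * y ^ 2)) := by
          rw [show 32 / y * (8 * y ^ 2 / ((c * x) ^ 2 + 8 * y ^ 2))
            = 256 * y / ((c * x) ^ 2 + 8 * y ^ 2) by field_simp; ring]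
          rw [div_le_div_iff₀ (by positivity) (by positivity)]
          have : (c * x) ^ 2 + 8 * y ^ 2 ≤ 64 * D ^ 2 := by nlinarith
          nlinarith
      _ ≤ _ := by gcongr

/-- The disk automorphism exchanging `a` and `0`. -/
noncomputable def moeb (a z : ℂ) : ℂ := (z - a) / (1 - conj a * z)

theorem norm_moeb_lt {a z : ℂ} (ha : ‖a‖ < 1) (hz : ‖z‖ < 1) : ‖moeb a z‖ < 1 := by
  have h1 := normSq_moebius a z
  have h2 : 0 < (1 - normSq a) * (1 - normSq z) := by
    simp only [normSq_eq_norm_sq]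
    apply mul_pos <;> nlinarith [norm_nonneg a, norm_nonneg z]
  rw [moeb, norm_div, div_lt_one (norm_pos_iff.2 (one_sub_conj_mul_ne_zero ha hz.le))]
  apply lt_of_pow_lt_pow_left₀ 2 (norm_nonneg _)
  rw [← normSq_eq_norm_sq, ← normSq_eq_norm_sq]; linarith

theorem one_sub_normSq_moeb {a z : ℂ} (ha : ‖a‖ < 1) (hz : ‖z‖ ≤ 1) :
    1 - normSq (moeb a z) = (1 - normSq a) * (1 - normSq z) / normSq (1 - conj a * z) := by
  have h1 := normSq_moebius a z
  have h2 : normSq (1 - conj a * z) ≠ 0 :=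
    normSq_eq_zero.not.2 (one_sub_conj_mul_ne_zero ha hz)
  rw [moeb, map_div₀, eq_div_iff h2, sub_mul, div_mul_cancel₀ _ h2]
  linarith

theorem one_add_conj_mul_moeb {a z : ℂ} (ha : ‖a‖ < 1) (hz : ‖z‖ ≤ 1) :
    1 + conj a * moeb a z = (1 - conj a * a) / (1 - conj a * z) := by
  have h := one_sub_conj_mul_ne_zero ha hz
  rw [moeb, eq_div_iff h, add_mul, mul_assoc, div_mul_cancel₀ _ h]; ring

theorem moeb_neg_moeb {a z : ℂ} (ha : ‖a‖ < 1) (hz : ‖z‖ ≤ 1) : moeb (-a) (moeb a z) = z := by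
  have h := one_sub_conj_mul_ne_zero ha hz
  have h3 : 1 - conj a * a ≠ 0 := one_sub_conj_mul_ne_zero ha ha.le
  have h4 := one_add_conj_mul_moeb ha hz
  have h5 : 1 - conj (-a) * moeb a z = (1 - conj a * a) / (1 - conj a * z) := by
    rw [← h4, map_neg]; ring
  have h6 : moeb a z - -a = z * (1 - conj a * a) / (1 - conj a * z) := by
    rw [moeb, eq_div_iff h, sub_neg_eq_add, add_mul, div_mul_cancel₀ _ h]; ring
  rw [moeb, h5, h6, div_div_div_cancel_right₀ h, mul_div_cancel_right₀ _ h3]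

theorem moeb_moeb_neg {a z : ℂ} (ha : ‖a‖ < 1) (hz : ‖z‖ ≤ 1) : moeb a (moeb (-a) z) = z := by
  have := moeb_neg_moeb (a := -a) (z := z) (by simpa using ha) hz
  rwa [neg_neg] at this

theorem hasDerivAt_moeb {a z : ℂ} (hz : 1 - conj a * z ≠ 0) :
    HasDerivAt (moeb a) ((1 - normSq a) / (1 - conj a * z) ^ 2) z := by
  have h := ((hasDerivAt_id z).sub_const a).div
    (((hasDerivAt_id z).const_mul (conj a)).const_sub 1) hz
  refine h.congr_deriv ?_
  rw [← mul_conj]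
  simp only [id]
  congr 1; ring

@[simp] theorem moeb_zero (a : ℂ) : moeb a 0 = -a := by simp [moeb]

/-- Schwarz's lemma in the form used here. -/
theorem norm_sub_le_of_moebius {G : ℂ → ℂ} (hG : DifferentiableOn ℂ G (ball 0 1))
    (hG1 : ∀ z ∈ ball (0 : ℂ) 1, ‖G z‖ ≤ 1) {w z : ℂ} (hw : ‖w‖ < 1) (hz : ‖z‖ < 1) :
    ‖G z - G w‖ ≤ 2 * ‖moeb w z‖ := by
  have hw' : ‖-w‖ < 1 := by simpa using hw
  have hmaps : MapsTo (moeb (-w)) (ball 0 1) (ball 0 1) := fun ζ hζ => by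
    rw [mem_ball_zero_iff] at hζ ⊢; exact norm_moeb_lt hw' hζ
  have hdiff : DifferentiableOn ℂ (G ∘ moeb (-w)) (ball 0 1) := by
    refine hG.comp ?_ hmaps
    intro ζ hζ
    exact (hasDerivAt_moeb (one_sub_conj_mul_ne_zero hw'
      (mem_ball_zero_iff.1 hζ).le)).differentiableAt.differentiableWithinAt
  have key := Complex.dist_le_div_mul_dist_of_mapsTo_ball (R₂ := 2) (z := moeb w z) hdiff
    (fun ξ hξ => by
      rw [mem_closedBall, dist_eq_norm]
      refine (norm_sub_le _ _).trans ?_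
      have a1 := hG1 _ (hmaps hξ)
      have a2 := hG1 _ (hmaps (mem_ball_self one_pos))
      simp only [Function.comp]
      linarith) (by rw [mem_ball_zero_iff]; exact norm_moeb_lt hw hz)
  simpa [moeb_neg_moeb hw hz.le, dist_eq_norm] using key

theorem hall_core {G : ℂ → ℂ} (hG : DiffContOnCl ℂ G (ball 0 1))
    (hG1 : ∀ z ∈ closedBall (0 : ℂ) 1, ‖G z‖ ≤ 1) {I : Finset ℕ} {w : ℕ → ℂ} {k : ℕ → ℕ}
    {κ : ℕ → ℝ} {M : ℕ} {η A : ℝ} (hw : ∀ i ∈ I, ‖w i‖ < 1) (hκ0 : ∀ i ∈ I, 0 < κ i)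
    (hκ : ∀ i ∈ I, κ i < ‖w i‖)
    (hsmall : ∀ i ∈ I, ∀ z, ‖z‖ < 1 → ‖moeb (w i) z‖ ≤ κ i → ‖G z‖ ≤ η)
    (hprod : ∀ z, ‖z‖ < 1 → (∀ i ∈ I, κ i ≤ ‖moeb (w i) z‖) →
      ∑ i ∈ I, k i * -Real.log ‖moeb (w i) z‖ ≤ A)
    (hη : η ^ M * Real.exp A ≤ 1) :
    ‖G 0‖ ^ M ≤ ∏ i ∈ I, ‖w i‖ ^ k i := by
  set U : Set ℂ := {z | z ∈ ball (0 : ℂ) 1 ∧ ∀ i ∈ I, κ i * ‖1 - conj (w i) * z‖ < ‖z - w i‖} with hU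
  have hUo : IsOpen U := by
    have : U = ball 0 1 ∩ ⋂ i ∈ I, {z | κ i * ‖1 - conj (w i) * z‖ < ‖z - w i‖} := by
      ext z; simp [hU]
    rw [this]
    refine isOpen_ball.inter (isOpen_biInter_finset fun i _ => ?_)
    exact isOpen_lt (by fun_prop) (by fun_prop)
  have hUb : U ⊆ ball 0 1 := fun z hz => hz.1
  have hcl : closure U ⊆ {z | z ∈ closedBall (0 : ℂ) 1 ∧
      ∀ i ∈ I, κ i * ‖1 - conj (w i) * z‖ ≤ ‖z - w i‖} := by
    refine closure_minimal (fun z hz => ⟨ball_subset_closedBall hz.1, fun i hi => (hz.2 i hi).le⟩) ?_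
    have : {z | z ∈ closedBall (0 : ℂ) 1 ∧ ∀ i ∈ I, κ i * ‖1 - conj (w i) * z‖ ≤ ‖z - w i‖}
      = closedBall 0 1 ∩ ⋂ i ∈ I, {z | κ i * ‖1 - conj (w i) * z‖ ≤ ‖z - w i‖} := by
      ext z; simp
    rw [this]
    refine isClosed_closedBall.inter (isClosed_biInter fun i _ => ?_)
    exact isClosed_le (by fun_prop) (by fun_prop)
  have hden : ∀ z ∈ closure U, ∀ i ∈ I, 1 - conj (w i) * z ≠ 0 := fun z hz i hi =>
    one_sub_conj_mul_ne_zero (hw i hi) (mem_closedBall_zero_iff.1 (hcl hz).1)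
  have hne : ∀ z ∈ closure U, ∀ i ∈ I, z - w i ≠ 0 := fun z hz i hi => by
    have h1 := (hcl hz).2 i hi
    have h2 := mul_pos (hκ0 i hi) (norm_pos_iff.2 (hden z hz i hi))
    exact norm_pos_iff.1 (h2.trans_le h1)
  set F : ℂ → ℂ := fun z => G z ^ M * ∏ i ∈ I, ((1 - conj (w i) * z) / (z - w i)) ^ k i with hF
  have hFd : DiffContOnCl ℂ F U := by
    constructor
    · refine DifferentiableOn.mul ((hG.differentiableOn.mono hUb).pow M) ?_
      refine DifferentiableOn.fun_finsetProd fun i hi => ?_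
      refine DifferentiableOn.pow (DifferentiableOn.div (by fun_prop) (by fun_prop) ?_) _
      exact fun z hz => hne z (subset_closure hz) i hi
    · refine ContinuousOn.mul ((hG.continuousOn.mono (closure_mono hUb)).pow M) ?_
      refine continuousOn_finsetProd _ fun i hi => ?_
      refine ContinuousOn.pow (ContinuousOn.div (by fun_prop) (by fun_prop) ?_) _
      exact fun z hz => hne z hz i hi
  have hFn : ∀ z, ‖F z‖ = ‖G z‖ ^ M * ∏ i ∈ I, (‖moeb (w i) z‖⁻¹) ^ k i := fun z => by
    simp only [hF, norm_mul, norm_pow, norm_prod, moeb, norm_div, inv_div]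
  have hfr : ∀ z ∈ frontier U, ‖F z‖ ≤ 1 := by
    intro z hz
    have hzc : z ∈ closure U := frontier_subset_closure hz
    have hzb := mem_closedBall_zero_iff.1 (hcl hzc).1
    rw [hFn]
    rcases hzb.lt_or_eq with hlt | heq
    · have hκm : ∀ i ∈ I, κ i ≤ ‖moeb (w i) z‖ := fun i hi => by
        rw [moeb, norm_div, le_div_iff₀ (norm_pos_iff.2 (hden z hzc i hi))]
        exact (hcl hzc).2 i hi
      have hnot : z ∉ U := by
        rw [hUo.frontier_eq] at hz; exact hz.2
      have : ∃ j ∈ I, ‖moeb (w j) z‖ ≤ κ j := by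
        by_contra! hcon
        refine hnot ⟨mem_ball_zero_iff.2 hlt, fun i hi => ?_⟩
        have := hcon i hi
        rwa [moeb, norm_div, lt_div_iff₀ (norm_pos_iff.2 (hden z hzc i hi))] at this
      obtain ⟨j, hj, hjz⟩ := this
      have h1 := hsmall j hj z hlt hjz
      have h2 : ∏ i ∈ I, (‖moeb (w i) z‖⁻¹) ^ k i ≤ Real.exp A := by
        have e : ∏ i ∈ I, (‖moeb (w i) z‖⁻¹) ^ k i
            = Real.exp (∑ i ∈ I, k i * -Real.log ‖moeb (w i) z‖) := by
          rw [Real.exp_sum]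
          refine Finset.prod_congr rfl fun i hi => ?_
          have : 0 < ‖moeb (w i) z‖ := (hκ0 i hi).trans_le (hκm i hi)
          rw [Real.exp_nat_mul, Real.exp_neg, Real.exp_log this]
        rw [e]
        exact Real.exp_le_exp.2 (hprod z hlt hκm)
      refine le_trans ?_ hη
      have : 0 ≤ ∏ i ∈ I, (‖moeb (w i) z‖⁻¹) ^ k i := Finset.prod_nonneg fun i _ => by positivity
      have := (norm_nonneg (G z)).trans h1
      gcongr
    · have h1 : ∀ i ∈ I, (‖moeb (w i) z‖⁻¹) ^ k i = 1 := fun i hi => by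
        have h2 := normSq_moebius (w i) z
        rw [show normSq z = 1 by rw [normSq_eq_norm_sq, heq]; norm_num] at h2
        have h3 : ‖1 - conj (w i) * z‖ = ‖z - w i‖ := by
          rw [← sq_eq_sq₀ (norm_nonneg _) (norm_nonneg _), ← normSq_eq_norm_sq,
            ← normSq_eq_norm_sq, h2]; ring
        rw [moeb, norm_div, h3, div_self (norm_ne_zero_iff.2 (hne z hzc i hi))]; simp
      rw [Finset.prod_congr rfl h1]
      simpa using pow_le_one₀ (norm_nonneg _) (hG1 z (hcl hzc).1)
  have h0U : (0 : ℂ) ∈ U := ⟨mem_ball_self one_pos, fun i hi => by simpa using hκ i hi⟩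
  have key := Complex.norm_le_of_forall_mem_frontier_norm_le (isBounded_ball.subset hUb) hFd hfr
    (subset_closure h0U)
  rw [hFn] at key
  simp only [moeb_zero, norm_neg] at key
  have e : ∏ i ∈ I, (‖w i‖⁻¹) ^ k i = (∏ i ∈ I, ‖w i‖ ^ k i)⁻¹ := by
    rw [← Finset.prod_inv_distrib]
    exact Finset.prod_congr rfl fun i _ => inv_pow _ _
  have hpos : 0 < ∏ i ∈ I, ‖w i‖ ^ k i :=
    Finset.prod_pos fun i hi => pow_pos ((hκ0 i hi).trans (hκ i hi)) _
  rw [e, ← div_eq_mul_inv, div_le_one hpos] at key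
  exact key

theorem sum_dist_le {N : ℕ} {I : Finset ℕ} (hI : I ⊆ Finset.range N) {i₀ : ℕ} (hi₀ : i₀ ∈ I)
    {β : ℕ → ℝ} (hβ : ∀ d, 0 ≤ β d) :
    ∑ i ∈ I, β (Nat.dist i i₀) ≤ 2 * ∑ d ∈ Finset.range N, β d := by
  have hi₀N := Finset.mem_range.1 (hI hi₀)
  have aux : ∀ J ⊆ I, Set.InjOn (fun i => Nat.dist i i₀) J →
      ∑ i ∈ J, β (Nat.dist i i₀) ≤ ∑ d ∈ Finset.range N, β d := by
    intro J hJ hinj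
    rw [← Finset.sum_image (f := β) hinj]
    refine Finset.sum_le_sum_of_subset_of_nonneg ?_ fun d _ _ => hβ d
    intro d hd
    obtain ⟨i, hi, rfl⟩ := Finset.mem_image.1 hd
    have := Finset.mem_range.1 (hI (hJ hi))
    rw [Finset.mem_range, Nat.dist]; omega
  rw [← Finset.sum_filter_add_sum_filter_not I (fun i => i₀ ≤ i), two_mul]
  refine add_le_add (aux _ (Finset.filter_subset _ _) ?_) (aux _ (Finset.filter_subset _ _) ?_)
  all_goals
    intro i hi j hj hij
    simp only [Finset.coe_filter, mem_ofPred_eq] at hi hj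
    simp only [Nat.dist] at hij
    omega

theorem hall_sum {N : ℕ} (hN : 0 < N) {I : Finset ℕ} (hI : I ⊆ Finset.range N) {w : ℕ → ℂ}
    {k : ℕ → ℕ} {c : ℝ} (hc : 0 < c) (hw : ∀ i ∈ I, ‖w i‖ < 1)
    (hk : ∀ i ∈ I, (k i : ℝ) ≤ 2 / (1 - ‖w i‖))
    (hsep : ∀ i ∈ I, ∀ j ∈ I, 2 * c * (((Nat.dist i j : ℝ) - 1) * (π / N)) ≤ ‖w i - w j‖)
    {z : ℂ} (hz : ‖z‖ < 1)
    (hκ : ∀ i ∈ I, Real.exp (-(N * (1 - ‖w i‖))) ≤ ‖moeb (w i) z‖) :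
    ∑ i ∈ I, k i * -Real.log ‖moeb (w i) z‖ ≤ (8 + 192 / c) * N := by
  rcases I.eq_empty_or_nonempty with rfl | hne
  · simp; positivity
  have hNR : (0 : ℝ) < N := by exact_mod_cast hN
  obtain ⟨i₀, hi₀, hmin⟩ := Finset.exists_min_image I (fun i => ‖z - w i‖) hne
  set y := 1 - ‖z‖ with hy
  have hy0 : 0 < y := by simp only [hy]; linarith
  set T := 3 * y / (c * (π / N)) with hT
  have hT0 : 0 < T := by positivity
  set β : ℕ → ℝ := fun d => if d ≤ 1 then 2 * N else
    32 / y * Real.log (1 + T ^ 2 / ((d : ℝ) - 1) ^ 2) with hβ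
  have hβ0 : ∀ d, 0 ≤ β d := fun d => by
    simp only [hβ]
    split_ifs with h
    · positivity
    · refine mul_nonneg (by positivity) (Real.log_nonneg ?_)
      have : 0 ≤ T ^ 2 / ((d : ℝ) - 1) ^ 2 := by positivity
      linarith
  have hterm : ∀ i ∈ I, k i * -Real.log ‖moeb (w i) z‖ ≤ β (Nat.dist i i₀) := by
    intro i hi
    have hs : 0 < 1 - ‖w i‖ := by linarith [hw i hi]
    have hpos : 0 < ‖moeb (w i) z‖ := (Real.exp_pos _).trans_le (hκ i hi)
    have hlog : -Real.log ‖moeb (w i) z‖ ≤ N * (1 - ‖w i‖) := by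
      have := (Real.le_log_iff_exp_le hpos).2 (hκ i hi)
      linarith
    have hlog0 : 0 ≤ -Real.log ‖moeb (w i) z‖ := by
      have := Real.log_nonpos hpos.le (norm_moeb_lt (hw i hi) hz).le
      linarith
    simp only [hβ]
    split_ifs with hd
    · calc k i * -Real.log ‖moeb (w i) z‖ ≤ 2 / (1 - ‖w i‖) * (N * (1 - ‖w i‖)) := by
            gcongr; exact hk i hi
        _ = 2 * N := by field_simp
    · have hd' : 2 ≤ Nat.dist i i₀ := by omega
      have hd2 : (0 : ℝ) < (Nat.dist i i₀ : ℝ) - 1 := by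
        have : (2 : ℝ) ≤ Nat.dist i i₀ := by exact_mod_cast hd'
        linarith
      set x := ((Nat.dist i i₀ : ℝ) - 1) * (π / N) with hx
      have hx0 : 0 < x := by positivity
      have hD : c * x ≤ ‖z - w i‖ := by
        have h1 := hsep i hi i₀ hi₀
        have h2 := hmin i hi
        have h3 : ‖w i - w i₀‖ ≤ ‖z - w i‖ + ‖z - w i₀‖ := by
          rw [show w i - w i₀ = (z - w i₀) - (z - w i) by ring]
          linarith [norm_sub_le (z - w i₀) (z - w i)]
        simp only [← hx] at h1
        linarith
      have hD1 : |y - (1 - ‖w i‖)| ≤ ‖z - w i‖ := by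
        have := abs_norm_sub_norm_le z (w i)
        rw [abs_sub_comm] at this
        simp only [hy]; convert this using 2; ring
      have hD0 : 0 < ‖z - w i‖ := (mul_pos hc hx0).trans_le hD
      have hg : -Real.log ‖moeb (w i) z‖
          ≤ 1 / 2 * Real.log (1 + 4 * (1 - ‖w i‖) * y / ‖z - w i‖ ^ 2) := by
        have e1 : -Real.log ‖moeb (w i) z‖ = 1 / 2 * Real.log ((‖moeb (w i) z‖ ^ 2)⁻¹) := by
          rw [Real.log_inv, Real.log_pow]; push_cast; ring
        rw [e1]
        have e2 : (‖moeb (w i) z‖ ^ 2)⁻¹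
            = 1 + (1 - normSq (w i)) * (1 - normSq z) / ‖z - w i‖ ^ 2 := by
          rw [moeb, norm_div, div_pow, inv_div, ← normSq_eq_norm_sq, ← normSq_eq_norm_sq,
            normSq_moebius, add_div, div_self]
          exact normSq_eq_zero.not.2 (norm_pos_iff.1 hD0)
        have e3 : (1 - normSq (w i)) * (1 - normSq z) ≤ 4 * (1 - ‖w i‖) * y := by
          rw [normSq_eq_norm_sq, normSq_eq_norm_sq]
          have a1 : 1 - ‖w i‖ ^ 2 ≤ 2 * (1 - ‖w i‖) := by nlinarith
          have a2 : 1 - ‖z‖ ^ 2 ≤ 2 * y := by simp only [hy]; nlinarith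
          have a3 : 0 ≤ 1 - ‖z‖ ^ 2 := by nlinarith [norm_nonneg z]
          calc _ ≤ 2 * (1 - ‖w i‖) * (2 * y) := by gcongr
            _ = _ := by ring
        have : 0 < (‖moeb (w i) z‖ ^ 2)⁻¹ := by positivity
        rw [e2] at this ⊢
        gcongr
      have h4 := log_green_le hs hy0 hc hx0 hD1 hD
      have e5 : 8 * y ^ 2 / (c * x) ^ 2 ≤ T ^ 2 / ((Nat.dist i i₀ : ℝ) - 1) ^ 2 := by
        have : T ^ 2 / ((Nat.dist i i₀ : ℝ) - 1) ^ 2 = 9 * y ^ 2 / (c * x) ^ 2 := by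
          rw [hT, hx]; field_simp; norm_num
        rw [this]; gcongr; norm_num
      calc k i * -Real.log ‖moeb (w i) z‖
          ≤ 2 / (1 - ‖w i‖) * (1 / 2 * Real.log (1 + 4 * (1 - ‖w i‖) * y / ‖z - w i‖ ^ 2)) := by
            gcongr; exact hk i hi
        _ = 1 / (1 - ‖w i‖) * Real.log (1 + 4 * (1 - ‖w i‖) * y / ‖z - w i‖ ^ 2) := by ring
        _ ≤ _ := h4
        _ ≤ _ := by gcongr
  refine (Finset.sum_le_sum hterm).trans ((sum_dist_le hI hi₀ hβ0).trans ?_)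
  have hsum : ∑ d ∈ Finset.range N, β d ≤ 4 * N + 32 / y * (π * T) := by
    calc ∑ d ∈ Finset.range N, β d ≤ ∑ d ∈ Finset.range (N + 2), β d :=
          Finset.sum_le_sum_of_subset_of_nonneg (Finset.range_mono (by omega)) fun d _ _ => hβ0 d
      _ = ∑ d ∈ Finset.range N, β (d + 1 + 1) + β 1 + β 0 := by
          rw [Finset.sum_range_succ', Finset.sum_range_succ']
      _ = 32 / y * ∑ d ∈ Finset.range N, Real.log (1 + T ^ 2 / ((d : ℝ) + 1) ^ 2) + 4 * N := by
          rw [Finset.mul_sum]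
          have : ∀ d : ℕ, β (d + 1 + 1) = 32 / y * Real.log (1 + T ^ 2 / ((d : ℝ) + 1) ^ 2) := by
            intro d
            simp only [hβ]
            rw [if_neg (by omega)]; push_cast; congr 4; ring
          simp only [this]
          simp only [hβ]; norm_num; ring
      _ ≤ _ := by
          have := sum_log_one_add_le hT0.le N
          have : 32 / y * ∑ d ∈ Finset.range N, Real.log (1 + T ^ 2 / ((d : ℝ) + 1) ^ 2)
            ≤ 32 / y * (π * T) := by gcongr
          linarith
  have e : 32 / y * (π * T) = 96 / c * N := by rw [hT]; field_simp; norm_num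
  rw [e] at hsum
  calc _ ≤ 2 * (4 * N + 96 / c * N) := by gcongr
    _ = _ := by ring

theorem norm_exp_sub_exp_ge {s t : ℝ} (h : |s - t| ≤ π) :
    2 / π * |s - t| ≤ ‖cexp (s * I) - cexp (t * I)‖ := by
  have e : cexp (s * I) - cexp (t * I) = cexp (t * I) * (cexp (I * (s - t : ℝ)) - 1) := by
    rw [mul_sub, ← Complex.exp_add]; push_cast; ring_nf
  rw [e, norm_mul, norm_exp_ofReal_mul_I, one_mul, norm_exp_I_mul_ofReal_sub_one, norm_mul,
    Real.norm_eq_abs, Real.norm_eq_abs, abs_of_pos (by norm_num : (0 : ℝ) < 2)]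
  have := Real.mul_abs_le_abs_sin (x := (s - t) / 2) (by
    rw [abs_div, abs_of_pos (by norm_num : (0 : ℝ) < 2)]; linarith)
  rw [abs_div, abs_of_pos (by norm_num : (0 : ℝ) < 2)] at this
  have e : 2 / π * |s - t| = 2 * (2 / π * (|s - t| / 2)) := by ring
  linarith

theorem norm_polar_sub_ge {r r' s t : ℝ} (hr : 0 ≤ r) (hr' : 0 ≤ r') (h : |s - t| ≤ π) :
    r / π * |s - t| ≤ ‖r * cexp (s * I) - r' * cexp (t * I)‖ := by
  set d := ‖r * cexp (s * I) - r' * cexp (t * I)‖ with hd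
  have h1 : ‖(r' - r : ℂ) * cexp (t * I)‖ ≤ d := by
    rw [norm_mul, norm_exp_ofReal_mul_I, mul_one, ← ofReal_sub, norm_real, Real.norm_eq_abs]
    have h2 := abs_norm_sub_norm_le ((r : ℂ) * cexp (s * I)) (r' * cexp (t * I))
    simp only [norm_mul, norm_exp_ofReal_mul_I, mul_one, norm_real, Real.norm_eq_abs] at h2
    rwa [abs_of_nonneg hr, abs_of_nonneg hr', abs_sub_comm] at h2
  have h2 : r * ‖cexp (s * I) - cexp (t * I)‖ ≤ d + d := by
    have e : (r : ℂ) * (cexp (s * I) - cexp (t * I))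
      = (r * cexp (s * I) - r' * cexp (t * I)) + (r' - r : ℂ) * cexp (t * I) := by ring
    have := norm_add_le (r * cexp (s * I) - r' * cexp (t * I)) ((r' - r : ℂ) * cexp (t * I))
    rw [← e, norm_mul, norm_real, Real.norm_eq_abs, abs_of_nonneg hr] at this
    linarith
  have h3 := mul_le_mul_of_nonneg_left (norm_exp_sub_exp_ge h) hr
  have e : r * (2 / π * |s - t|) = 2 * (r / π * |s - t|) := by ring
  linarith

/-- Hall's lemma: few rays from the centre meet the set where `G` is small. -/
theorem hall {δ : ℝ} (hδ : 0 < δ) (hδ1 : δ ≤ 1) : ∃ ε : ℝ, 0 < ε ∧ ε ≤ δ / 8 ∧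
    ∀ G : ℂ → ℂ, DiffContOnCl ℂ G (ball 0 1) → (∀ z ∈ closedBall (0 : ℂ) 1, ‖G z‖ ≤ 1) →
      δ ≤ ‖G 0‖ → ∀ t₀ : ℝ,
      volume {φ ∈ Icc t₀ (t₀ + π) | ∃ r ∈ Icc (0 : ℝ) 1, ‖G (r * cexp (φ * I))‖ < ε}
        ≤ ENNReal.ofReal (1 / 2) := by
  have hπ := Real.pi_pos
  set c := δ / (8 * π) with hc
  have hc0 : 0 < c := by positivity
  set C := 8 + 192 / c with hC
  have hC0 : 0 < C := by positivity
  set ℓ := Real.log (1 / δ) with hℓ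
  have hℓ0 : 0 ≤ ℓ := Real.log_nonneg (by rw [le_div_iff₀ hδ]; linarith)
  obtain ⟨m, hm⟩ := exists_nat_gt (2 * π * ℓ)
  have hm0 : (0 : ℝ) < m := lt_of_le_of_lt (by positivity) hm
  set ε := min (δ / 8) (Real.exp (-(C * m)) / 4) with hε
  have hε0 : 0 < ε := lt_min (by positivity) (by positivity)
  have hε8 : ε ≤ δ / 8 := min_le_left _ _
  have hε4 : 4 * ε * Real.exp (C * m) ≤ 1 := by
    have : ε ≤ Real.exp (-(C * m)) / 4 := min_le_right _ _
    calc 4 * ε * Real.exp (C * m) ≤ 4 * (Real.exp (-(C * m)) / 4) * Real.exp (C * m) := by gcongr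
      _ = 1 := by rw [mul_div_cancel₀ _ (by norm_num : (4 : ℝ) ≠ 0), ← Real.exp_add]; simp
  refine ⟨ε, hε0, hε8, fun G hG hG1 hG0 t₀ => ?_⟩
  set E := {φ ∈ Icc t₀ (t₀ + π) | ∃ r ∈ Icc (0 : ℝ) 1, ‖G (r * cexp (φ * I))‖ < ε} with hE
  have hGc : ContinuousOn G (closedBall 0 1) := by
    have := hG.continuousOn; rwa [closure_ball _ one_ne_zero] at this
  obtain ⟨d, hd0, hd⟩ := Metric.uniformContinuousOn_iff.1
    ((isCompact_closedBall (0 : ℂ) 1).uniformContinuousOn_of_continuous hGc) ε hε0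
  set L := Real.log (1 / ε) with hL
  have hL0 : 0 < L := Real.log_pos (by rw [lt_div_iff₀ hε0]; linarith)
  have hLε : Real.exp (-L) = ε := by
    rw [hL, one_div, Real.log_inv, neg_neg, Real.exp_log hε0]
  obtain ⟨M, hM⟩ := exists_nat_gt (L / (m * min 1 (d / 2)))
  have hd1 : 0 < min 1 (d / 2) := lt_min one_pos (by positivity)
  have hM0 : (0 : ℝ) < M := lt_of_le_of_lt (by positivity) hM
  set N := m * M with hN
  have hNR : (N : ℝ) = m * M := by rw [hN]; push_cast; rfl
  have hN0 : (0 : ℝ) < N := by rw [hNR]; positivity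
  have hLN : L / N ≤ min 1 (d / 2) := by
    rw [div_lt_iff₀ (by positivity)] at hM
    rw [div_le_iff₀ hN0, hNR]; linarith
  have hLN1 : L / N ≤ 1 := hLN.trans (min_le_left _ _)
  have hLNd : L / N < d := (hLN.trans (min_le_right _ _)).trans_lt (by linarith)
  have hLN0 : 0 < L / N := by positivity
  set h := π / N with hh
  have hh0 : 0 < h := by positivity
  classical
  set J : ℕ → Set ℝ := fun i => Icc (t₀ + i * h) (t₀ + (i + 1) * h) with hJ
  set S : Finset ℕ := (Finset.range N).filter fun i => (J i ∩ E).Nonempty with hS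
  have hch : ∀ i ∈ S, ∃ φ r : ℝ, φ ∈ J i ∧ 0 ≤ r ∧ r ≤ 1 - L / N ∧
      ‖G (r * cexp (φ * I))‖ < 2 * ε := by
    intro i hi
    obtain ⟨φ, hφ, hφE⟩ := (Finset.mem_filter.1 hi).2
    obtain ⟨r, hr, hrG⟩ := hφE.2
    refine ⟨φ, min r (1 - L / N), hφ, le_min hr.1 (by linarith), min_le_right _ _, ?_⟩
    set r' := min r (1 - L / N) with hr'
    have hr0 : 0 ≤ r' := le_min hr.1 (by linarith)
    have hrr : r' ≤ r := min_le_left _ _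
    have hrd : r - r' < d := by
      rcases min_choice r (1 - L / N) with h1 | h1
      · rw [hr', h1]; simpa using hd0
      · rw [hr', h1]; linarith [hr.2]
    have hmem : ∀ x : ℝ, 0 ≤ x → x ≤ 1 → (x : ℂ) * cexp (φ * I) ∈ closedBall (0 : ℂ) 1 :=
      fun x hx hx1 => by
        rw [mem_closedBall_zero_iff, norm_mul, norm_exp_ofReal_mul_I, norm_real, Real.norm_eq_abs,
          abs_of_nonneg hx]; linarith
    have := hd _ (hmem r' hr0 (hrr.trans hr.2)) _ (hmem r hr.1 hr.2) (by
      rw [dist_eq_norm, ← sub_mul, norm_mul, norm_exp_ofReal_mul_I, ← ofReal_sub, norm_real,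
        Real.norm_eq_abs, abs_sub_comm, abs_of_nonneg (by linarith)]; linarith)
    rw [dist_eq_norm] at this
    have h3 := norm_sub_norm_le (G (r' * cexp (φ * I))) (G (r * cexp (φ * I)))
    linarith
  choose! φ r hφ hr0 hr1 hrG using hch
  set w : ℕ → ℂ := fun i => r i * cexp (φ i * I) with hw
  have hwn : ∀ i ∈ S, ‖w i‖ = r i := fun i hi => by
    simp only [hw, norm_mul, norm_exp_ofReal_mul_I, norm_real, Real.norm_eq_abs, mul_one,
      abs_of_nonneg (hr0 i hi)]
  have hw1 : ∀ i ∈ S, ‖w i‖ < 1 := fun i hi => by rw [hwn i hi]; linarith [hr1 i hi]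
  have hGd := hG.differentiableOn
  have hG1' : ∀ z ∈ ball (0 : ℂ) 1, ‖G z‖ ≤ 1 := fun z hz => hG1 z (ball_subset_closedBall hz)
  have hrδ : ∀ i ∈ S, δ / 4 ≤ r i := fun i hi => by
    have h1 := norm_sub_le_of_moebius hGd hG1' (w := 0) (z := w i) (by simp) (hw1 i hi)
    have h2 : moeb 0 (w i) = w i := by simp [moeb]
    rw [h2, hwn i hi] at h1
    have h3 := norm_sub_norm_le (G 0) (G (w i))
    rw [norm_sub_rev] at h3
    have h4 := hrG i hi
    have h5 : ‖G (w i)‖ < 2 * ε := h4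
    linarith
  have hsep : ∀ i ∈ S, ∀ j ∈ S, 2 * c * (((Nat.dist i j : ℝ) - 1) * (π / N)) ≤ ‖w i - w j‖ := by
    intro i hi j hj
    have a1 := hφ i hi
    have a2 := hφ j hj
    have iN := Finset.mem_range.1 (Finset.mem_filter.1 hi).1
    have jN := Finset.mem_range.1 (Finset.mem_filter.1 hj).1
    have iN' : (i : ℝ) + 1 ≤ N := by exact_mod_cast iN
    have jN' : (j : ℝ) + 1 ≤ N := by exact_mod_cast jN
    have hNh : N * h = π := by rw [hh]; field_simp
    have b1 : ((i : ℝ) + 1) * h ≤ π := by rw [← hNh]; gcongr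
    have b2 : ((j : ℝ) + 1) * h ≤ π := by rw [← hNh]; gcongr
    have b3 : 0 ≤ (i : ℝ) * h := by positivity
    have b4 : 0 ≤ (j : ℝ) * h := by positivity
    have hab : |φ i - φ j| ≤ π := abs_le.2 ⟨by linarith [a1.1, a2.2], by linarith [a1.2, a2.1]⟩
    have h1 := norm_polar_sub_ge (hr0 i hi) (hr0 j hj) hab
    refine le_trans ?_ h1
    have hdist : ((Nat.dist i j : ℝ) - 1) * (π / N) ≤ |φ i - φ j| := by
      rw [← hh]
      rcases le_total i j with hij | hij
      · have e : (Nat.dist i j : ℝ) = j - i := by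
          rw [Nat.dist, Nat.sub_eq_zero_of_le hij, zero_add, Nat.cast_sub hij]
        rw [e, abs_sub_comm]
        refine le_trans ?_ (le_abs_self _)
        linarith [a1.2, a2.1]
      · have e : (Nat.dist i j : ℝ) = i - j := by
          rw [Nat.dist, Nat.sub_eq_zero_of_le hij, add_zero, Nat.cast_sub hij]
        rw [e]
        refine le_trans ?_ (le_abs_self _)
        linarith [a2.2, a1.1]
    have e1 : 2 * c = δ / 4 / π := by rw [hc]; field_simp; norm_num
    rw [e1]
    have h3 := hrδ i hi
    calc δ / 4 / π * (((Nat.dist i j : ℝ) - 1) * (π / N)) ≤ δ / 4 / π * |φ i - φ j| := by gcongr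
      _ ≤ _ := by gcongr
  have hκε : ∀ i ∈ S, Real.exp (-(N * (1 - ‖w i‖))) ≤ ε := fun i hi => by
    rw [← hLε]
    apply Real.exp_le_exp.2
    have := hr1 i hi
    rw [hwn i hi]
    have h2 : L / N ≤ 1 - r i := by linarith
    rw [div_le_iff₀ hN0] at h2
    linarith
  have hs0 : ∀ i ∈ S, 0 < 1 - ‖w i‖ := fun i hi => by linarith [hw1 i hi]
  have hcore := hall_core hG hG1 (I := S) (w := w) (k := fun i => ⌈1 / (1 - ‖w i‖)⌉₊)
    (κ := fun i => Real.exp (-(N * (1 - ‖w i‖)))) (M := M) (η := 4 * ε) (A := C * N) hw1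
    (fun i _ => Real.exp_pos _)
    (fun i hi => by
      have := hrδ i hi
      rw [← hwn i hi] at this
      exact (hκε i hi).trans_lt (by linarith))
    (fun i hi z hz hle => by
      have h1 := norm_sub_le_of_moebius hGd hG1' (hw1 i hi) hz
      have h2 := norm_sub_norm_le (G z) (G (w i))
      have h3 : ‖G (w i)‖ < 2 * ε := hrG i hi
      linarith [hκε i hi])
    (fun z hz hle => hall_sum (by exact_mod_cast hN0) (Finset.filter_subset _ _) hc0 hw1
      (fun i hi => by
        have h1 := Nat.ceil_lt_add_one (a := 1 / (1 - ‖w i‖)) (by have := hs0 i hi; positivity)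
        have h2 : 1 ≤ 1 / (1 - ‖w i‖) := by
          rw [le_div_iff₀ (hs0 i hi)]; linarith [norm_nonneg (w i)]
        have e : 2 / (1 - ‖w i‖) = 1 / (1 - ‖w i‖) + 1 / (1 - ‖w i‖) := by ring
        rw [e]; linarith) hsep hz hle)
    (by
      rw [hNR, show C * (m * M : ℝ) = M * (C * m) by ring, Real.exp_nat_mul, ← mul_pow]
      exact pow_le_one₀ (by positivity) hε4)
  have hcard : (S.card : ℝ) ≤ M * ℓ := by
    have h1 : ∏ i ∈ S, ‖w i‖ ^ ⌈1 / (1 - ‖w i‖)⌉₊ ≤ ∏ _i ∈ S, Real.exp (-1) := by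
      refine Finset.prod_le_prod (fun i _ => by positivity) fun i hi => ?_
      have h2 : ‖w i‖ ≤ Real.exp (-(1 - ‖w i‖)) := by
        have := Real.add_one_le_exp (-(1 - ‖w i‖)); linarith
      calc ‖w i‖ ^ ⌈1 / (1 - ‖w i‖)⌉₊ ≤ Real.exp (-(1 - ‖w i‖)) ^ ⌈1 / (1 - ‖w i‖)⌉₊ := by gcongr
        _ = Real.exp (⌈1 / (1 - ‖w i‖)⌉₊ * -(1 - ‖w i‖)) := by rw [Real.exp_nat_mul]
        _ ≤ _ := by
          apply Real.exp_le_exp.2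
          have := Nat.le_ceil (1 / (1 - ‖w i‖))
          have h3 := mul_le_mul_of_nonneg_right this (hs0 i hi).le
          rw [div_mul_cancel₀ _ (hs0 i hi).ne'] at h3
          linarith
    rw [Finset.prod_const] at h1
    have h4 : δ ^ M ≤ Real.exp (-1) ^ S.card := (pow_le_pow_left₀ hδ.le hG0 M).trans (hcore.trans h1)
    have h5 := Real.log_le_log (by positivity) h4
    rw [Real.log_pow, Real.log_pow, Real.log_exp] at h5
    have : ℓ = -Real.log δ := by rw [hℓ, one_div, Real.log_inv]
    rw [this]; linarith
  have hcover : E ⊆ ⋃ i ∈ S, J i := by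
    intro t ht
    have hNh : N * h = π := by rw [hh]; field_simp
    have hx0 : 0 ≤ (t - t₀) / h := div_nonneg (by linarith [ht.1.1]) hh0.le
    have hxN : (t - t₀) / h ≤ N := by rw [div_le_iff₀ hh0, hNh]; linarith [ht.1.2]
    have : ∃ i < N, t ∈ J i := by
      rcases hxN.lt_or_eq with hlt | heq
      · refine ⟨⌊(t - t₀) / h⌋₊, (Nat.floor_lt hx0).2 hlt, ?_, ?_⟩
        · have := Nat.floor_le hx0
          rw [le_div_iff₀ hh0] at this; linarith
        · have := (Nat.lt_floor_add_one ((t - t₀) / h)).le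
          rw [div_le_iff₀ hh0] at this; linarith
      · have hN1 : 1 ≤ N := by exact_mod_cast hN0
        rw [div_eq_iff hh0.ne'] at heq
        refine ⟨N - 1, by omega, ?_, ?_⟩
        · push_cast [hN1]; linarith
        · push_cast [hN1]; linarith
    obtain ⟨i, hi, hti⟩ := this
    exact mem_biUnion (show i ∈ S from Finset.mem_filter.2 ⟨Finset.mem_range.2 hi, t, hti, ht⟩) hti
  calc volume E ≤ volume (⋃ i ∈ S, J i) := measure_mono hcover
    _ ≤ ∑ i ∈ S, volume (J i) := measure_biUnion_finset_le _ _
    _ = ∑ i ∈ S, ENNReal.ofReal h := by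
        refine Finset.sum_congr rfl fun i _ => ?_
        rw [hJ, Real.volume_Icc]; congr 1; ring
    _ = ENNReal.ofReal (S.card * h) := by
        rw [Finset.sum_const, nsmul_eq_mul, ENNReal.ofReal_mul (by positivity),
          ENNReal.ofReal_natCast]
    _ ≤ _ := by
        apply ENNReal.ofReal_le_ofReal
        calc S.card * h ≤ M * ℓ * h := by gcongr
          _ = π * ℓ / m := by rw [hh, hNR]; field_simp
          _ ≤ _ := by rw [div_le_div_iff₀ hm0 (by norm_num)]; linarith

/-- Smooth transition functions on the line, with two bounded derivatives. -/
theorem exists_cutoff {s₁ s₂ : ℝ} (h : s₁ < s₂) : ∃ β β' β'' : ℝ → ℝ, ∃ C : ℝ,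
    (∀ s, HasDerivAt β (β' s) s) ∧ (∀ s, HasDerivAt β' (β'' s) s) ∧ Continuous β'' ∧
    (∀ s, 0 ≤ β s) ∧ (∀ s, β s ≤ 1) ∧ (∀ s ≤ s₁, β s = 0) ∧ (∀ s, s₂ ≤ s → β s = 1) ∧
    (∀ s ≤ s₁, β' s = 0) ∧ (∀ s, s₂ ≤ s → β' s = 0) ∧ (∀ s, |β' s| ≤ C) ∧ (∀ s, |β'' s| ≤ C) := by
  set β : ℝ → ℝ := fun s => Real.smoothTransition ((s - s₁) / (s₂ - s₁)) with hβ
  have hd : 0 < s₂ - s₁ := by linarith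
  have hcd : ContDiff ℝ 2 β := by
    refine Real.smoothTransition.contDiff.comp ?_
    fun_prop
  have hcd1 : ContDiff ℝ 1 (deriv β) := hcd.deriv'
  have h1 : ∀ s, HasDerivAt β (deriv β s) s := fun s =>
    ((hcd.differentiable (by norm_num)) s).hasDerivAt
  have h2 : ∀ s, HasDerivAt (deriv β) (deriv (deriv β) s) s := fun s =>
    ((hcd1.differentiable (by norm_num)) s).hasDerivAt
  have h3 : Continuous (deriv (deriv β)) := hcd1.continuous_deriv le_rfl
  have h0 : ∀ s, 0 ≤ β s := fun s => Real.smoothTransition.nonneg _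
  have h1' : ∀ s, β s ≤ 1 := fun s => Real.smoothTransition.le_one _
  have hz : ∀ s ≤ s₁, β s = 0 := fun s hs =>
    Real.smoothTransition.zero_of_nonpos (div_nonpos_of_nonpos_of_nonneg (by linarith) hd.le)
  have ho : ∀ s, s₂ ≤ s → β s = 1 := fun s hs =>
    Real.smoothTransition.one_of_one_le (by rw [le_div_iff₀ hd]; linarith)
  have hz' : ∀ s ≤ s₁, deriv β s = 0 := fun s hs => by
    apply IsLocalMin.deriv_eq_zero
    exact Eventually.of_forall fun x => by rw [hz s hs]; exact h0 x
  have ho' : ∀ s, s₂ ≤ s → deriv β s = 0 := fun s hs => by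
    apply IsLocalMax.deriv_eq_zero
    exact Eventually.of_forall fun x => by rw [ho s hs]; exact h1' x
  obtain ⟨C₁, hC₁⟩ := (isCompact_Icc (a := s₁) (b := s₂)).exists_bound_of_continuousOn
    hcd1.continuous.continuousOn
  obtain ⟨C₂, hC₂⟩ := (isCompact_Icc (a := s₁) (b := s₂)).exists_bound_of_continuousOn
    h3.continuousOn
  have hmax : 0 ≤ max C₁ C₂ := ((norm_nonneg _).trans (hC₁ s₁ ⟨le_rfl, h.le⟩)).trans (le_max_left _ _)
  refine ⟨β, deriv β, deriv (deriv β), max C₁ C₂, h1, h2, h3, h0, h1', hz, ho, hz', ho', ?_, ?_⟩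
  · intro s
    by_cases hs : s ∈ Icc s₁ s₂
    · exact (hC₁ s hs).trans (le_max_left _ _)
    · have : deriv β s = 0 := by
        rcases le_or_gt s s₁ with h4 | h4
        · exact hz' s h4
        · exact ho' s (by by_contra h5; exact hs ⟨h4.le, by linarith⟩)
      rw [this]; simpa using hmax
  · intro s
    by_cases hs : s ∈ Icc s₁ s₂
    · exact (hC₂ s hs).trans (le_max_right _ _)
    · have : deriv (deriv β) s = 0 := by
        rcases lt_or_ge s s₁ with h4 | h4
        · have : deriv β =ᶠ[𝓝 s] fun _ => 0 := by
            filter_upwards [Iio_mem_nhds h4] with x hx using hz' x (le_of_lt hx)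
          rw [this.deriv_eq]; simp
        · have h5 : s₂ < s := by by_contra h5; exact hs ⟨h4, by linarith⟩
          have : deriv β =ᶠ[𝓝 s] fun _ => 0 := by
            filter_upwards [Ioi_mem_nhds h5] with x hx using ho' x (le_of_lt hx)
          rw [this.deriv_eq]; simp
      rw [this]; simpa using hmax

theorem hasW_log_norm {ζ : ℂ} (h0 : ζ ≠ 0) :
    HasW (fun w => (Real.log ‖w‖ : ℂ)) (1 / (2 * ζ)) (1 / (2 * conj ζ)) ζ := by
  have hpos : 0 < normSq ζ := normSq_pos.2 h0
  have h1 : HasDerivAt (fun s => Real.log s / 2) ((normSq ζ)⁻¹ / 2) (normSq ζ) :=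
    (Real.hasDerivAt_log hpos.ne').div_const 2
  have h2 := hasW_normSq (h := fun w => w) (h' := 1) (z := ζ) h1 (hasDerivAt_id ζ)
  have hc : conj ζ ≠ 0 := by simpa using h0
  refine (h2.congr_coeff ?_ ?_).congr (Eventually.of_forall fun w => ?_)
  · push_cast; rw [← mul_conj]; field_simp
  · push_cast; rw [← mul_conj]; simp; field_simp
  · simp only [normSq_eq_norm_sq, Real.log_pow]; congr 1; push_cast; ring

theorem HasW.real_comp {φ : ℂ → ℝ} {τ : ℝ → ℝ} {τ' : ℝ} {a b z : ℂ}
    (hτ : HasDerivAt τ τ' (φ z)) (hφ : HasW (fun w => (φ w : ℂ)) a b z) :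
    HasW (fun w => (τ (φ w) : ℂ)) (τ' * a) (τ' * b) z := by
  have h1 : HasFDerivAt φ (reCLM.comp (wirt a b)) z :=
    ((reCLM.hasFDerivAt (x := (φ z : ℂ))).comp z hφ).congr_of_eventuallyEq
      (Eventually.of_forall fun w => by simp)
  have h2 : wirt a b = ofRealCLM.comp (reCLM.comp (wirt a b)) :=
    HasFDerivAt.unique hφ ((ofRealCLM.hasFDerivAt (x := φ z)).comp z h1)
  have h3 := (ofRealCLM.hasFDerivAt (x := τ (φ z))).comp z (hτ.hasFDerivAt.comp z h1)
  refine h3.congr_fderiv ?_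
  ext1 v
  have h4 := congrArg (fun T => T v) h2
  simp only [ContinuousLinearMap.comp_apply, ofRealCLM_apply, reCLM_apply, wirt_apply] at h4
  rw [wirt_apply, mul_assoc, mul_assoc, ← mul_add, h4]
  simp [mul_comm]

theorem hasW_arg_comp {τ : ℝ → ℝ} {ζ : ℂ} {τ' : ℝ} (h0 : ζ ≠ 0)
    (hper : Function.Periodic τ (2 * π)) (hτ : HasDerivAt τ τ' (arg ζ)) :
    HasW (fun w => (τ (arg w) : ℂ)) (τ' / (2 * I * ζ)) (-(τ' / (2 * I * conj ζ))) ζ := by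
  have hc : conj ζ ≠ 0 := by simpa using h0
  have hlog : HasDerivAt (fun w => Complex.log (w / ζ)) (1 / ζ) ζ := by
    have := ((hasDerivAt_id ζ).div_const ζ).clog (by simp [h0, mem_slitPlane_iff])
    simpa [h0] using this
  have h1 := hasW_of_hasDerivAt hlog
  have h2 : HasW (fun w => ((arg (w / ζ) : ℝ) : ℂ)) (1 / (2 * I * ζ)) (-(1 / (2 * I * conj ζ))) ζ := by
    have h3 := (h1.sub h1.conj).mul (hasW_const (1 / (2 * I)) ζ)
    refine (h3.congr_coeff ?_ ?_).congr (Eventually.of_forall fun w => ?_)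
    · field_simp; simp
    · simp
    · simp only [sub_conj, log_im]; push_cast; field_simp
  have h2' : HasW (fun w => ((arg ζ + arg (w / ζ) : ℝ) : ℂ)) (1 / (2 * I * ζ))
      (-(1 / (2 * I * conj ζ))) ζ := by
    refine ((((hasW_const (arg ζ : ℂ) ζ).add h2)).congr_coeff (zero_add _) (zero_add _)).congr
      (Eventually.of_forall fun w => ?_)
    push_cast; rfl
  have h5 := HasW.real_comp (τ := τ) (τ' := τ') (by simpa [h0] using hτ) h2'
  refine (h5.congr_coeff (by ring) (by ring)).congr ?_
  filter_upwards [isOpen_ne.mem_nhds h0] with w hw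
  have h6 : ((arg w : ℝ) : Real.Angle) = ((arg ζ + arg (w / ζ) : ℝ) : Real.Angle) := by
    rw [Real.Angle.coe_add, ← arg_mul_coe_angle h0 (div_ne_zero hw h0), mul_div_cancel₀ _ h0]
  obtain ⟨n, hn⟩ := Real.Angle.angle_eq_iff_two_pi_dvd_sub.1 h6
  have h7 : arg w = (arg ζ + arg (w / ζ)) + n * (2 * π) := by linarith
  rw [h7, hper.int_mul n]

section

/-- The least modulus of `g` along the (hyperbolic) ray from `a` in direction `t`. -/
noncomputable def radMin (g : ℂ → ℂ) (a : ℂ) (t : ℝ) : ℝ :=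
  sInf ((fun r : Icc (0 : ℝ) 1 => ‖g (moeb (-a) ((r : ℝ) * cexp (t * I)))‖) '' univ)

/-- Unnormalised angular distribution of the channels leaving `a`. -/
noncomputable def chan₀ (g : ℂ → ℂ) (ε : ℝ) (a : ℂ) (t : ℝ) : ℝ :=
  max 0 (1 / 2 + (conj a * cexp (t * I)).re) * max 0 (min 1 (2 / ε * radMin g a t - 1))

/-- Angular distribution of the channels leaving `a`. -/
noncomputable def chan (g : ℂ → ℂ) (ε : ℝ) (a : ℂ) (t : ℝ) : ℝ :=
  2 * π * chan₀ g ε a t / max 1 (∫ s in (0 : ℝ)..2 * π, chan₀ g ε a s)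

/-- The angular part of the single-charge potential. -/
noncomputable def angPot (g : ℂ → ℂ) (ε : ℝ) (a : ℂ) (t : ℝ) : ℝ :=
  ∫ s in (0 : ℝ)..t, (1 - chan g ε a s)

variable {g : ℂ → ℂ} {ε R : ℝ} {a : ℂ}

theorem norm_moeb_le {a z : ℂ} (ha : ‖a‖ < 1) (hz : ‖z‖ ≤ 1) : ‖moeb a z‖ ≤ 1 := by
  have h := one_sub_normSq_moeb ha hz
  have h1 : 0 ≤ (1 - normSq a) * (1 - normSq z) / normSq (1 - conj a * z) := by
    apply div_nonneg _ (normSq_nonneg _)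
    simp only [normSq_eq_norm_sq]
    apply mul_nonneg <;> nlinarith [norm_nonneg a, norm_nonneg z]
  rw [← h, normSq_eq_norm_sq] at h1
  nlinarith [norm_nonneg (moeb a z)]

theorem norm_polar_le {r : ℝ} (hr : r ∈ Icc (0 : ℝ) 1) (t : ℝ) : ‖(r : ℂ) * cexp (t * I)‖ ≤ 1 := by
  rw [norm_mul, norm_exp_ofReal_mul_I, norm_real, Real.norm_eq_abs, abs_of_nonneg hr.1, mul_one]
  exact hr.2

theorem continuous_radMin (hg : ContinuousOn g (closedBall 0 1)) :
    Continuous fun x : ball (0 : ℂ) 1 × ℝ => radMin g x.1 x.2 := by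
  refine isCompact_univ.continuous_sInf (K := (univ : Set (Icc (0 : ℝ) 1)))
    (f := fun (x : ball (0 : ℂ) 1 × ℝ) (r : Icc (0 : ℝ) 1) =>
      ‖g (moeb (-(x.1 : ℂ)) ((r : ℝ) * cexp (x.2 * I)))‖) ?_
  have h1 : ∀ p : (ball (0 : ℂ) 1 × ℝ) × Icc (0 : ℝ) 1, ‖(-(p.1.1 : ℂ))‖ < 1 := fun p => by
    rw [norm_neg]; exact mem_ball_zero_iff.1 p.1.1.2
  have hc : Continuous fun p : (ball (0 : ℂ) 1 × ℝ) × Icc (0 : ℝ) 1 =>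
      moeb (-(p.1.1 : ℂ)) ((p.2 : ℝ) * cexp (p.1.2 * I)) := by
    unfold moeb
    refine Continuous.div (by fun_prop) ?_ fun p =>
      one_sub_conj_mul_ne_zero (h1 p) (norm_polar_le p.2.2 _)
    have := continuous_conj
    fun_prop
  exact (hg.comp_continuous hc fun p =>
    mem_closedBall_zero_iff.2 (norm_moeb_le (h1 p) (norm_polar_le p.2.2 _))).norm

theorem radMin_le {r t : ℝ} (hr : r ∈ Icc (0 : ℝ) 1) :
    radMin g a t ≤ ‖g (moeb (-a) (r * cexp (t * I)))‖ :=
  csInf_le ⟨0, by rintro _ ⟨r, _, rfl⟩; exact norm_nonneg _⟩ ⟨⟨r, hr⟩, mem_univ _, rfl⟩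

theorem le_radMin {t : ℝ} {m : ℝ}
    (h : ∀ r ∈ Icc (0 : ℝ) 1, m ≤ ‖g (moeb (-a) (r * cexp (t * I)))‖) : m ≤ radMin g a t :=
  le_csInf (image_nonempty.2 ⟨⟨0, by simp⟩, mem_univ _⟩) (by
    rintro _ ⟨r, _, rfl⟩; exact h r r.2)

theorem exp_add_two_pi_I (t : ℝ) : cexp ((t + 2 * π : ℝ) * I) = cexp (t * I) := by
  push_cast; rw [add_mul, Complex.exp_add, Complex.exp_two_pi_mul_I, mul_one]

theorem periodic_chan₀ : Function.Periodic (chan₀ g ε a) (2 * π) := fun t => by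
  simp only [chan₀, radMin, exp_add_two_pi_I]

theorem periodic_chan : Function.Periodic (chan g ε a) (2 * π) := fun t => by
  simp only [chan, periodic_chan₀ t]

theorem continuous_chan₀ (hg : ContinuousOn g (closedBall 0 1)) :
    Continuous fun x : ball (0 : ℂ) 1 × ℝ => chan₀ g ε x.1 x.2 := by
  have h1 := continuous_radMin hg
  have := continuous_conj
  have h2 : Continuous fun x : ball (0 : ℂ) 1 × ℝ => (conj (x.1 : ℂ) * cexp (x.2 * I)).re := by
    have : Continuous fun x : ball (0 : ℂ) 1 × ℝ => conj (x.1 : ℂ) * cexp (x.2 * I) := by fun_prop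
    exact continuous_re.comp this
  unfold chan₀
  fun_prop

theorem continuous_chan (hg : ContinuousOn g (closedBall 0 1)) :
    Continuous fun x : ball (0 : ℂ) 1 × ℝ => chan g ε x.1 x.2 := by
  have h1 := continuous_chan₀ (ε := ε) hg
  have h2 : Continuous fun a : ball (0 : ℂ) 1 => ∫ s in (0 : ℝ)..2 * π, chan₀ g ε a s :=
    intervalIntegral.continuous_parametric_intervalIntegral_of_continuous
      (f := fun (a : ball (0 : ℂ) 1) s => chan₀ g ε a s) h1 continuous_const
  unfold chan
  refine Continuous.div (by fun_prop) ?_ fun x => (lt_of_lt_of_le one_pos (le_max_left _ _)).ne'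
  have := h2.comp (continuous_fst (X := ball (0 : ℂ) 1) (Y := ℝ))
  exact continuous_const.max this

theorem continuous_angPot (hg : ContinuousOn g (closedBall 0 1)) :
    Continuous fun x : ball (0 : ℂ) 1 × ℝ => angPot g ε x.1 x.2 := by
  have h1 := continuous_chan (ε := ε) hg
  refine intervalIntegral.continuous_parametric_intervalIntegral_of_continuous
    (f := fun (x : ball (0 : ℂ) 1 × ℝ) s => 1 - chan g ε x.1 s) ?_ continuous_snd
  have : Continuous fun p : (ball (0 : ℂ) 1 × ℝ) × ℝ => chan g ε p.1.1 p.2 :=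
    h1.comp ((continuous_fst.comp continuous_fst).prodMk continuous_snd)
  exact continuous_const.sub this

theorem chan₀_nonneg (t : ℝ) : 0 ≤ chan₀ g ε a t :=
  mul_nonneg (le_max_left _ _) (le_max_left _ _)

theorem chan_nonneg (t : ℝ) : 0 ≤ chan g ε a t := by
  have := chan₀_nonneg (g := g) (ε := ε) (a := a) t
  unfold chan
  positivity

theorem chan₀_le (ha : ‖a‖ < 1) (t : ℝ) : chan₀ g ε a t ≤ 3 / 2 := by
  have h1 : (conj a * cexp (t * I)).re ≤ 1 := (re_le_norm _).trans (by
    rw [norm_mul, norm_conj, norm_exp_ofReal_mul_I]; linarith)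
  have h2 : max 0 (1 / 2 + (conj a * cexp (t * I)).re) ≤ 3 / 2 := max_le (by norm_num) (by linarith)
  have h3 : max 0 (min 1 (2 / ε * radMin g a t - 1)) ≤ 1 := max_le (by norm_num) (min_le_left _ _)
  calc chan₀ g ε a t ≤ 3 / 2 * 1 := mul_le_mul h2 h3 (le_max_left _ _) (by norm_num)
    _ = _ := by ring

theorem chan_le (ha : ‖a‖ < 1) (t : ℝ) : chan g ε a t ≤ 3 * π := by
  unfold chan
  rw [div_le_iff₀ (lt_of_lt_of_le one_pos (le_max_left _ _))]
  have h1 := chan₀_le (g := g) (ε := ε) ha t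
  have h2 := le_max_left 1 (∫ s in (0 : ℝ)..2 * π, chan₀ g ε a s)
  have := Real.pi_pos
  nlinarith

theorem chan_eq_zero (hε : 0 < ε) {t : ℝ} (h : radMin g a t ≤ ε / 2) : chan g ε a t = 0 := by
  have : min 1 (2 / ε * radMin g a t - 1) ≤ 0 := (min_le_right _ _).trans (by
    have : 2 / ε * radMin g a t ≤ 2 / ε * (ε / 2) := by gcongr
    have e : 2 / ε * (ε / 2) = 1 := by field_simp
    linarith)
  simp [chan, chan₀, max_eq_left this]

theorem re_of_chan_ne_zero {t : ℝ} (h : chan g ε a t ≠ 0) : -(1 / 2) ≤ (conj a * cexp (t * I)).re := by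
  by_contra hcon
  apply h
  have : max 0 (1 / 2 + (conj a * cexp (t * I)).re) = 0 := max_eq_left (by linarith)
  simp only [chan, chan₀, this, zero_mul, mul_zero, zero_div]

theorem continuous_chan_right (hg : ContinuousOn g (closedBall 0 1)) (ha : ‖a‖ < 1) :
    Continuous (chan g ε a) :=
  (continuous_chan hg).comp (Continuous.prodMk_right (⟨a, mem_ball_zero_iff.2 ha⟩ : ball (0 : ℂ) 1))

theorem continuous_chan₀_right (hg : ContinuousOn g (closedBall 0 1)) (ha : ‖a‖ < 1) :
    Continuous (chan₀ g ε a) :=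
  (continuous_chan₀ hg).comp (Continuous.prodMk_right (⟨a, mem_ball_zero_iff.2 ha⟩ : ball (0 : ℂ) 1))

/-- Every charge has channels of total mass at least one (Hall's lemma). -/
theorem exists_one_le_integral_chan₀ {δ : ℝ} (hδ : 0 < δ) (hδ1 : δ ≤ 1) :
    ∃ ε : ℝ, 0 < ε ∧ ε ≤ δ / 8 ∧ ∀ g : ℂ → ℂ, ∀ R : ℝ, 1 < R → DifferentiableOn ℂ g (ball 0 R) →
      (∀ z ∈ closedBall (0 : ℂ) 1, ‖g z‖ ≤ 1) → ∀ a : ℂ, ‖a‖ < 1 → δ ≤ ‖g a‖ →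
      1 ≤ ∫ s in (0 : ℝ)..2 * π, chan₀ g ε a s := by
  obtain ⟨ε, hε, hε8, hall⟩ := hall hδ hδ1
  refine ⟨ε, hε, hε8, fun g R hR hg hg1 a ha hga => ?_⟩
  have hna : ‖-a‖ < 1 := by simpa using ha
  have hgc : ContinuousOn g (closedBall 0 1) := hg.continuousOn.mono (closedBall_subset_ball hR)
  have hmc : ∀ z ∈ closedBall (0 : ℂ) 1, DifferentiableAt ℂ (moeb (-a)) z := fun z hz =>
    (hasDerivAt_moeb (one_sub_conj_mul_ne_zero hna (mem_closedBall_zero_iff.1 hz))).differentiableAt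
  have hmaps : MapsTo (moeb (-a)) (closedBall 0 1) (closedBall 0 1) := fun z hz =>
    mem_closedBall_zero_iff.2 (norm_moeb_le hna (mem_closedBall_zero_iff.1 hz))
  have hd : DifferentiableOn ℂ (g ∘ moeb (-a)) (closedBall 0 1) := fun z hz =>
    ((hg.differentiableAt (isOpen_ball.mem_nhds (closedBall_subset_ball hR (hmaps hz)))).comp z
      (hmc z hz)).differentiableWithinAt
  have hE := hall (g ∘ moeb (-a)) (by
    apply DifferentiableOn.diffContOnCl; rwa [closure_ball _ one_ne_zero])
    (fun z hz => hg1 _ (hmaps hz)) (by simpa using hga) (arg a - π / 2)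
  set t₀ := arg a - π / 2 with ht₀
  set E := {φ ∈ Icc t₀ (t₀ + π) | ∃ r ∈ Icc (0 : ℝ) 1, ‖(g ∘ moeb (-a)) (r * cexp (φ * I))‖ < ε}
    with hEdef
  have hc0 := continuous_chan₀_right (ε := ε) hgc ha
  have hper : ∫ s in (0 : ℝ)..2 * π, chan₀ g ε a s = ∫ s in t₀..t₀ + 2 * π, chan₀ g ε a s := by
    have := (periodic_chan₀ (g := g) (ε := ε) (a := a)).intervalIntegral_add_eq 0 t₀
    simpa using this
  rw [hper]
  have hsplit := intervalIntegral.integral_add_adjacent_intervals (μ := volume)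
    (hc0.intervalIntegrable t₀ (t₀ + π)) (hc0.intervalIntegrable (t₀ + π) (t₀ + 2 * π))
  have hπ := Real.pi_pos
  have h2 : 0 ≤ ∫ s in (t₀ + π)..(t₀ + 2 * π), chan₀ g ε a s :=
    intervalIntegral.integral_nonneg (by linarith) fun s _ => chan₀_nonneg s
  suffices h : 1 ≤ ∫ s in t₀..t₀ + π, chan₀ g ε a s by linarith
  have hq : ∀ s ∈ Icc t₀ (t₀ + π), 0 ≤ (conj a * cexp (s * I)).re := by
    intro s hs
    have e : conj a * cexp (s * I) = ‖a‖ * cexp ((s - arg a : ℝ) * I) := by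
      conv_lhs => rw [← norm_mul_exp_arg_mul_I a]
      rw [map_mul, conj_ofReal, ← exp_conj, mul_assoc, ← Complex.exp_add]
      simp; ring_nf; simp
    rw [e, re_ofReal_mul, exp_ofReal_mul_I_re]
    exact mul_nonneg (norm_nonneg _) (Real.cos_nonneg_of_mem_Icc ⟨by linarith [hs.1], by linarith [hs.2]⟩)
  have hgood : ∀ s ∈ Icc t₀ (t₀ + π) \ E, 1 / 2 ≤ chan₀ g ε a s := by
    intro s hs
    have h3 : ε ≤ radMin g a s := le_radMin fun r hr => by
      by_contra hcon
      exact hs.2 ⟨hs.1, r, hr, not_le.1 hcon⟩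
    have h4 : 1 / 2 ≤ max 0 (1 / 2 + (conj a * cexp (s * I)).re) :=
      le_max_of_le_right (by linarith [hq s hs.1])
    have h5 : 1 ≤ max 0 (min 1 (2 / ε * radMin g a s - 1)) := by
      refine le_max_of_le_right (le_min le_rfl ?_)
      have : 2 / ε * ε ≤ 2 / ε * radMin g a s := by gcongr
      rw [div_mul_cancel₀ _ hε.ne'] at this; linarith
    calc (1 : ℝ) / 2 = 1 / 2 * 1 := by ring
      _ ≤ _ := mul_le_mul h4 h5 (by norm_num) (le_max_left _ _)
  set A := {s ∈ Icc t₀ (t₀ + π) | 1 / 2 ≤ chan₀ g ε a s} with hA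
  have hAm : MeasurableSet A := (isClosed_Icc.inter (isClosed_le continuous_const hc0)).measurableSet
  have hcov : Icc t₀ (t₀ + π) ⊆ A ∪ E := fun s hs => by
    by_cases hsE : s ∈ E
    · exact Or.inr hsE
    · exact Or.inl ⟨hs, hgood s ⟨hs, hsE⟩⟩
  have hAfin : volume A ≠ ⊤ := ne_top_of_le_ne_top (by simp) (measure_mono (fun s hs => hs.1 :
    A ⊆ Icc t₀ (t₀ + π)))
  have hvol : π - 1 / 2 ≤ volume.real A := by
    have h3 : volume (Icc t₀ (t₀ + π)) ≤ volume A + ENNReal.ofReal (1 / 2) :=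
      (measure_mono hcov).trans ((measure_union_le _ _).trans (by gcongr))
    rw [Real.volume_Icc, ← ofReal_measureReal hAfin, ← ENNReal.ofReal_add (by positivity) (by norm_num),
      ENNReal.ofReal_le_ofReal_iff (by positivity)] at h3
    linarith
  have h6 : ∫ s in A, (1 / 2 : ℝ) ≤ ∫ s in Icc t₀ (t₀ + π), chan₀ g ε a s := by
    calc ∫ s in A, (1 / 2 : ℝ) ≤ ∫ s in A, chan₀ g ε a s := by
          apply setIntegral_mono_on (integrableOn_const hAfin) _ hAm fun s hs => hs.2
          exact (hc0.integrableOn_Icc).mono_set fun s hs => hs.1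
      _ ≤ _ := setIntegral_mono_set hc0.integrableOn_Icc
          (Eventually.of_forall fun s => chan₀_nonneg s) (Eventually.of_forall fun s hs => hs.1)
  rw [setIntegral_const, smul_eq_mul] at h6
  rw [intervalIntegral.integral_of_le (by linarith), ← integral_Icc_eq_integral_Ioc]
  linarith [Real.pi_gt_three]

end

theorem continuousAt_periodic_comp_arg {E : Type*} [TopologicalSpace E] {P : ℝ → E}
    (hP : Continuous P) (hper : Function.Periodic P (2 * π)) {ζ : ℂ} (h0 : ζ ≠ 0) :
    ContinuousAt (fun w => P (arg w)) ζ := by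
  have h1 : Continuous (hper.lift) := continuous_quot_lift _ hP
  have h2 := h1.continuousAt.comp (continuousAt_arg_coe_angle h0)
  exact h2

theorem abs_log_norm_le {m : ℝ} (hm : 0 < m) {ζ : ℂ} (h1 : m ≤ ‖ζ‖) (h2 : ‖ζ‖ < 1) :
    |Real.log ‖ζ‖| ≤ (1 - normSq ζ) / m := by
  have h0 : 0 < ‖ζ‖ := hm.trans_le h1
  rw [abs_of_nonpos (Real.log_nonpos h0.le h2.le)]
  have h3 := Real.one_sub_inv_le_log_of_pos h0
  have h4 : ‖ζ‖⁻¹ - 1 = (1 - ‖ζ‖) / ‖ζ‖ := by field_simp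
  have h5 : (1 - ‖ζ‖) / ‖ζ‖ ≤ (1 - ‖ζ‖) / m := by
    apply div_le_div_of_nonneg_left _ hm h1; linarith
  have h6 : (1 - ‖ζ‖) / m ≤ (1 - normSq ζ) / m := by
    rw [normSq_eq_norm_sq]; gcongr; nlinarith
  linarith

section
variable {g : ℂ → ℂ} {ε : ℝ} {a : ℂ}

theorem hasDerivAt_angPot (hg : ContinuousOn g (closedBall 0 1)) (ha : ‖a‖ < 1) (t : ℝ) :
    HasDerivAt (angPot g ε a) (1 - chan g ε a t) t := by
  have hc : Continuous fun s => 1 - chan g ε a s :=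
    continuous_const.sub (continuous_chan_right hg ha)
  exact intervalIntegral.integral_hasDerivAt_right (hc.intervalIntegrable _ _)
    hc.stronglyMeasurable.stronglyMeasurableAtFilter hc.continuousAt

theorem periodic_angPot (hg : ContinuousOn g (closedBall 0 1)) (ha : ‖a‖ < 1)
    (hm : 1 ≤ ∫ s in (0 : ℝ)..2 * π, chan₀ g ε a s) :
    Function.Periodic (angPot g ε a) (2 * π) := fun t => by
  have hc : Continuous fun s => 1 - chan g ε a s :=
    continuous_const.sub (continuous_chan_right hg ha)
  have hp : Function.Periodic (fun s => 1 - chan g ε a s) (2 * π) := fun s => by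
    simp only [periodic_chan s]
  have h1 := hp.intervalIntegral_add_eq 0 t
  have h2 : ∫ s in (0 : ℝ)..2 * π, (1 - chan g ε a s) = 0 := by
    rw [intervalIntegral.integral_sub (by simp)
      ((continuous_chan_right hg ha).intervalIntegrable _ _)]
    have : ∫ s in (0 : ℝ)..2 * π, chan g ε a s = 2 * π := by
      unfold chan
      rw [intervalIntegral.integral_div, intervalIntegral.integral_const_mul, max_eq_right hm]
      field_simp
    rw [this]; simp
  rw [zero_add] at h1
  have h3 := intervalIntegral.integral_add_adjacent_intervals (μ := volume)
    (hc.intervalIntegrable 0 t) (hc.intervalIntegrable t (t + 2 * π))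
  unfold angPot
  rw [← h3, ← h1, h2, add_zero]

theorem abs_angPot_le (ha : ‖a‖ < 1) {t : ℝ} (ht : |t| ≤ π) : |angPot g ε a t| ≤ 50 := by
  have hπ := Real.pi_pos
  have hπ2 := Real.pi_lt_d2
  have h : ‖∫ s in (0 : ℝ)..t, (1 - chan g ε a s)‖ ≤ (1 + 3 * π) * |t - 0| := by
    apply intervalIntegral.norm_integral_le_of_norm_le_const
    intro s _
    rw [Real.norm_eq_abs, abs_le]
    constructor <;> linarith [chan_nonneg (g := g) (ε := ε) (a := a) s,
      chan_le (g := g) (ε := ε) ha s]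
  rw [Real.norm_eq_abs, sub_zero] at h
  refine h.trans ?_
  nlinarith

/-- The potential of a single charge at `a`, in the coordinate `ζ = moeb a z`. -/
noncomputable def potS (β : ℝ → ℝ) (g : ℂ → ℂ) (ε : ℝ) (a ζ : ℂ) : ℂ :=
  β (normSq ζ) * (Real.log ‖ζ‖ + I * angPot g ε a (arg ζ))

/-- The `∂`-derivative of `potS`. -/
noncomputable def potA (β β' : ℝ → ℝ) (g : ℂ → ℂ) (ε : ℝ) (a ζ : ℂ) : ℂ :=
  β' (normSq ζ) * conj ζ * (Real.log ‖ζ‖ + I * angPot g ε a (arg ζ)) +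
    β (normSq ζ) * ((2 - chan g ε a (arg ζ)) / (2 * ζ))

/-- The `∂̄`-derivative of `potS`. -/
noncomputable def potD (β β' : ℝ → ℝ) (g : ℂ → ℂ) (ε : ℝ) (a ζ : ℂ) : ℂ :=
  β' (normSq ζ) * ζ * (Real.log ‖ζ‖ + I * angPot g ε a (arg ζ)) +
    β (normSq ζ) * (chan g ε a (arg ζ) / (2 * conj ζ))

variable {β β' : ℝ → ℝ}

theorem hasW_potS (hg : ContinuousOn g (closedBall 0 1)) (ha : ‖a‖ < 1)
    (hm : 1 ≤ ∫ s in (0 : ℝ)..2 * π, chan₀ g ε a s) (hβ : ∀ s, HasDerivAt β (β' s) s)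
    {ζ : ℂ} (h0 : ζ ≠ 0) : HasW (potS β g ε a) (potA β β' g ε a ζ) (potD β β' g ε a ζ) ζ := by
  have h1 := hasW_normSq (h := fun w => w) (z := ζ) (hβ (normSq ζ)) (hasDerivAt_id ζ)
  have h2 := (hasW_const I ζ).mul (hasW_arg_comp h0 (periodic_angPot hg ha hm)
    (hasDerivAt_angPot hg ha (arg ζ)))
  have h3 := h1.mul ((hasW_log_norm h0).add h2)
  have hc0 : conj ζ ≠ 0 := (map_ne_zero _).2 h0
  refine h3.congr_coeff ?_ ?_
  · unfold potA
    push_cast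
    field_simp
    ring
  · unfold potD
    rw [map_one]
    push_cast
    field_simp
    ring

theorem continuousAt_potA_potD (hg : ContinuousOn g (closedBall 0 1)) (ha : ‖a‖ < 1)
    (hm : 1 ≤ ∫ s in (0 : ℝ)..2 * π, chan₀ g ε a s) (hβ : Continuous β) (hβ' : Continuous β')
    {ζ : ℂ} (h0 : ζ ≠ 0) :
    ContinuousAt (potA β β' g ε a) ζ ∧ ContinuousAt (potD β β' g ε a) ζ := by
  have hc := continuous_conj
  have h1 : ContinuousAt (fun w => angPot g ε a (arg w)) ζ := continuousAt_periodic_comp_arg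
    (continuous_iff_continuousAt.2 fun t => (hasDerivAt_angPot hg ha t).continuousAt)
    (periodic_angPot hg ha hm) h0
  have h2 : ContinuousAt (fun w => chan g ε a (arg w)) ζ := continuousAt_periodic_comp_arg
    (continuous_chan_right hg ha) periodic_chan h0
  have h1' : ContinuousAt (fun w => (angPot g ε a (arg w) : ℂ)) ζ :=
    continuous_ofReal.continuousAt.comp h1
  have h2' : ContinuousAt (fun w => (chan g ε a (arg w) : ℂ)) ζ :=
    continuous_ofReal.continuousAt.comp h2
  have h3 : ContinuousAt (fun w : ℂ => (Real.log ‖w‖ : ℂ)) ζ := (hasW_log_norm h0).continuousAt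
  have hc0 : conj ζ ≠ 0 := (map_ne_zero _).2 h0
  have h4 : ContinuousAt (fun w : ℂ => (β (normSq w) : ℂ)) ζ := by
    have : Continuous (fun w : ℂ => (β (normSq w) : ℂ)) := by fun_prop
    exact this.continuousAt
  have h5 : ContinuousAt (fun w : ℂ => (β' (normSq w) : ℂ)) ζ := by
    have : Continuous (fun w : ℂ => (β' (normSq w) : ℂ)) := by fun_prop
    exact this.continuousAt
  have h6 : ContinuousAt (fun w : ℂ => conj w) ζ := hc.continuousAt
  have h7 : (2 : ℂ) * ζ ≠ 0 := mul_ne_zero two_ne_zero h0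
  have h8 : (2 : ℂ) * conj ζ ≠ 0 := mul_ne_zero two_ne_zero hc0
  have h9 : ContinuousAt (fun w : ℂ => (Real.log ‖w‖ : ℂ) + I * angPot g ε a (arg w)) ζ :=
    h3.add (continuousAt_const.mul h1')
  have h10 : ContinuousAt (fun w : ℂ => 2 * w) ζ := by fun_prop
  have h11 : ContinuousAt (fun w : ℂ => 2 * conj w) ζ := by fun_prop
  have h12 : ContinuousAt (fun w : ℂ => (2 - chan g ε a (arg w)) / (2 * w)) ζ :=
    (continuousAt_const.sub h2').div h10 h7
  have h13 : ContinuousAt (fun w : ℂ => chan g ε a (arg w) / (2 * conj w)) ζ := h2'.div h11 h8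
  have h14 : ContinuousAt (fun w : ℂ => w) ζ := continuousAt_id
  exact ⟨((h5.mul h6).mul h9).add (h4.mul h12), ((h5.mul h14).mul h9).add (h4.mul h13)⟩

set_option maxHeartbeats 400000 in
theorem measurable_pot (hg : ContinuousOn g (closedBall 0 1)) (hβ : Continuous β)
    (hβ' : Continuous β') (z : ℂ) :
    AEStronglyMeasurable (fun a => potS β g ε a (moeb a z)) (volume.restrict (ball 0 1)) ∧
    AEStronglyMeasurable (fun a => potA β β' g ε a (moeb a z)) (volume.restrict (ball 0 1)) ∧
    AEStronglyMeasurable (fun a => potD β β' g ε a (moeb a z)) (volume.restrict (ball 0 1)) := by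
  have hc := continuous_conj
  have hcm : Measurable (fun w : ℂ => conj w) := hc.measurable
  have hmo : Measurable fun a : ℂ => moeb a z := by
    unfold moeb
    fun_prop
  have hmo' : Measurable fun a : ball (0 : ℂ) 1 => moeb (a : ℂ) z := hmo.comp measurable_subtype_coe
  have hpr : Measurable fun a : ball (0 : ℂ) 1 => (a, arg (moeb (a : ℂ) z)) :=
    measurable_id.prodMk (measurable_arg.comp hmo')
  have h1 : Measurable fun a : ball (0 : ℂ) 1 => angPot g ε a (arg (moeb a z)) :=
    Measurable.comp (g := fun x : ball (0 : ℂ) 1 × ℝ => angPot g ε x.1 x.2)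
      (f := fun a : ball (0 : ℂ) 1 => (a, arg (moeb (a : ℂ) z)))
      (continuous_angPot hg).measurable hpr
  have h2 : Measurable fun a : ball (0 : ℂ) 1 => chan g ε a (arg (moeb a z)) :=
    Measurable.comp (g := fun x : ball (0 : ℂ) 1 × ℝ => chan g ε x.1 x.2)
      (f := fun a : ball (0 : ℂ) 1 => (a, arg (moeb (a : ℂ) z)))
      (continuous_chan hg).measurable hpr
  have h1' : Measurable fun a : ball (0 : ℂ) 1 => (angPot g ε a (arg (moeb a z)) : ℂ) :=
    measurable_ofReal.comp h1
  have h2' : Measurable fun a : ball (0 : ℂ) 1 => (chan g ε a (arg (moeb a z)) : ℂ) :=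
    measurable_ofReal.comp h2
  have h3 : Measurable fun a : ball (0 : ℂ) 1 => (Real.log ‖moeb a z‖ : ℂ) :=
    measurable_ofReal.comp (Real.measurable_log.comp hmo'.norm)
  have h4 : Measurable fun a : ball (0 : ℂ) 1 => (β (normSq (moeb a z)) : ℂ) := by
    have : Continuous (fun w : ℂ => (β (normSq w) : ℂ)) := by fun_prop
    exact this.measurable.comp hmo'
  have h5 : Measurable fun a : ball (0 : ℂ) 1 => (β' (normSq (moeb a z)) : ℂ) := by
    have : Continuous (fun w : ℂ => (β' (normSq w) : ℂ)) := by fun_prop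
    exact this.measurable.comp hmo'
  have h6 : Measurable fun a : ball (0 : ℂ) 1 => conj (moeb a z) := hcm.comp hmo'
  have key : ∀ F : ℂ → ℂ, Measurable (fun a : ball (0 : ℂ) 1 => F a) →
      AEStronglyMeasurable F (volume.restrict (ball 0 1)) := by
    intro F hF
    rw [← map_comap_subtype_coe measurableSet_ball,
      (MeasurableEmbedding.subtype_coe measurableSet_ball).aestronglyMeasurable_map_iff]
    exact hF.aestronglyMeasurable
  have h9 : Measurable fun a : ball (0 : ℂ) 1 =>
      (Real.log ‖moeb a z‖ : ℂ) + I * angPot g ε a (arg (moeb a z)) :=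
    h3.add (measurable_const.mul h1')
  have h10 : Measurable fun a : ball (0 : ℂ) 1 => 2 * moeb (a : ℂ) z := measurable_const.mul hmo'
  have h11 : Measurable fun a : ball (0 : ℂ) 1 => 2 * conj (moeb (a : ℂ) z) :=
    measurable_const.mul h6
  have h12 : Measurable fun a : ball (0 : ℂ) 1 =>
      (2 - chan g ε a (arg (moeb a z)) : ℂ) / (2 * moeb a z) := (measurable_const.sub h2').div h10
  have h13 : Measurable fun a : ball (0 : ℂ) 1 =>
      (chan g ε a (arg (moeb a z)) : ℂ) / (2 * conj (moeb a z)) := h2'.div h11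
  have k1 := key (fun a => potS β g ε a (moeb a z)) (h4.mul h9)
  have k2 := key (fun a => potA β β' g ε a (moeb a z)) (((h5.mul h6).mul h9).add (h4.mul h12))
  have k3 := key (fun a => potD β β' g ε a (moeb a z)) (((h5.mul hmo').mul h9).add (h4.mul h13))
  exact ⟨k1, k2, k3⟩

end

/-- Single-charge potentials: `S a (moeb a z)` is a potential of a point charge at `a` whose
`∂̄`-derivative is bounded and supported in channels avoiding the set where `g` is small. -/
theorem exists_pot {δ : ℝ} (hδ : 0 < δ) (hδ1 : δ ≤ 1) :
    ∃ ε₂ M : ℝ, 0 < ε₂ ∧ ε₂ ≤ δ / 16 ∧ 0 ≤ M ∧ ∀ g : ℂ → ℂ, ∀ R : ℝ, 1 < R →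
      DifferentiableOn ℂ g (ball 0 R) → (∀ z ∈ closedBall (0 : ℂ) 1, ‖g z‖ ≤ 1) →
      ∃ S A D : ℂ → ℂ → ℂ,
        (∀ z, AEStronglyMeasurable (fun a => S a (moeb a z)) (volume.restrict (ball 0 1)) ∧
          AEStronglyMeasurable (fun a => A a (moeb a z)) (volume.restrict (ball 0 1)) ∧
          AEStronglyMeasurable (fun a => D a (moeb a z)) (volume.restrict (ball 0 1))) ∧
        ∀ a, ‖a‖ < 1 → δ ≤ ‖g a‖ → ∀ ζ, ‖ζ‖ < 1 →
          HasW (S a) (A a ζ) (D a ζ) ζ ∧ ContinuousAt (A a) ζ ∧ ContinuousAt (D a) ζ ∧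
          ‖S a ζ‖ ≤ M ∧ ‖A a ζ‖ ≤ M ∧ ‖D a ζ‖ ≤ M ∧
          |(S a ζ).re| ≤ M * (1 - normSq ζ) ∧
          (D a ζ ≠ 0 → 1 / 2 ≤ ‖1 + conj a * ζ‖) ∧
          (‖g (moeb (-a) ζ)‖ < ε₂ → D a ζ = 0 ∧ A a ζ = 1 / ζ) := by
  obtain ⟨ε, hε, hε8, hmass⟩ := exists_one_le_integral_chan₀ hδ hδ1
  set m := δ / 8 with hm
  have hm0 : 0 < m := by positivity
  obtain ⟨β, β', β'', C, hβ, hβ2, -, hβ0, hβ1, hβl, hβr, hβl', hβr', hβC, -⟩ :=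
    exists_cutoff (s₁ := m ^ 2) (s₂ := (2 * m) ^ 2) (by nlinarith)
  have hC : 0 ≤ C := (abs_nonneg _).trans (hβC 0)
  have hβc : Continuous β := continuous_iff_continuousAt.2 fun s => (hβ s).continuousAt
  have hβc' : Continuous β' := continuous_iff_continuousAt.2 fun s => (hβ2 s).continuousAt
  set N := C * (1 / m + 50) + (1 / m + 50) + 15 / m with hN
  have hNm : 1 / m ≤ N := by
    have : 0 ≤ C * (1 / m + 50) + 50 + 15 / m := by positivity
    linarith
  refine ⟨ε / 2, N, by positivity, by linarith, by positivity, fun g R hR hg hg1 => ?_⟩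
  have hgc : ContinuousOn g (closedBall 0 1) := hg.continuousOn.mono (closedBall_subset_ball hR)
  refine ⟨potS β g ε, potA β β' g ε, potD β β' g ε, measurable_pot hgc hβc hβc', ?_⟩
  intro a ha hga ζ hζ
  have hna : ‖-a‖ < 1 := by simpa using ha
  have hma := hmass g R hR hg hg1 a ha hga
  have hπ := Real.pi_lt_d2
  have hY : ‖(angPot g ε a (arg ζ) : ℂ)‖ ≤ 50 := by
    rw [norm_real]; exact abs_angPot_le ha (abs_arg_le_pi ζ)
  have hP : ‖(chan g ε a (arg ζ) : ℂ)‖ ≤ 10 := by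
    rw [norm_real, Real.norm_eq_abs, abs_of_nonneg (chan_nonneg _)]
    linarith [chan_le (g := g) (ε := ε) ha (arg ζ)]
  have hB : ‖(β (normSq ζ) : ℂ)‖ ≤ 1 := by
    rw [norm_real, Real.norm_eq_abs, abs_of_nonneg (hβ0 _)]; exact hβ1 _
  have hB' : ‖(β' (normSq ζ) : ℂ)‖ ≤ C := by rw [norm_real]; exact hβC _
  rcases lt_or_ge ‖ζ‖ m with hsm | hbig
  · have hev : ∀ᶠ w in 𝓝 ζ, normSq w ≤ m ^ 2 := by
      filter_upwards [continuous_norm.continuousAt.eventually_lt continuousAt_const hsm] with w hw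
      rw [normSq_eq_norm_sq]; gcongr
    have eS : potS β g ε a =ᶠ[𝓝 ζ] fun _ => 0 := hev.mono fun w hw => by simp [potS, hβl _ hw]
    have eA : potA β β' g ε a =ᶠ[𝓝 ζ] fun _ => 0 := hev.mono fun w hw => by
      simp [potA, hβl _ hw, hβl' _ hw]
    have eD : potD β β' g ε a =ᶠ[𝓝 ζ] fun _ => 0 := hev.mono fun w hw => by
      simp [potD, hβl _ hw, hβl' _ hw]
    have hN0 : 0 ≤ N := by positivity
    refine ⟨?_, continuousAt_const.congr eA.symm, continuousAt_const.congr eD.symm, ?_⟩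
    · rw [eA.eq_of_nhds, eD.eq_of_nhds]
      exact (hasW_const 0 ζ).congr eS
    · rw [eS.eq_of_nhds, eA.eq_of_nhds, eD.eq_of_nhds]
      have h2 : 0 ≤ N * (1 - normSq ζ) := by
        rw [normSq_eq_norm_sq]; apply mul_nonneg hN0; nlinarith [norm_nonneg ζ]
      refine ⟨by simpa, by simpa, by simpa, by simpa using h2, by simp, fun hlt => ?_⟩
      exfalso
      have hmm : ‖moeb (-a) ζ‖ < 1 := norm_moeb_lt hna hζ
      have h3 := norm_sub_le_of_moebius (G := g) (w := a) (z := moeb (-a) ζ)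
        (hg.mono (ball_subset_ball hR.le)) (fun z hz => hg1 z (ball_subset_closedBall hz)) ha hmm
      rw [moeb_moeb_neg ha hζ.le] at h3
      have h4 := norm_sub_norm_le (g a) (g (moeb (-a) ζ))
      rw [norm_sub_rev] at h4
      linarith
  · have h0 : ζ ≠ 0 := norm_pos_iff.1 (hm0.trans_le hbig)
    have hz0 : 0 < ‖ζ‖ := hm0.trans_le hbig
    have hns : 0 ≤ 1 - normSq ζ := by rw [normSq_eq_norm_sq]; nlinarith [norm_nonneg ζ]
    have hl := abs_log_norm_le hm0 hbig hζ
    have hX : ‖(Real.log ‖ζ‖ : ℂ)‖ ≤ 1 / m := by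
      rw [norm_real]; refine hl.trans ?_
      gcongr; linarith [normSq_nonneg ζ]
    have hXY : ‖(Real.log ‖ζ‖ : ℂ) + I * angPot g ε a (arg ζ)‖ ≤ 1 / m + 50 := by
      refine (norm_add_le _ _).trans (add_le_add hX ?_)
      rw [norm_mul, norm_I, one_mul]; exact hY
    have hcont := continuousAt_potA_potD (ε := ε) hgc ha hma hβc hβc' h0
    have hS : ‖potS β g ε a ζ‖ ≤ N := by
      unfold potS
      rw [norm_mul]
      calc _ ≤ 1 * (1 / m + 50) := mul_le_mul hB hXY (norm_nonneg _) zero_le_one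
        _ ≤ N := by
          have : 0 ≤ C * (1 / m + 50) + 15 / m := by positivity
          linarith
    have h15 : ∀ x y : ℂ, ‖x‖ ≤ 12 → ‖y‖ = ‖ζ‖ → ‖x / (2 * y)‖ ≤ 15 / m := by
      intro x y hx hy
      rw [norm_div, norm_mul, hy]
      simp only [Complex.norm_ofNat]
      rw [div_le_div_iff₀ (by positivity) hm0]
      have := norm_nonneg x
      nlinarith
    have hAD : ∀ x y w : ℂ, ‖x‖ ≤ 12 → ‖y‖ = ‖ζ‖ → ‖w‖ = ‖ζ‖ →
        ‖β' (normSq ζ) * w * (Real.log ‖ζ‖ + I * angPot g ε a (arg ζ)) +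
          β (normSq ζ) * (x / (2 * y))‖ ≤ N := by
      intro x y w hx hy hw
      have e1 : ‖β' (normSq ζ) * w * (Real.log ‖ζ‖ + I * angPot g ε a (arg ζ))‖
          ≤ C * 1 * (1 / m + 50) := by
        rw [norm_mul, norm_mul, hw]; gcongr
      have e2 : ‖β (normSq ζ) * (x / (2 * y))‖ ≤ 1 * (15 / m) := by
        rw [norm_mul]; exact mul_le_mul hB (h15 x y hx hy) (norm_nonneg _) zero_le_one
      have e3 : 0 ≤ 1 / m + 50 := by positivity
      refine (norm_add_le _ _).trans ?_
      linarith
    have hA : ‖potA β β' g ε a ζ‖ ≤ N := by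
      refine hAD _ _ _ ?_ rfl (norm_conj ζ)
      refine (norm_sub_le _ _).trans ?_
      rw [Complex.norm_ofNat]; linarith
    have hD : ‖potD β β' g ε a ζ‖ ≤ N := hAD _ _ _ (by linarith) (norm_conj ζ) rfl
    refine ⟨hasW_potS hgc ha hma hβ h0, hcont.1, hcont.2, hS, hA, hD, ?_, ?_, ?_⟩
    · have e : (potS β g ε a ζ).re = β (normSq ζ) * Real.log ‖ζ‖ := by
        simp only [potS, add_re, ofReal_re, mul_re, I_re, I_im, ofReal_im]; ring
      rw [e, abs_mul]
      have hb : |β (normSq ζ)| ≤ 1 := by rw [abs_of_nonneg (hβ0 _)]; exact hβ1 _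
      calc _ ≤ 1 * ((1 - normSq ζ) / m) := mul_le_mul hb hl (abs_nonneg _) zero_le_one
        _ = 1 / m * (1 - normSq ζ) := by ring
        _ ≤ _ := by gcongr
    · intro hne
      by_cases hP0 : chan g ε a (arg ζ) = 0
      · have hb : ‖ζ‖ ≤ 2 * m := by
          by_contra hcon
          apply hne
          have : (2 * m) ^ 2 ≤ normSq ζ := by
            rw [normSq_eq_norm_sq]; exact pow_le_pow_left₀ (by positivity) (not_le.1 hcon).le 2
          simp [potD, hP0, hβr' _ this]
        have h1 := norm_sub_norm_le (1 : ℂ) (-(conj a * ζ))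
        rw [norm_neg, norm_mul, norm_conj, norm_one, sub_neg_eq_add] at h1
        have : ‖a‖ * ‖ζ‖ ≤ 1 * (2 * m) := by gcongr
        linarith
      · have h1 := re_of_chan_ne_zero hP0
        have h2 : (1 + conj a * ζ).re = 1 + ‖ζ‖ * (conj a * cexp (arg ζ * I)).re := by
          conv_lhs => rw [← norm_mul_exp_arg_mul_I ζ]
          rw [← re_ofReal_mul, add_re, one_re]
          congr 2; ring
        refine le_trans ?_ (re_le_norm _)
        rw [h2]; nlinarith
    · intro hlt
      have hmm : ‖moeb (-a) ζ‖ < 1 := norm_moeb_lt hna hζ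
      have h3 := norm_sub_le_of_moebius (G := g) (w := a) (z := moeb (-a) ζ)
        (hg.mono (ball_subset_ball hR.le)) (fun z hz => hg1 z (ball_subset_closedBall hz)) ha hmm
      rw [moeb_moeb_neg ha hζ.le] at h3
      have h4 := norm_sub_norm_le (g a) (g (moeb (-a) ζ))
      rw [norm_sub_rev] at h4
      have h5 : (2 * m) ^ 2 ≤ normSq ζ := by
        rw [normSq_eq_norm_sq]; exact pow_le_pow_left₀ (by positivity) (by linarith) 2
      have h6 : chan g ε a (arg ζ) = 0 := by
        apply chan_eq_zero hε
        have := radMin_le (g := g) (a := a) (t := arg ζ) (r := ‖ζ‖) ⟨norm_nonneg _, hζ.le⟩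
        rw [norm_mul_exp_arg_mul_I] at this
        linarith
      constructor
      · simp [potD, h6, hβr' _ h5]
      · simp only [potA, h6, hβr' _ h5, hβr _ h5]
        push_cast
        field_simp
        ring

theorem exp_mem_sphere (θ : ℝ) : cexp (θ * I) ∈ sphere (0 : ℂ) 1 := by simp

theorem continuousOn_comp_exp {F : ℂ → ℂ} (hF : ContinuousOn F (closedBall 0 1)) :
    Continuous fun θ : ℝ => F (cexp (θ * I)) :=
  hF.comp_continuous (by fun_prop) fun θ => sphere_subset_closedBall (exp_mem_sphere θ)

theorem integral_eq_circleAverage (F : ℂ → ℂ) :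
    Real.circleAverage F 0 1 = (2 * π : ℝ)⁻¹ • ∫ θ in (0 : ℝ)..2 * π, F (cexp (θ * I)) := by
  simp [Real.circleAverage, circleMap]

theorem norm_sub_eq_norm_one_sub {z w : ℂ} (hz : ‖z‖ = 1) : ‖1 - conj w * z‖ = ‖z - w‖ := by
  have h := normSq_moebius w z
  simp only [normSq_eq_norm_sq, hz] at h
  have h2 : ‖1 - conj w * z‖ ^ 2 = ‖z - w‖ ^ 2 := by rw [h]; ring
  exact (pow_left_inj₀ (norm_nonneg _) (norm_nonneg _) two_ne_zero).1 h2

/-- Derivative of `moeb w`. -/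
noncomputable def moeb' (w z : ℂ) : ℂ := (1 - normSq w) / (1 - conj w * z) ^ 2

theorem norm_moeb' {w : ℂ} (hw : ‖w‖ < 1) (z : ℂ) :
    ‖moeb' w z‖ = (1 - ‖w‖ ^ 2) / ‖1 - conj w * z‖ ^ 2 := by
  have : (1 - normSq w : ℂ) = ((1 - ‖w‖ ^ 2 : ℝ) : ℂ) := by rw [normSq_eq_norm_sq]; push_cast; ring
  rw [moeb', norm_div, norm_pow, this, norm_real, Real.norm_eq_abs, abs_of_nonneg]
  nlinarith [norm_nonneg w]

theorem integral_norm_moeb' {w : ℂ} (hw : ‖w‖ < 1) :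
    ∫ θ in (0 : ℝ)..2 * π, ‖moeb' w (cexp (θ * I))‖ = 2 * π := by
  have h := (diffContOnCl_const (c := (1 : ℂ)) (s := ball (0 : ℂ) 1)
    (𝕜 := ℂ)).circleAverage_poissonKernel_smul' (mem_ball_zero_iff.2 hw)
  rw [integral_eq_circleAverage] at h
  have h2 : ∀ θ : ℝ, ((‖cexp (θ * I) - 0‖ ^ 2 - ‖w - 0‖ ^ 2) /
      ‖cexp (θ * I) - 0 - (w - 0)‖ ^ 2) • (1 : ℂ) = (‖moeb' w (cexp (θ * I))‖ : ℂ) := by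
    intro θ
    rw [norm_moeb' hw, norm_sub_eq_norm_one_sub (norm_exp_ofReal_mul_I θ), sub_zero, sub_zero,
      norm_exp_ofReal_mul_I]
    simp
  simp only [h2] at h
  rw [intervalIntegral.integral_ofReal, real_smul, ← ofReal_mul] at h
  have h3 : (2 * π)⁻¹ * ∫ θ in (0 : ℝ)..2 * π, ‖moeb' w (cexp (θ * I))‖ = 1 := by
    exact_mod_cast h
  have := Real.pi_pos
  field_simp at h3
  linarith

theorem continuousOn_moeb {w : ℂ} (hw : ‖w‖ < 1) : ContinuousOn (moeb w) (closedBall 0 1) :=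
  fun _ hz => (hasDerivAt_moeb (one_sub_conj_mul_ne_zero hw
    (mem_closedBall_zero_iff.1 hz))).continuousAt.continuousWithinAt

theorem hasDerivAt_moeb' {w z : ℂ} (hz : 1 - conj w * z ≠ 0) :
    HasDerivAt (moeb' w) (2 * conj w * (1 - normSq w) / (1 - conj w * z) ^ 3) z := by
  have h1 : HasDerivAt (fun z => 1 - conj w * z) (-conj w) z := by
    simpa using ((hasDerivAt_id z).const_mul (conj w)).const_sub 1
  have h2 := ((hasDerivAt_const z (1 - normSq w : ℂ)).div (h1.pow 2) (pow_ne_zero 2 hz))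
  refine HasDerivAt.congr_deriv h2 ?_
  simp only [Pi.pow_apply]
  field_simp
  ring

theorem continuousOn_moeb' {w : ℂ} (hw : ‖w‖ < 1) : ContinuousOn (moeb' w) (closedBall 0 1) :=
  fun _ hz => (hasDerivAt_moeb' (one_sub_conj_mul_ne_zero hw
    (mem_closedBall_zero_iff.1 hz))).continuousAt.continuousWithinAt

/-- Area of the disk, computed through a Möbius change of variables. -/
theorem integral_norm_moeb'_sq_le {w : ℂ} (hw : ‖w‖ < 1) :
    ∫ z in ball (0 : ℂ) 1, ‖moeb' w z‖ ^ 2 ≤ π := by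
  have hc := continuous_conj
  have hb := continuousOn_moeb hw
  have hb' := continuousOn_moeb' hw
  have hne : ∀ z ∈ closedBall (0 : ℂ) 1, 1 - conj w * z ≠ 0 := fun z hz =>
    one_sub_conj_mul_ne_zero hw (mem_closedBall_zero_iff.1 hz)
  have h := stokes (F := fun z => conj (moeb w z) * moeb' w z) (b := fun z => (‖moeb' w z‖ ^ 2 : ℝ))
    (a := fun z => _) ((hc.comp_continuousOn hb).mul hb')
    (fun z hz => ((hasW_of_hasDerivAt (hasDerivAt_moeb (hne z (ball_subset_closedBall hz)))).conj.mul
      (hasW_of_hasDerivAt (hasDerivAt_moeb' (hne z (ball_subset_closedBall hz))))).congr_coeff rfl (by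
        rw [mul_zero, add_zero, ← moeb', ← normSq_eq_norm_sq, normSq_eq_conj_mul_self]))
    (by fun_prop)
  rw [integral_complex_ofReal] at h
  have h1 : ‖∫ θ in (0 : ℝ)..2 * π, cexp (θ * I) * (conj (moeb w (cexp (θ * I))) *
      moeb' w (cexp (θ * I)))‖ ≤ ∫ θ in (0 : ℝ)..2 * π, ‖moeb' w (cexp (θ * I))‖ := by
    apply intervalIntegral.norm_integral_le_of_norm_le Real.two_pi_pos.le
    · refine Eventually.of_forall fun θ _ => ?_
      rw [norm_mul, norm_mul, norm_conj, norm_exp_ofReal_mul_I, one_mul]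
      exact mul_le_of_le_one_left (norm_nonneg _) (norm_moeb_le hw (by simp))
    · exact (continuousOn_comp_exp hb').norm.intervalIntegrable _ _
  rw [integral_norm_moeb' hw, h, norm_mul, norm_real, Complex.norm_ofNat] at h1
  have := le_abs_self (∫ z in ball (0 : ℂ) 1, ‖moeb' w z‖ ^ 2)
  rw [← Real.norm_eq_abs] at this
  linarith

section
variable {u κ : ℂ → ℝ} {p e : ℂ → ℂ} {B : ℝ}

theorem integral_weight_le (hu : ∀ z ∈ closedBall (0 : ℂ) 1, HasW (fun w => (u w : ℂ)) (p z) (conj (p z)) z)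
    (hp : ∀ z ∈ closedBall (0 : ℂ) 1, HasW p (e z) (κ z) z) (hκ : ContinuousOn κ (closedBall 0 1))
    (hB : ∀ z ∈ closedBall (0 : ℂ) 1, |u z| ≤ B) {w : ℂ} (hw : ‖w‖ < 1) :
    ∫ z in ball (0 : ℂ) 1, κ z * (1 - normSq (moeb w z)) ≤ 2 * π * B := by
  have hc := continuous_conj
  have hb := continuousOn_moeb hw
  have hb' := continuousOn_moeb' hw
  have huc : ContinuousOn (fun z => (u z : ℂ)) (closedBall 0 1) := fun z hz =>
    (hu z hz).continuousAt.continuousWithinAt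
  have hpc : ContinuousOn p (closedBall 0 1) := fun z hz => (hp z hz).continuousAt.continuousWithinAt
  have hB0 : 0 ≤ B := (abs_nonneg _).trans (hB 0 (by simp))
  have hd : ∀ z ∈ closedBall (0 : ℂ) 1, HasDerivAt (moeb w) (moeb' w z) z := fun z hz =>
    hasDerivAt_moeb (one_sub_conj_mul_ne_zero hw (mem_closedBall_zero_iff.1 hz))
  have hd' : ∀ z ∈ closedBall (0 : ℂ) 1, HasDerivAt (moeb' w) _ z := fun z hz =>
    hasDerivAt_moeb' (one_sub_conj_mul_ne_zero hw (mem_closedBall_zero_iff.1 hz))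
  set d : ℂ → ℂ := fun z => -(conj (moeb w z) * moeb' w z) with hd_def
  have hdc : ContinuousOn d (closedBall 0 1) := ((hc.comp_continuousOn hb).mul hb').neg
  have hWW : ∀ z ∈ closedBall (0 : ℂ) 1, HasW (fun z => ((1 - normSq (moeb w z) : ℝ) : ℂ)) (d z)
      (-(moeb w z * conj (moeb' w z))) z := fun z hz => by
    have h1 : HasDerivAt (fun s : ℝ => 1 - s) (-1) (normSq (moeb w z)) := by
      simpa using (hasDerivAt_id (normSq (moeb w z))).const_sub 1
    refine (hasW_normSq h1 (hd z hz)).congr_coeff ?_ ?_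
    · simp only [hd_def]; push_cast; ring
    · push_cast; ring
  have hWd : ∀ z ∈ closedBall (0 : ℂ) 1, HasW d _ (-((‖moeb' w z‖ ^ 2 : ℝ) : ℂ)) z := fun z hz =>
    (((hasW_of_hasDerivAt (hd z hz)).conj.mul (hasW_of_hasDerivAt (hd' z hz))).neg).congr_coeff rfl (by
        rw [mul_zero, add_zero, ← normSq_eq_norm_sq, normSq_eq_conj_mul_self])
  have hWc : ContinuousOn (fun z => ((1 - normSq (moeb w z) : ℝ) : ℂ)) (closedBall 0 1) := fun z hz =>
    (hWW z hz).continuousAt.continuousWithinAt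
  have hκc : ContinuousOn (fun z => (κ z : ℂ)) (closedBall 0 1) := continuous_ofReal.comp_continuousOn hκ
  have hpcc : ContinuousOn (fun z => conj (p z)) (closedBall 0 1) := hc.comp_continuousOn hpc
  have hnc : ContinuousOn (fun z => ((‖moeb' w z‖ ^ 2 : ℝ) : ℂ)) (closedBall 0 1) :=
    continuous_ofReal.comp_continuousOn (hb'.norm.pow 2)
  have i1 := integrableOn_ball_of_continuousOn (hdc.mul hpcc)
  have i2 := integrableOn_ball_of_continuousOn (hWc.mul hκc)
  have i3 := integrableOn_ball_of_continuousOn (huc.mul hnc)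
  have e1 := integral_del_eq_zero (F := fun z => ((1 - normSq (moeb w z) : ℝ) : ℂ) * conj (p z))
    (a := fun z => d z * conj (p z) + ((1 - normSq (moeb w z) : ℝ) : ℂ) * κ z) (b := fun z => _)
    (hWc.mul hpcc)
    (fun z hz => ((hWW z (ball_subset_closedBall hz)).mul
      (hp z (ball_subset_closedBall hz)).conj).congr_coeff (by rw [conj_ofReal]) rfl)
    ((hdc.mul hpcc).add (hWc.mul hκc)) (fun z hz => by
      have h1 := one_sub_normSq_moeb hw (mem_sphere_zero_iff_norm.1 hz).le
      rw [h1, normSq_eq_norm_sq z, mem_sphere_zero_iff_norm.1 hz]; simp)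
  rw [integral_add (f := fun z => d z * conj (p z))
    (g := fun z => ((1 - normSq (moeb w z) : ℝ) : ℂ) * κ z) i1 i2] at e1
  have e2 := stokes (F := fun z => u z * d z) (a := fun z => _)
    (b := fun z => d z * conj (p z) - u z * ((‖moeb' w z‖ ^ 2 : ℝ) : ℂ)) (huc.mul hdc)
    (fun z hz => ((hu z (ball_subset_closedBall hz)).mul
      (hWd z (ball_subset_closedBall hz))).congr_coeff rfl (by ring))
    ((hdc.mul hpcc).sub (huc.mul hnc))
  rw [integral_sub (f := fun z => d z * conj (p z))
    (g := fun z => u z * ((‖moeb' w z‖ ^ 2 : ℝ) : ℂ)) i1 i3] at e2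
  have b1 : ‖∫ z in ball (0 : ℂ) 1, u z * ((‖moeb' w z‖ ^ 2 : ℝ) : ℂ)‖ ≤ B * π := by
    have i4 : IntegrableOn (fun z => ‖moeb' w z‖ ^ 2) (ball 0 1) :=
      (hb'.norm.pow 2).integrableOn_compact (isCompact_closedBall _ _) |>.mono_set ball_subset_closedBall
    calc _ ≤ ∫ z in ball (0 : ℂ) 1, B * ‖moeb' w z‖ ^ 2 := by
          apply norm_integral_le_of_norm_le (i4.const_mul B)
          refine (ae_restrict_iff' measurableSet_ball).2 (Eventually.of_forall fun z hz => ?_)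
          rw [norm_mul, norm_real, norm_real, Real.norm_eq_abs, Real.norm_eq_abs,
            abs_of_nonneg (sq_nonneg ‖moeb' w z‖)]
          exact mul_le_mul_of_nonneg_right (hB z (ball_subset_closedBall hz)) (sq_nonneg _)
      _ ≤ B * π := by
          rw [integral_const_mul]
          exact mul_le_mul_of_nonneg_left (integral_norm_moeb'_sq_le hw) hB0
  have b2 : ‖∫ θ in (0 : ℝ)..2 * π, cexp (θ * I) * (u (cexp (θ * I)) * d (cexp (θ * I)))‖ ≤
      B * (2 * π) := by
    have h0 := congrArg (fun x => B * x) (integral_norm_moeb' hw)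
    simp only [← intervalIntegral.integral_const_mul] at h0
    rw [← h0]
    apply intervalIntegral.norm_integral_le_of_norm_le Real.two_pi_pos.le
    · refine Eventually.of_forall fun θ _ => ?_
      rw [norm_mul, norm_mul, norm_exp_ofReal_mul_I, one_mul, norm_real, norm_neg, norm_mul, norm_conj]
      refine mul_le_mul (hB _ (by simp)) ?_ (by positivity) hB0
      exact mul_le_of_le_one_left (norm_nonneg _) (norm_moeb_le hw (by simp))
    · exact ((continuousOn_comp_exp hb').norm.const_mul B).intervalIntegrable _ _
  have e3 : ((∫ z in ball (0 : ℂ) 1, κ z * (1 - normSq (moeb w z)) : ℝ) : ℂ) =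
      -((∫ θ in (0 : ℝ)..2 * π, cexp (θ * I) * (u (cexp (θ * I)) * d (cexp (θ * I)))) / 2) -
      ∫ z in ball (0 : ℂ) 1, u z * ((‖moeb' w z‖ ^ 2 : ℝ) : ℂ) := by
    rw [← integral_complex_ofReal, e2]
    have : ∫ z in ball (0 : ℂ) 1, ((κ z * (1 - normSq (moeb w z)) : ℝ) : ℂ) =
        ∫ z in ball (0 : ℂ) 1, ((1 - normSq (moeb w z) : ℝ) : ℂ) * κ z := by
      congr 1; ext z; push_cast; ring
    rw [this]
    linear_combination e1
  have e4 := congrArg norm e3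
  have e5 : ‖((∫ z in ball (0 : ℂ) 1, κ z * (1 - normSq (moeb w z)) : ℝ) : ℂ)‖ ≤ 2 * π * B := by
    rw [e4]
    refine (norm_sub_le _ _).trans ?_
    rw [norm_neg, norm_div, Complex.norm_ofNat]
    linarith
  rw [norm_real] at e5
  exact (le_abs_self _).trans e5

end

theorem integral_exp_div_sub {w : ℂ} (hw : w ∈ ball (0 : ℂ) 1) :
    ∫ θ in (0 : ℝ)..2 * π, cexp (θ * I) / (cexp (θ * I) - w) = 2 * π := by
  have h := (diffContOnCl_const (c := (1 : ℂ)) (s := ball (0 : ℂ) |1|)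
    (𝕜 := ℂ)).circleAverage_smul_div (w := w) (by simpa using hw)
  rw [integral_eq_circleAverage, real_smul] at h
  simp only [sub_zero, smul_eq_mul, mul_one] at h
  have hπ : (π : ℂ) ≠ 0 := by exact_mod_cast Real.pi_pos.ne'
  push_cast at h
  field_simp at h
  linear_combination h

/-- A Cauchy–Pompeiu formula at a point near which the function is holomorphic. -/
theorem cauchy_pompeiu {F e κ : ℂ → ℂ} (hF : ∀ z ∈ closedBall (0 : ℂ) 1, HasW F (e z) (κ z) z)
    (hκ : ContinuousOn κ (closedBall 0 1)) {w : ℂ} (hw : w ∈ ball (0 : ℂ) 1)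
    (hz : ∀ᶠ z in 𝓝 w, κ z = 0) :
    ∫ θ in (0 : ℝ)..2 * π, cexp (θ * I) * F (cexp (θ * I)) / (cexp (θ * I) - w) =
      2 * π * F w + 2 * ∫ z in ball (0 : ℂ) 1, κ z / (z - w) := by
  have hFc : ContinuousOn F (closedBall 0 1) := fun z hz => (hF z hz).continuousAt.continuousWithinAt
  have hne : ∀ θ : ℝ, cexp (θ * I) - w ≠ 0 := fun θ h => by
    have := mem_ball_zero_iff.1 hw
    rw [← sub_eq_zero.1 h, norm_exp_ofReal_mul_I] at this
    exact lt_irrefl _ this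
  have hev : ∀ᶠ z in 𝓝 w, κ z = 0 ∧ z ∈ ball (0 : ℂ) 1 := hz.and (isOpen_ball.mem_nhds hw)
  obtain ⟨s, hs, hso, hws⟩ := _root_.eventually_nhds_iff.1 hev
  have hds : DifferentiableOn ℂ (dslope F w) s := by
    rw [differentiableOn_dslope (hso.mem_nhds hws)]
    intro z hz
    have := hF z (ball_subset_closedBall (hs z hz).2)
    rw [(hs z hz).1] at this
    exact this.hasDerivAt.differentiableAt.differentiableWithinAt
  have hW : ∀ z ∈ closedBall (0 : ℂ) 1, ∃ a, HasW (dslope F w) a (κ z / (z - w)) z := by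
    intro z hz
    rcases eq_or_ne z w with rfl | hzw
    · refine ⟨_, (hasW_of_hasDerivAt (hds.differentiableAt (hso.mem_nhds hws)).hasDerivAt).congr_coeff
        rfl ?_⟩
      simp
    · have h0 : z - w ≠ 0 := sub_ne_zero.2 hzw
      refine ⟨_, ((((hF z hz).sub (hasW_const (F w) z)).div ((hasW_id z).sub (hasW_const w z))
        h0).congr ?_).congr_coeff rfl ?_⟩
      · filter_upwards [isOpen_ne.mem_nhds hzw] with y hy
        rw [dslope_of_ne _ hy, slope_def_field]
      · field_simp; ring
  choose! a ha using hW
  have hbc : ContinuousOn (fun z => κ z / (z - w)) (closedBall 0 1) := by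
    intro z hz'
    rcases eq_or_ne z w with rfl | hzw
    · have : (fun y => κ y / (y - z)) =ᶠ[𝓝 z] fun _ => 0 := hz.mono fun y hy => by simp [hy]
      exact (continuousAt_const.congr this.symm).continuousWithinAt
    · exact (hκ z hz').div (by fun_prop) (sub_ne_zero.2 hzw)
  have h1 := stokes (F := dslope F w) (fun z hz => (ha z hz).continuousAt.continuousWithinAt)
    (fun z hz => ha z (ball_subset_closedBall hz)) hbc
  have h2 : ∀ θ : ℝ, cexp (θ * I) * dslope F w (cexp (θ * I)) =
      cexp (θ * I) * F (cexp (θ * I)) / (cexp (θ * I) - w) -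
        cexp (θ * I) / (cexp (θ * I) - w) * F w := by
    intro θ
    rw [dslope_of_ne _ (sub_ne_zero.1 (hne θ)), slope_def_field]
    ring
  simp only [h2] at h1
  have hc1 : Continuous fun θ : ℝ => cexp (θ * I) / (cexp (θ * I) - w) :=
    Continuous.div (by fun_prop) (by fun_prop) hne
  have hc2 : Continuous fun θ : ℝ => cexp (θ * I) * F (cexp (θ * I)) / (cexp (θ * I) - w) :=
    Continuous.div (Continuous.mul (by fun_prop) (continuousOn_comp_exp hFc)) (by fun_prop) hne
  have hc3 : Continuous fun θ : ℝ => cexp (θ * I) / (cexp (θ * I) - w) * F w := hc1.mul continuous_const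
  rw [intervalIntegral.integral_sub (hc2.intervalIntegrable _ _) (hc3.intervalIntegrable _ _),
    intervalIntegral.integral_mul_const,
    integral_exp_div_sub hw] at h1
  linear_combination h1

section
variable {u κ : ℂ → ℝ} {p e : ℂ → ℂ} {B : ℝ}

theorem integral_conj_kernel (hp : ∀ z ∈ closedBall (0 : ℂ) 1, HasW p (e z) (κ z) z)
    (hκ : ContinuousOn κ (closedBall 0 1)) {w : ℂ} (hw : w ∈ ball (0 : ℂ) 1) :
    ∫ θ in (0 : ℝ)..2 * π, conj (cexp (θ * I) * p (cexp (θ * I))) / (cexp (θ * I) - w) =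
      2 * ∫ z in ball (0 : ℂ) 1, κ z * (conj z / (1 - conj z * w)) := by
  have hw1 : ‖w‖ < 1 := mem_ball_zero_iff.1 hw
  have hpc : ContinuousOn p (closedBall 0 1) := fun z hz => (hp z hz).continuousAt.continuousWithinAt
  have hne : ∀ z ∈ closedBall (0 : ℂ) 1, 1 - z * conj w ≠ 0 := fun z hz => by
    rw [mul_comm]; exact one_sub_conj_mul_ne_zero hw1 (mem_closedBall_zero_iff.1 hz)
  have hk : ∀ z ∈ closedBall (0 : ℂ) 1, HasDerivAt (fun z => z / (1 - z * conj w)) _ z := fun z hz =>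
    (hasDerivAt_id z).div (((hasDerivAt_id z).mul_const (conj w)).const_sub 1) (hne z hz)
  have hkc : ContinuousOn (fun z => z / (1 - z * conj w)) (closedBall 0 1) := fun z hz =>
    (hk z hz).continuousAt.continuousWithinAt
  have h1 := stokes (F := fun z => p z * (z / (1 - z * conj w))) (a := fun z => _)
    (b := fun z => κ z * (z / (1 - z * conj w))) (hpc.mul hkc)
    (fun z hz => ((hp z (ball_subset_closedBall hz)).mul
      (hasW_of_hasDerivAt (hk z (ball_subset_closedBall hz)))).congr_coeff rfl (by simp))
    ((continuous_ofReal.comp_continuousOn hκ).mul hkc)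
  have h2 := congrArg conj h1
  rw [intervalIntegral.integral_of_le Real.two_pi_pos.le, ← integral_conj, map_mul, ← integral_conj,
    ← intervalIntegral.integral_of_le Real.two_pi_pos.le] at h2
  simp only [map_mul, conj_ofReal, map_div₀, map_sub, map_one, conj_conj, map_ofNat] at h2
  rw [← h2]
  refine intervalIntegral.integral_congr fun θ _ => ?_
  have h0 : cexp (θ * I) ≠ 0 := Complex.exp_ne_zero _
  have h3 : conj (cexp (θ * I)) = (cexp (θ * I))⁻¹ := by
    rw [inv_def, normSq_eq_norm_sq, norm_exp_ofReal_mul_I]; simp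
  have h4 : cexp (θ * I) - w ≠ 0 := fun h => by
    rw [← sub_eq_zero.1 h, norm_exp_ofReal_mul_I] at hw1
    exact lt_irrefl _ hw1
  simp only [map_mul, h3]
  have h5 : 1 - (cexp (θ * I))⁻¹ * w = (cexp (θ * I) - w) / cexp (θ * I) := by field_simp
  rw [h5]
  field_simp

theorem integral_herglotz (hu : ∀ z ∈ closedBall (0 : ℂ) 1, HasW (fun w => (u w : ℂ)) (p z) (conj (p z)) z)
    (hp : ∀ z ∈ closedBall (0 : ℂ) 1, HasW p (e z) (κ z) z) (hκ : ContinuousOn κ (closedBall 0 1))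
    {w : ℂ} (hw : w ∈ ball (0 : ℂ) 1) (hz : ∀ᶠ z in 𝓝 w, κ z = 0) :
    ∫ θ in (0 : ℝ)..2 * π, 2 * cexp (θ * I) / (cexp (θ * I) - w) ^ 2 * u (cexp (θ * I)) =
      4 * π * p w - 4 * ∫ z in ball (0 : ℂ) 1, κ z * (1 / (w - z) + conj z / (1 - conj z * w)) := by
  have hw1 : ‖w‖ < 1 := mem_ball_zero_iff.1 hw
  have hcc := continuous_conj
  have hκc : ContinuousOn (fun z => (κ z : ℂ)) (closedBall 0 1) := continuous_ofReal.comp_continuousOn hκ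
  have hpc : ContinuousOn p (closedBall 0 1) := fun z hz => (hp z hz).continuousAt.continuousWithinAt
  have huc : ContinuousOn (fun z => (u z : ℂ)) (closedBall 0 1) := fun z hz =>
    (hu z hz).continuousAt.continuousWithinAt
  have hne : ∀ θ : ℝ, cexp (θ * I) - w ≠ 0 := fun θ h => by
    rw [← sub_eq_zero.1 h, norm_exp_ofReal_mul_I] at hw1
    exact lt_irrefl _ hw1
  have e1 := cauchy_pompeiu (κ := fun z => (κ z : ℂ)) hp hκc hw (hz.mono fun z hz => by simp [hz])
  have e2 := integral_conj_kernel hp hκ hw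
  have hd : ∀ θ : ℝ, HasDerivAt (fun θ : ℝ => (u (cexp (θ * I)) : ℂ) / (cexp (θ * I) - w))
      (I * (cexp (θ * I) * p (cexp (θ * I)) / (cexp (θ * I) - w)) -
        I * (conj (cexp (θ * I) * p (cexp (θ * I))) / (cexp (θ * I) - w)) -
        I / 2 * (2 * cexp (θ * I) / (cexp (θ * I) - w) ^ 2 * u (cexp (θ * I)))) θ := by
    intro θ
    have h1 : HasDerivAt (fun θ : ℝ => cexp (θ * I)) (cexp (θ * I) * I) θ := by
      have := ((hasDerivAt_id (θ : ℂ)).mul_const I).cexp.comp_ofReal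
      simpa using this
    have h2 : HasDerivAt (fun θ : ℝ => (u (cexp (θ * I)) : ℂ)) _ θ :=
      HasFDerivAt.comp_hasDerivAt (f := fun θ : ℝ => cexp (θ * I)) θ
        (show HasFDerivAt (fun w => (u w : ℂ)) (wirt _ _) (cexp (θ * I)) from
          hu (cexp (θ * I)) (by simp)) h1
    have h3 := h2.div (h1.sub_const w) (hne θ)
    refine h3.congr_deriv ?_
    rw [wirt_apply]
    simp only [map_mul, conj_I]
    have := hne θ
    field_simp
    ring
  have hc2 : Continuous fun θ : ℝ => cexp (θ * I) * p (cexp (θ * I)) / (cexp (θ * I) - w) :=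
    Continuous.div (Continuous.mul (by fun_prop) (continuousOn_comp_exp hpc)) (by fun_prop) hne
  have hc3 : Continuous fun θ : ℝ => conj (cexp (θ * I) * p (cexp (θ * I))) / (cexp (θ * I) - w) :=
    Continuous.div (hcc.comp (Continuous.mul (by fun_prop) (continuousOn_comp_exp hpc))) (by fun_prop) hne
  have hc4 : Continuous fun θ : ℝ =>
      2 * cexp (θ * I) / (cexp (θ * I) - w) ^ 2 * u (cexp (θ * I)) :=
    Continuous.mul (Continuous.div (by fun_prop) (by fun_prop) fun θ => pow_ne_zero 2 (hne θ))
      (continuousOn_comp_exp huc)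
  have hc5 : Continuous fun θ : ℝ => I * (cexp (θ * I) * p (cexp (θ * I)) / (cexp (θ * I) - w)) :=
    continuous_const.mul hc2
  have hc6 : Continuous fun θ : ℝ =>
      I * (conj (cexp (θ * I) * p (cexp (θ * I))) / (cexp (θ * I) - w)) := continuous_const.mul hc3
  have hc7 : Continuous fun θ : ℝ =>
      I / 2 * (2 * cexp (θ * I) / (cexp (θ * I) - w) ^ 2 * u (cexp (θ * I))) := continuous_const.mul hc4
  have e3 := intervalIntegral.integral_eq_sub_of_hasDerivAt (a := 0) (b := 2 * π) (fun θ _ => hd θ)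
    (((hc5.sub hc6).sub hc7).intervalIntegrable _ _)
  have e4 : cexp ((2 * π : ℝ) * I) = 1 := by push_cast; exact Complex.exp_two_pi_mul_I
  rw [e4, ofReal_zero, zero_mul, Complex.exp_zero, sub_self,
    intervalIntegral.integral_sub ((hc5.fun_sub hc6).intervalIntegrable _ _) (hc7.intervalIntegrable _ _),
    intervalIntegral.integral_sub (hc5.intervalIntegrable _ _) (hc6.intervalIntegrable _ _),
    intervalIntegral.integral_const_mul, intervalIntegral.integral_const_mul,
    intervalIntegral.integral_const_mul, e1, e2] at e3
  have i1 : IntegrableOn (fun z => (κ z : ℂ) / (z - w)) (ball 0 1) := by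
    apply integrableOn_ball_of_continuousOn
    intro z hz'
    rcases eq_or_ne z w with rfl | hzw
    · have : (fun y => (κ y : ℂ) / (y - z)) =ᶠ[𝓝 z] fun _ => 0 := hz.mono fun y hy => by simp [hy]
      exact (continuousAt_const.congr this.symm).continuousWithinAt
    · exact (hκc z hz').div (by fun_prop) (sub_ne_zero.2 hzw)
  have i2 : IntegrableOn (fun z => (κ z : ℂ) * (conj z / (1 - conj z * w))) (ball 0 1) := by
    apply integrableOn_ball_of_continuousOn
    refine hκc.mul (ContinuousOn.div (by fun_prop) (by fun_prop) fun z hz => ?_)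
    have := one_sub_conj_mul_ne_zero hw1 (mem_closedBall_zero_iff.1 hz)
    intro h
    apply this
    have := congrArg conj h
    simp only [map_sub, map_one, map_mul, conj_conj, map_zero] at this
    rw [mul_comm]; exact this
  have e5 : ∫ z in ball (0 : ℂ) 1, κ z * (1 / (w - z) + conj z / (1 - conj z * w)) =
      -(∫ z in ball (0 : ℂ) 1, (κ z : ℂ) / (z - w)) +
        ∫ z in ball (0 : ℂ) 1, κ z * (conj z / (1 - conj z * w)) := by
    rw [← integral_neg, ← integral_add i1.fun_neg i2]
    congr 1; ext z
    rw [← neg_sub z w, one_div, inv_neg]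
    ring
  rw [e5]
  linear_combination (2 * I) * e3 - (4 * π * p w + 4 * (∫ z in ball (0 : ℂ) 1, (κ z : ℂ) / (z - w)) -
    4 * (∫ z in ball (0 : ℂ) 1, κ z * (conj z / (1 - conj z * w))) -
    ∫ θ in (0 : ℝ)..2 * π, 2 * cexp (θ * I) / (cexp (θ * I) - w) ^ 2 * u (cexp (θ * I))) * I_sq

end

theorem hasDerivAt_glue {F G F' G' : ℝ → ℝ} {t : ℝ} (hF : ∀ s ≤ t, HasDerivAt F (F' s) s)
    (hG : ∀ s, t ≤ s → HasDerivAt G (G' s) s) (h0 : F t = G t) (h1 : F' t = G' t) (s : ℝ) :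
    HasDerivAt (fun s => if s ≤ t then F s else G s) (if s ≤ t then F' s else G' s) s := by
  rcases lt_trichotomy s t with h | rfl | h
  · rw [if_pos h.le]
    refine (hF s h.le).congr_of_eventuallyEq ?_
    filter_upwards [Iio_mem_nhds h] with y hy
    rw [if_pos (le_of_lt hy)]
  · rw [if_pos le_rfl, ← hasDerivWithinAt_univ, ← Iic_union_Ici (a := s)]
    refine HasDerivWithinAt.union ?_ ?_
    · exact (hF s le_rfl).hasDerivWithinAt.congr (fun y hy => if_pos hy) (if_pos le_rfl)
    · rw [h1]
      refine (hG s le_rfl).hasDerivWithinAt.congr (fun y hy => ?_) (by rw [if_pos le_rfl, h0])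
      rcases eq_or_lt_of_le (mem_Ici.1 hy) with rfl | h
      · rw [if_pos le_rfl, h0]
      · rw [if_neg h.not_ge]
  · rw [if_neg h.not_ge]
    refine (hG s h.le).congr_of_eventuallyEq ?_
    filter_upwards [Ioi_mem_nhds h] with y hy
    rw [if_neg (not_le.2 hy)]

/-- A regularization of `log √s`. -/
noncomputable def regLog (t s : ℝ) : ℝ :=
  if s ≤ t then s / t - s ^ 2 / (4 * t ^ 2) + Real.log t / 2 - 3 / 4 else Real.log s / 2

noncomputable def regLog' (t s : ℝ) : ℝ := if s ≤ t then 1 / t - s / (2 * t ^ 2) else 1 / (2 * s)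

noncomputable def regLog'' (t s : ℝ) : ℝ := if s ≤ t then -1 / (2 * t ^ 2) else -1 / (2 * s ^ 2)

theorem hasDerivAt_regLog {t : ℝ} (ht : 0 < t) (s : ℝ) :
    HasDerivAt (regLog t) (regLog' t s) s := by
  refine hasDerivAt_glue (F' := fun s => 1 / t - s / (2 * t ^ 2)) (G' := fun s => 1 / (2 * s))
    (fun s _ => ?_) (fun s hs => ?_) ?_ ?_ s
  · have := ((((hasDerivAt_id s).div_const t).sub (((hasDerivAt_id s).pow 2).div_const
      (4 * t ^ 2))).add_const (Real.log t / 2)).sub_const (3 / 4)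
    refine this.congr_deriv ?_
    simp; field_simp; ring
  · refine ((Real.hasDerivAt_log (ht.trans_le hs).ne').div_const 2).congr_deriv ?_
    have := (ht.trans_le hs).ne'
    field_simp
  · field_simp; ring
  · field_simp; ring

theorem hasDerivAt_regLog' {t : ℝ} (ht : 0 < t) (s : ℝ) :
    HasDerivAt (regLog' t) (regLog'' t s) s := by
  refine hasDerivAt_glue (F' := fun s => -1 / (2 * t ^ 2)) (G' := fun s => -1 / (2 * s ^ 2))
    (fun s _ => ?_) (fun s hs => ?_) ?_ ?_ s
  · refine (((hasDerivAt_id s).div_const (2 * t ^ 2)).const_sub (1 / t)).congr_deriv ?_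
    ring
  · have := (ht.trans_le hs).ne'
    refine ((hasDerivAt_const s (1 : ℝ)).div ((hasDerivAt_id s).const_mul 2) (by simpa)).congr_deriv ?_
    simp; field_simp
  · field_simp; ring
  · rfl

theorem mul_regLog''_add {t : ℝ} (ht : 0 < t) (s : ℝ) :
    s * regLog'' t s + regLog' t s = max (t - s) 0 / t ^ 2 := by
  unfold regLog'' regLog'
  split_ifs with h
  · rw [max_eq_left (by linarith)]; field_simp; ring
  · have : s ≠ 0 := by linarith
    rw [max_eq_right (by linarith)]; field_simp; ring

theorem abs_regLog_le {t s : ℝ} (ht : 0 < t) (hs : 0 ≤ s) (hs1 : s ≤ 1) :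
    |regLog t s| ≤ 2 + |Real.log t| := by
  unfold regLog
  split_ifs with h
  · have h1 : s / t ≤ 1 := (div_le_one ht).2 h
    have h2 : 0 ≤ s / t := by positivity
    have h3 : s ^ 2 / (4 * t ^ 2) = (s / t) ^ 2 / 4 := by field_simp
    have h4 := abs_le.1 (le_refl |Real.log t|)
    rw [h3, abs_le]
    constructor <;> nlinarith [h4.1, h4.2, abs_nonneg (Real.log t)]
  · have h1 : Real.log s ≤ 0 := Real.log_nonpos hs hs1
    have h2 : Real.log t ≤ Real.log s := Real.log_le_log ht (not_le.1 h).le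
    rw [abs_of_nonpos (by linarith), abs_of_nonpos (by linarith)]
    linarith

theorem abs_re_herglotz_le {u : ℂ → ℝ} {B : ℝ} (hu : ContinuousOn u (closedBall 0 1))
    (hB : ∀ z ∈ closedBall (0 : ℂ) 1, |u z| ≤ B) {w : ℂ} (hw : w ∈ ball (0 : ℂ) 1) :
    |(Real.circleAverage (fun ζ => herglotzRieszKernel 0 w ζ • (u ζ : ℂ)) 0 1).re| ≤ B := by
  have hus : ContinuousOn u (sphere 0 1) := hu.mono sphere_subset_closedBall
  have hui : CircleIntegrable u 0 1 := hus.circleIntegrable zero_le_one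
  have hPc : ContinuousOn (poissonKernel 0 w) (sphere 0 1) := by
    rw [poissonKernel_eq_re_herglotzRieszKernel]
    exact continuous_re.comp_continuousOn
      (by simpa using continuousOn_herglotzRieszKernel_sphere (R := 1) hw)
  have hPi : CircleIntegrable (poissonKernel 0 w) 0 1 := hPc.circleIntegrable zero_le_one
  have hPn : ∀ z ∈ sphere (0 : ℂ) |1|, 0 ≤ poissonKernel 0 w z := by
    intro z hz
    have h1 : ‖z‖ = 1 := by simpa using hz
    have h2 := mem_ball_zero_iff.1 hw
    rw [poissonKernel_def, sub_zero, sub_zero, h1]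
    exact div_nonneg (by nlinarith [norm_nonneg w]) (sq_nonneg _)
  have hP1 : Real.circleAverage (poissonKernel 0 w) 0 1 = 1 := by
    have h1 := (diffContOnCl_const (c := (1 : ℂ)) (s := ball (0 : ℂ) 1)
      (𝕜 := ℂ)).circleAverage_poissonKernel_smul hw
    have h2 : (poissonKernel 0 w • fun _ : ℂ => (1 : ℂ)) = ofRealCLM ∘ poissonKernel 0 w := by
      ext z; simp
    rw [h2, ofRealCLM.circleAverage_comp_comm hPi] at h1
    exact ofReal_eq_one.1 h1
  rw [re_circleAverage_herglotzRieszKernel_smul hui hw, ← poissonKernel_eq_re_herglotzRieszKernel]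
  calc _ ≤ _ := Real.abs_circleAverage_le_circleAverage_abs
    _ ≤ Real.circleAverage (fun z => B • poissonKernel 0 w z) 0 1 := by
        refine Real.circleAverage_mono ?_ ?_ fun z hz => ?_
        · exact ContinuousOn.circleIntegrable zero_le_one (hPc.smul hus).abs
        · exact ContinuousOn.circleIntegrable zero_le_one (hPc.const_smul B)
        · have h1 := hB z (sphere_subset_closedBall (by simpa using hz))
          simp only [Pi.abs_apply, smul_eq_mul, Pi.mul_apply, abs_mul, abs_of_nonneg (hPn z hz)]
          rw [mul_comm B]
          exact mul_le_mul_of_nonneg_left h1 (hPn z hz)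
    _ = B := by rw [Real.circleAverage_fun_smul, hP1]; simp

theorem exists_charge {δ : ℝ} (hδ : 0 < δ) : ∃ K : ℝ, 0 ≤ K ∧
    ∀ (f : ℂ → ℂ) (R : ℝ), 1 < R → DifferentiableOn ℂ f (ball 0 R) →
      (∀ z ∈ closedBall (0 : ℂ) 1, ‖f z‖ ≤ 1) →
      ∃ (κ : ℂ → ℝ) (L L' : ℂ → ℂ), ContinuousOn κ (closedBall 0 1) ∧ (∀ z, 0 ≤ κ z) ∧
        (∀ z ∈ closedBall (0 : ℂ) 1, δ ≤ ‖f z‖ → κ z = 0) ∧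
        (∀ z ∈ ball (0 : ℂ) 1, HasDerivAt L (L' z) z ∧ |(L z).re| ≤ K) ∧
        (∀ w ∈ ball (0 : ℂ) 1, ∫ z in ball (0 : ℂ) 1, κ z * (1 - normSq (moeb w z)) ≤ K) ∧
        ∀ w ∈ ball (0 : ℂ) 1, δ < ‖f w‖ → L' w = deriv f w / f w -
          ∫ z in ball (0 : ℂ) 1, κ z * (1 / (w - z) + conj z / (1 - conj z * w)) := by
  set t : ℝ := δ ^ 2 with ht_def
  have ht : 0 < t := by positivity
  refine ⟨4 * (2 + |Real.log t|), by positivity, fun f R hR hf hf1 => ?_⟩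
  have hsub : closedBall (0 : ℂ) 1 ⊆ ball 0 R := closedBall_subset_ball hR
  have hd : ∀ z ∈ closedBall (0 : ℂ) 1, HasDerivAt f (deriv f z) z := fun z hz =>
    (hf.differentiableAt (isOpen_ball.mem_nhds (hsub hz))).hasDerivAt
  have hd2 : ∀ z ∈ closedBall (0 : ℂ) 1, HasDerivAt (deriv f) (deriv (deriv f) z) z := fun z hz =>
    ((hf.deriv isOpen_ball).differentiableAt (isOpen_ball.mem_nhds (hsub hz))).hasDerivAt
  have hfc : ContinuousOn f (closedBall 0 1) := fun z hz => (hd z hz).continuousAt.continuousWithinAt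
  have hfc' : ContinuousOn (deriv f) (closedBall 0 1) := fun z hz =>
    (hd2 z hz).continuousAt.continuousWithinAt
  set u : ℂ → ℝ := fun z => regLog t (normSq (f z)) with hu_def
  set p : ℂ → ℂ := fun z => regLog' t (normSq (f z)) * conj (f z) * deriv f z with hp_def
  set κ₀ : ℂ → ℝ := fun z => normSq (deriv f z) * (max (t - normSq (f z)) 0 / t ^ 2) with hκ_def
  have hu : ∀ z ∈ closedBall (0 : ℂ) 1, HasW (fun w => (u w : ℂ)) (p z) (conj (p z)) z :=
    fun z hz => (hasW_normSq (hasDerivAt_regLog ht _) (hd z hz)).congr_coeff rfl (by simp [hp_def])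
  have hp : ∀ z ∈ closedBall (0 : ℂ) 1, ∃ e, HasW p e (κ₀ z) z := fun z hz =>
    ⟨_, (((hasW_normSq (hasDerivAt_regLog' ht _) (hd z hz)).mul
      (hasW_of_hasDerivAt (hd z hz)).conj).mul (hasW_of_hasDerivAt (hd2 z hz))).congr_coeff rfl (by
        simp only [hκ_def]
        rw [← mul_regLog''_add ht]
        push_cast
        rw [normSq_eq_conj_mul_self, normSq_eq_conj_mul_self]
        simp only [mul_zero, add_zero]
        ring)⟩
  choose! e he using hp
  have hκc : ContinuousOn κ₀ (closedBall 0 1) := by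
    have := continuous_normSq
    fun_prop
  have huB : ∀ z ∈ closedBall (0 : ℂ) 1, |u z| ≤ 2 + |Real.log t| := fun z hz =>
    abs_regLog_le ht (normSq_nonneg _) (by
      rw [normSq_eq_norm_sq]; have := hf1 z hz; nlinarith [norm_nonneg (f z)])
  have huc : ContinuousOn u (closedBall 0 1) := fun z hz => by
    have := continuous_re.continuousAt.comp (hu z hz).continuousAt
    exact this.continuousWithinAt
  have hκ0 : ∀ z, δ ≤ ‖f z‖ → κ₀ z = 0 := fun z hz => by
    simp only [hκ_def]
    rw [max_eq_right, zero_div, mul_zero]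
    rw [normSq_eq_norm_sq]; nlinarith
  have hκn : ∀ z, 0 ≤ κ₀ z := fun z => by
    have := normSq_nonneg (deriv f z)
    positivity
  have hui : CircleIntegrable (fun z => (u z : ℂ)) 0 1 :=
    ((continuous_ofReal.comp_continuousOn huc).mono sphere_subset_closedBall).circleIntegrable
      zero_le_one
  have hπ := Real.pi_pos
  refine ⟨fun z => 2 / π * κ₀ z,
    fun w => Real.circleAverage (fun ζ => herglotzRieszKernel 0 w ζ • (u ζ : ℂ)) 0 1,
    fun w => Real.circleAverage (fun ζ => (2 * ζ / (ζ - w) ^ 2) • (u ζ : ℂ)) 0 1,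
    hκc.const_smul (2 / π), fun z => mul_nonneg (by positivity) (hκn z), fun z _ h => by simp [hκ0 z h],
    fun z hz => ⟨hasDerivAt_circleAverage_herglotzRieszKernel_smul hui hz,
      (abs_re_herglotz_le huc huB hz).trans (by linarith [abs_nonneg (Real.log t)])⟩,
    fun w hw => ?_, fun w hw hfw => ?_⟩
  · have := integral_weight_le hu he hκc huB (mem_ball_zero_iff.1 hw)
    simp only [mul_assoc]
    rw [integral_const_mul]
    calc _ ≤ 2 / π * (2 * π * (2 + |Real.log t|)) := by gcongr
      _ = _ := by field_simp; ring
  · have hev : ∀ᶠ z in 𝓝 w, κ₀ z = 0 := by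
      have := (hd w (ball_subset_closedBall hw)).continuousAt.norm.eventually_const_lt hfw
      exact this.mono fun z hz => hκ0 z hz.le
    have h1 := integral_herglotz hu he hκc hw hev
    have hf0 : f w ≠ 0 := norm_pos_iff.1 (hδ.trans hfw)
    have h2 : 2 * p w = deriv f w / f w := by
      have h3 : ¬ normSq (f w) ≤ t := by rw [normSq_eq_norm_sq, not_le]; nlinarith
      have h4 : conj (f w) ≠ 0 := by simpa using hf0
      simp only [hp_def, regLog', if_neg h3]
      push_cast
      rw [normSq_eq_conj_mul_self]
      field_simp
    have hπ' : (π : ℂ) ≠ 0 := ofReal_ne_zero.2 hπ.ne'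
    have h3 : ∀ z, ((2 / π * κ₀ z : ℝ) : ℂ) * (1 / (w - z) + conj z / (1 - conj z * w)) =
        (2 / π : ℂ) * (κ₀ z * (1 / (w - z) + conj z / (1 - conj z * w))) := fun z => by
      push_cast; ring
    simp only [h3]
    rw [integral_eq_circleAverage, real_smul, integral_const_mul, ← h2]
    simp only [smul_eq_mul]
    rw [h1]
    push_cast
    field_simp
    ring

theorem norm_wirt_le (a b : ℂ) : ‖wirt a b‖ ≤ ‖a‖ + ‖b‖ := by
  refine ContinuousLinearMap.opNorm_le_bound _ (by positivity) fun v => ?_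
  rw [wirt_apply]
  refine (norm_add_le _ _).trans ?_
  rw [norm_mul, norm_mul, RCLike.norm_conj, add_mul]

theorem continuous_wirt : Continuous fun q : ℂ × ℂ => wirt q.1 q.2 := by
  unfold wirt; fun_prop

theorem hasW_integral {α : Type*} [MeasurableSpace α] {μ : Measure α} {F a b : ℂ → α → ℂ} {z₀ : ℂ}
    {s : Set ℂ} (hs : s ∈ 𝓝 z₀) {bound : α → ℝ} (hFm : ∀ z, AEStronglyMeasurable (F z) μ)
    (hFi : Integrable (F z₀) μ) (ham : AEStronglyMeasurable (a z₀) μ)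
    (hbm : AEStronglyMeasurable (b z₀) μ)
    (hb : ∀ᵐ x ∂μ, ∀ z ∈ s, ‖a z x‖ + ‖b z x‖ ≤ bound x) (hbi : Integrable bound μ)
    (hd : ∀ᵐ x ∂μ, ∀ z ∈ s, HasW (fun z => F z x) (a z x) (b z x) z) :
    HasW (fun z => ∫ x, F z x ∂μ) (∫ x, a z₀ x ∂μ) (∫ x, b z₀ x ∂μ) z₀ := by
  have hm : AEStronglyMeasurable (fun x => wirt (a z₀ x) (b z₀ x)) μ :=
    continuous_wirt.comp_aestronglyMeasurable (ham.prodMk hbm)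
  have hz₀ := mem_of_mem_nhds hs
  have h1 : Integrable (fun x => wirt (a z₀ x) (b z₀ x)) μ :=
    hbi.mono' hm (hb.mono fun x hx => (norm_wirt_le _ _).trans (hx z₀ hz₀))
  have ha : Integrable (a z₀) μ := hbi.mono' ham (hb.mono fun x hx => by
    linarith [hx z₀ hz₀, norm_nonneg (b z₀ x)])
  have hb' : Integrable (b z₀) μ := hbi.mono' hbm (hb.mono fun x hx => by
    linarith [hx z₀ hz₀, norm_nonneg (a z₀ x)])
  refine (hasFDerivAt_integral_of_dominated_of_fderiv_le (F' := fun z x => wirt (a z x) (b z x)) hs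
    (.of_forall hFm) hFi hm (hb.mono fun x hx z hz => (norm_wirt_le _ _).trans (hx z hz)) hbi
    hd).congr_fderiv ?_
  ext1 v
  rw [ContinuousLinearMap.integral_apply h1, wirt_apply]
  simp only [wirt_apply]
  rw [integral_add (ha.mul_const v) (hb'.mul_const _), integral_mul_const, integral_mul_const]

theorem normSq_moeb_comm (a z : ℂ) : normSq (moeb a z) = normSq (moeb z a) := by
  rw [moeb, moeb, map_div₀, map_div₀, ← normSq_neg (z - a), neg_sub, ← normSq_conj (1 - conj a * z)]
  simp [mul_comm]

/-- The part of `|b_a'|` supported where `1 - |a|²` is comparable to `|1 - ā z|`. -/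
noncomputable def ker (a z : ℂ) : ℝ :=
  if ‖1 - conj a * z‖ ≤ 2 * (1 - ‖a‖ ^ 2) then (1 - ‖a‖ ^ 2) / ‖1 - conj a * z‖ ^ 2 else 0

theorem ker_nonneg {a z : ℂ} (ha : ‖a‖ ≤ 1) : 0 ≤ ker a z := by
  unfold ker
  split_ifs
  · exact div_nonneg (by nlinarith [norm_nonneg a]) (sq_nonneg _)
  · exact le_rfl

theorem one_sub_norm_le {a z : ℂ} {ρ : ℝ} (ha : ‖a‖ < 1) (hz : ‖z‖ ≤ ρ) :
    1 - ρ ≤ ‖1 - conj a * z‖ := by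
  have h1 := norm_sub_norm_le (1 : ℂ) (conj a * z)
  rw [norm_one, norm_mul, RCLike.norm_conj] at h1
  nlinarith [norm_nonneg z, norm_nonneg a]

theorem norm_moeb'_le {a z : ℂ} {ρ : ℝ} (ha : ‖a‖ < 1) (hz : ‖z‖ ≤ ρ) (hρ : ρ < 1) :
    ‖moeb' a z‖ ≤ 1 / (1 - ρ) ^ 2 := by
  rw [norm_moeb' ha]
  have h1 := one_sub_norm_le ha hz
  have h2 : 0 < 1 - ρ := by linarith
  gcongr
  nlinarith [norm_nonneg a]

theorem exists_psi {δ : ℝ} (hδ : 0 < δ) (hδ1 : δ ≤ 1) : ∃ ε K : ℝ, 0 < ε ∧ ε ≤ δ / 16 ∧ 0 ≤ K ∧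
    ∀ (f g : ℂ → ℂ) (R : ℝ), 1 < R → DifferentiableOn ℂ f (ball 0 R) →
      DifferentiableOn ℂ g (ball 0 R) →
      (∀ z ∈ closedBall (0 : ℂ) 1, ‖f z‖ ≤ 1) → (∀ z ∈ closedBall (0 : ℂ) 1, ‖g z‖ ≤ 1) →
      (∀ z ∈ closedBall (0 : ℂ) 1, δ ≤ ‖f z‖ + ‖g z‖) →
      ∃ (κ : ℂ → ℝ) (ψ a b : ℂ → ℂ), ContinuousOn κ (closedBall 0 1) ∧ (∀ z, 0 ≤ κ z) ∧
        (∀ w ∈ ball (0 : ℂ) 1, ∫ z in ball (0 : ℂ) 1, κ z * (1 - normSq (moeb z w)) ≤ K) ∧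
        ContinuousOn b (ball 0 1) ∧
        ∀ z ∈ ball (0 : ℂ) 1, HasW ψ (a z) (b z) z ∧ |(ψ z).re| ≤ K ∧
          ‖b z‖ ≤ K * ∫ x in ball (0 : ℂ) 1, κ x * ker x z ∧
          (‖g z‖ < ε → b z = 0 ∧ a z = deriv f z / f z) := by
  obtain ⟨ε, M, hε, hεδ, hM, hpot⟩ := exists_pot (half_pos hδ) (by linarith)
  obtain ⟨K, hK, hcharge⟩ := exists_charge (half_pos hδ)
  refine ⟨ε, max M (K + M * K), hε, by linarith, le_max_of_le_left hM,
    fun f g R hR hf hg hf1 hg1 hfg => ?_⟩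
  obtain ⟨S, A, D, hmeas, hSAD⟩ := hpot g R hR hg hg1
  obtain ⟨κ, L, L', hκc, hκ0, hκz, hL, hκK, hL'⟩ := hcharge f R hR hf hf1
  have hκK' : ∀ w ∈ ball (0 : ℂ) 1, ∫ z in ball (0 : ℂ) 1, κ z * (1 - normSq (moeb z w)) ≤ K :=
    fun w hw => by simpa only [normSq_moeb_comm w] using hκK w hw
  set μ : Measure ℂ := volume.restrict (ball (0 : ℂ) 1) with hμ
  have hmem : ∀ᵐ x ∂μ, x ∈ ball (0 : ℂ) 1 := ae_restrict_mem measurableSet_ball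
  have hκm : AEStronglyMeasurable (fun x => (κ x : ℂ)) μ :=
    (integrableOn_ball_of_continuousOn (continuous_ofReal.comp_continuousOn hκc)).aestronglyMeasurable
  have hκi : Integrable κ μ := integrableOn_ball_of_continuousOn hκc
  have hgood : ∀ x ∈ ball (0 : ℂ) 1, κ x ≠ 0 → ‖x‖ < 1 ∧ δ / 2 ≤ ‖g x‖ := fun x hx hκx => by
    refine ⟨mem_ball_zero_iff.1 hx, ?_⟩
    have h1 := hfg x (ball_subset_closedBall hx)
    by_contra h
    exact hκx (hκz x (ball_subset_closedBall hx) (by linarith))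
  have hmo : ∀ x ∈ ball (0 : ℂ) 1, ∀ z ∈ ball (0 : ℂ) 1, ‖moeb x z‖ < 1 := fun x hx z hz =>
    norm_moeb_lt (mem_ball_zero_iff.1 hx) (mem_ball_zero_iff.1 hz)
  have hmo' : ∀ x ∈ ball (0 : ℂ) 1, ∀ z ∈ ball (0 : ℂ) 1, HasDerivAt (moeb x) (moeb' x z) z :=
    fun x hx z hz => hasDerivAt_moeb (one_sub_conj_mul_ne_zero (mem_ball_zero_iff.1 hx)
      (mem_ball_zero_iff.1 hz).le)
  have hmm : ∀ z, Measurable fun x => moeb' x z := fun z => by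
    have h1 := continuous_conj.measurable
    have h2 := continuous_normSq.measurable
    unfold moeb'
    fun_prop
  have hmm0 : ∀ z, Measurable fun x => moeb x z := fun z => by
    have h1 := continuous_conj.measurable
    unfold moeb
    fun_prop
  have hbnd : ∀ x ∈ ball (0 : ℂ) 1, κ x ≠ 0 → ∀ z ∈ ball (0 : ℂ) 1, _ := fun x hx h z hz =>
    hSAD x (hgood x hx h).1 (hgood x hx h).2 (moeb x z) (hmo x hx z hz)
  have hSm : ∀ z, AEStronglyMeasurable (fun x => (κ x : ℂ) * S x (moeb x z)) μ := fun z =>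
    hκm.mul (hmeas z).1
  have hAm : ∀ z, AEStronglyMeasurable (fun x => (κ x : ℂ) * (A x (moeb x z) * moeb' x z)) μ :=
    fun z => hκm.mul ((hmeas z).2.1.mul (hmm z).aestronglyMeasurable)
  have hDm : ∀ z, AEStronglyMeasurable
      (fun x => (κ x : ℂ) * (D x (moeb x z) * conj (moeb' x z))) μ := fun z =>
    hκm.mul ((hmeas z).2.2.mul (continuous_conj.measurable.comp (hmm z)).aestronglyMeasurable)
  have hSb : ∀ z ∈ ball (0 : ℂ) 1, ∀ x ∈ ball (0 : ℂ) 1, ‖(κ x : ℂ) * S x (moeb x z)‖ ≤ M * κ x := by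
    intro z hz x hx
    rw [norm_mul, norm_real, Real.norm_of_nonneg (hκ0 x), mul_comm M]
    by_cases h : κ x = 0
    · simp [h]
    · exact mul_le_mul_of_nonneg_left (hbnd x hx h z hz).2.2.2.1 (hκ0 x)
  have hSi : ∀ z ∈ ball (0 : ℂ) 1, Integrable (fun x => (κ x : ℂ) * S x (moeb x z)) μ := fun z hz =>
    (hκi.const_mul M).mono' (hSm z) (hmem.mono (hSb z hz))
  have hAb : ∀ ρ < 1, ∀ z, ‖z‖ ≤ ρ → ∀ x ∈ ball (0 : ℂ) 1,
      ‖(κ x : ℂ) * (A x (moeb x z) * moeb' x z)‖ ≤ M * (1 / (1 - ρ) ^ 2) * κ x := by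
    intro ρ hρ z hz x hx
    rw [norm_mul, norm_mul, norm_real, Real.norm_of_nonneg (hκ0 x), mul_comm (M * _)]
    by_cases h : κ x = 0
    · simp [h]
    · have h1 := hbnd x hx h z (mem_ball_zero_iff.2 (hz.trans_lt hρ))
      exact mul_le_mul_of_nonneg_left (mul_le_mul h1.2.2.2.2.1
        (norm_moeb'_le (mem_ball_zero_iff.1 hx) hz hρ) (norm_nonneg _) hM) (hκ0 x)
  have hDb : ∀ ρ < 1, ∀ z, ‖z‖ ≤ ρ → ∀ x ∈ ball (0 : ℂ) 1,
      ‖(κ x : ℂ) * (D x (moeb x z) * conj (moeb' x z))‖ ≤ M * (1 / (1 - ρ) ^ 2) * κ x := by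
    intro ρ hρ z hz x hx
    rw [norm_mul, norm_mul, RCLike.norm_conj, norm_real, Real.norm_of_nonneg (hκ0 x), mul_comm (M * _)]
    by_cases h : κ x = 0
    · simp [h]
    · have h1 := hbnd x hx h z (mem_ball_zero_iff.2 (hz.trans_lt hρ))
      exact mul_le_mul_of_nonneg_left (mul_le_mul h1.2.2.2.2.2.1
        (norm_moeb'_le (mem_ball_zero_iff.1 hx) hz hρ) (norm_nonneg _) hM) (hκ0 x)
  have hnhds : ∀ z ∈ ball (0 : ℂ) 1, ∃ ρ < 1, closedBall (0 : ℂ) ρ ∈ 𝓝 z := fun z hz => by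
    obtain ⟨ρ, h1, h2⟩ := exists_between (mem_ball_zero_iff.1 hz)
    exact ⟨ρ, h2, mem_of_superset (isOpen_ball.mem_nhds (mem_ball_zero_iff.2 h1))
      ball_subset_closedBall⟩
  have hW : ∀ z ∈ ball (0 : ℂ) 1, HasW (fun z => ∫ x, (κ x : ℂ) * S x (moeb x z) ∂μ)
      (∫ x, (κ x : ℂ) * (A x (moeb x z) * moeb' x z) ∂μ)
      (∫ x, (κ x : ℂ) * (D x (moeb x z) * conj (moeb' x z)) ∂μ) z := by
    intro z hz
    obtain ⟨ρ, hρ, hs⟩ := hnhds z hz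
    refine hasW_integral hs (bound := fun x => M * (1 / (1 - ρ) ^ 2) * κ x + M * (1 / (1 - ρ) ^ 2) * κ x)
      (a := fun z x => (κ x : ℂ) * (A x (moeb x z) * moeb' x z))
      (b := fun z x => (κ x : ℂ) * (D x (moeb x z) * conj (moeb' x z)))
      hSm (hSi z hz) (hAm z) (hDm z) ?_ ((hκi.const_mul _).add (hκi.const_mul _)) ?_
    · filter_upwards [hmem] with x hx w hw
      exact add_le_add (hAb ρ hρ w (mem_closedBall_zero_iff.1 hw) x hx)
        (hDb ρ hρ w (mem_closedBall_zero_iff.1 hw) x hx)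
    · filter_upwards [hmem] with x hx w hw
      have hw : w ∈ ball (0 : ℂ) 1 := mem_ball_zero_iff.2 ((mem_closedBall_zero_iff.1 hw).trans_lt hρ)
      by_cases h : κ x = 0
      · simpa [h] using hasW_const 0 w
      · exact ((hasW_const (κ x : ℂ) w).mul ((hbnd x hx h w hw).1.comp_hol (hmo' x hx w hw))).congr_coeff
          (by ring) (by ring)
  refine ⟨κ, fun z => L z + ∫ x, (κ x : ℂ) * S x (moeb x z) ∂μ,
    fun z => L' z + ∫ x, (κ x : ℂ) * (A x (moeb x z) * moeb' x z) ∂μ,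
    fun z => ∫ x, (κ x : ℂ) * (D x (moeb x z) * conj (moeb' x z)) ∂μ, hκc, hκ0,
    fun w hw => (hκK' w hw).trans ((le_add_of_nonneg_right (by positivity)).trans (le_max_right _ _)),
    fun z hz => ?_, fun z hz => ⟨?_, ?_, ?_, fun hgz => ?_⟩⟩
  · obtain ⟨ρ, hρ, hs⟩ := hnhds z hz
    refine (continuousAt_of_dominated (.of_forall hDm) (bound := fun x => M * (1 / (1 - ρ) ^ 2) * κ x) ?_
      (hκi.const_mul _) ?_).continuousWithinAt
    · filter_upwards [hs] with w hw
      exact hmem.mono (hDb ρ hρ w (mem_closedBall_zero_iff.1 hw))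
    · filter_upwards [hmem] with x hx
      by_cases h : κ x = 0
      · simpa [h] using continuousAt_const
      · have h2 := one_sub_conj_mul_ne_zero (mem_ball_zero_iff.1 hx) (mem_ball_zero_iff.1 hz).le
        exact continuousAt_const.mul (((hbnd x hx h z hz).2.2.1.comp (hmo' x hx z hz).continuousAt).mul
          (continuous_conj.continuousAt.comp (hasDerivAt_moeb' h2).continuousAt))
  · exact ((hasW_of_hasDerivAt (hL z hz).1).add (hW z hz)).congr_coeff rfl (zero_add _)
  · have h1 : |(∫ x, (κ x : ℂ) * S x (moeb x z) ∂μ).re| ≤ M * K := by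
      have h2 : (∫ x, (κ x : ℂ) * S x (moeb x z) ∂μ).re =
          ∫ x, ((κ x : ℂ) * S x (moeb x z)).re ∂μ := (reCLM.integral_comp_comm (hSi z hz)).symm
      rw [h2]
      have h3 : Integrable (fun x => M * (κ x * (1 - normSq (moeb x z)))) μ := by
        refine (Integrable.mono' (f := fun x => κ x * (1 - normSq (moeb x z))) hκi (hκi.aestronglyMeasurable.mul
          (measurable_const.sub (continuous_normSq.measurable.comp (hmm0 z))).aestronglyMeasurable)
          (hmem.mono fun x hx => ?_)).const_mul M
        have h4 := hmo x hx z hz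
        rw [norm_mul, Real.norm_of_nonneg (hκ0 x), normSq_eq_norm_sq,
          Real.norm_of_nonneg (by nlinarith [norm_nonneg (moeb x z)])]
        nlinarith [hκ0 x, norm_nonneg (moeb x z), mul_nonneg (hκ0 x) (sq_nonneg ‖moeb x z‖)]
      have h4 := norm_integral_le_of_norm_le h3 (f := fun x => ((κ x : ℂ) * S x (moeb x z)).re)
        (hmem.mono fun x hx => ?_)
      · rw [Real.norm_eq_abs, integral_const_mul] at h4
        exact h4.trans (mul_le_mul_of_nonneg_left (hκK' z hz) hM)
      · rw [re_ofReal_mul, Real.norm_eq_abs, abs_mul, abs_of_nonneg (hκ0 x)]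
        by_cases h : κ x = 0
        · simp [h]
        · have := (hbnd x hx h z hz).2.2.2.2.2.2.1
          calc _ ≤ κ x * (M * (1 - normSq (moeb x z))) := mul_le_mul_of_nonneg_left this (hκ0 x)
            _ = _ := by ring
    calc _ ≤ |(L z).re| + |(∫ x, (κ x : ℂ) * S x (moeb x z) ∂μ).re| := abs_add_le _ _
      _ ≤ K + M * K := add_le_add (hL z hz).2 h1
      _ ≤ _ := le_max_right _ _
  · have hk : Integrable (fun x => κ x * ker x z) μ := by
      have h1 : Measurable fun x => ker x z := by
        have h1 := continuous_conj.measurable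
        unfold ker
        refine Measurable.ite (measurableSet_le (by fun_prop) (by fun_prop)) (by fun_prop)
          measurable_const
      refine (hκi.const_mul (1 / (1 - ‖z‖) ^ 2)).mono' (hκi.aestronglyMeasurable.mul
        h1.aestronglyMeasurable) (hmem.mono fun x hx => ?_)
      rw [norm_mul, Real.norm_of_nonneg (hκ0 x), mul_comm (_ / _)]
      refine mul_le_mul_of_nonneg_left ?_ (hκ0 x)
      have h2 := norm_moeb'_le (mem_ball_zero_iff.1 hx) le_rfl (mem_ball_zero_iff.1 hz)
      unfold ker
      split_ifs
      · rwa [← norm_moeb' (mem_ball_zero_iff.1 hx), norm_norm]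
      · rw [norm_zero]; positivity
    have h1 := norm_integral_le_of_norm_le (hk.const_mul M)
      (f := fun x => (κ x : ℂ) * (D x (moeb x z) * conj (moeb' x z))) (hmem.mono fun x hx => ?_)
    · rw [integral_const_mul] at h1
      refine h1.trans (mul_le_mul_of_nonneg_right (le_max_left _ _) (integral_nonneg_of_ae ?_))
      exact hmem.mono fun x hx => mul_nonneg (hκ0 x) (ker_nonneg (mem_ball_zero_iff.1 hx).le)
    · rw [norm_mul, norm_mul, RCLike.norm_conj, norm_real, Real.norm_of_nonneg (hκ0 x)]
      by_cases h : κ x = 0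
      · simp [h]
      have hx1 := mem_ball_zero_iff.1 hx
      obtain ⟨-, -, -, -, -, h2, -, h3, -⟩ := hbnd x hx h z hz
      have h5 : ‖D x (moeb x z)‖ * ‖moeb' x z‖ ≤ M * ker x z := by
        by_cases hD : D x (moeb x z) = 0
        · simpa [hD] using mul_nonneg hM (ker_nonneg hx1.le)
        · have h6 := h3 hD
          have h7 := one_sub_conj_mul_ne_zero hx1 (mem_ball_zero_iff.1 hz).le
          have h8 : ‖1 - conj x * x‖ = 1 - ‖x‖ ^ 2 := by
            rw [← normSq_eq_conj_mul_self, normSq_eq_norm_sq, ← ofReal_one, ← ofReal_sub, norm_real,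
              Real.norm_of_nonneg (by nlinarith [norm_nonneg x])]
          rw [one_add_conj_mul_moeb hx1 (mem_ball_zero_iff.1 hz).le, norm_div, h8,
            le_div_iff₀ (norm_pos_iff.2 h7)] at h6
          rw [ker, if_pos (by linarith), ← norm_moeb' hx1]
          exact mul_le_mul_of_nonneg_right h2 (norm_nonneg _)
      calc _ ≤ κ x * (M * ker x z) := mul_le_mul_of_nonneg_left h5 (hκ0 x)
        _ = _ := by ring
  · have key : ∀ x ∈ ball (0 : ℂ) 1, κ x ≠ 0 → D x (moeb x z) = 0 ∧ A x (moeb x z) = 1 / moeb x z := by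
      intro x hx h
      refine (hbnd x hx h z hz).2.2.2.2.2.2.2.2 ?_
      rwa [moeb_neg_moeb (mem_ball_zero_iff.1 hx) (mem_ball_zero_iff.1 hz).le]
    constructor
    · beta_reduce
      rw [integral_eq_zero_of_ae]
      filter_upwards [hmem] with x hx
      by_cases h : κ x = 0
      · simp [h]
      · simp [(key x hx h).1]
    · have hfz := hfg z (ball_subset_closedBall hz)
      beta_reduce
      rw [hL' z hz (by linarith)]
      rw [sub_add_eq_add_sub, sub_eq_iff_eq_add, add_right_inj]
      refine integral_congr_ae ?_
      filter_upwards [hmem] with x hx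
      by_cases h : κ x = 0
      · simp [h]
      have hzx : z - x ≠ 0 := by
        refine sub_ne_zero.2 fun hzx => ?_
        have := (hgood x hx h).2
        rw [← hzx] at this
        linarith
      have h7 := one_sub_conj_mul_ne_zero (mem_ball_zero_iff.1 hx) (mem_ball_zero_iff.1 hz).le
      rw [(key x hx h).2, moeb, moeb', normSq_eq_conj_mul_self]
      generalize conj x = y at h7 ⊢
      have h8 : 1 - z * y ≠ 0 := by rwa [mul_comm]
      field_simp
      ring

theorem integral_param {μ : Measure ℂ} [IsFiniteMeasure μ] {ρ : ℝ} (hμ : ∀ᵐ p ∂μ, ‖p‖ ≤ ρ)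
    {F : ℂ → ℂ → ℂ} (hm : ∀ z, Measurable (F z))
    (hc : ContinuousOn (fun x : ℂ × ℂ => F x.1 x.2) (closedBall 0 1 ×ˢ closedBall 0 ρ)) :
    (∃ M, ∀ z ∈ closedBall (0 : ℂ) 1, ∀ p ∈ closedBall (0 : ℂ) ρ, ‖F z p‖ ≤ M) ∧
      (∀ z ∈ closedBall (0 : ℂ) 1, Integrable (F z) μ) ∧
      ContinuousOn (fun z => ∫ p, F z p ∂μ) (closedBall 0 1) := by
  obtain ⟨M, hM⟩ := ((isCompact_closedBall (0 : ℂ) 1).prod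
    (isCompact_closedBall (0 : ℂ) ρ)).exists_bound_of_continuousOn hc
  have hM' : ∀ z ∈ closedBall (0 : ℂ) 1, ∀ p ∈ closedBall (0 : ℂ) ρ, ‖F z p‖ ≤ M :=
    fun z hz p hp => hM (z, p) ⟨hz, hp⟩
  have hae : ∀ z ∈ closedBall (0 : ℂ) 1, ∀ᵐ p ∂μ, ‖F z p‖ ≤ M := fun z hz =>
    hμ.mono fun p hp => hM' z hz p (mem_closedBall_zero_iff.2 hp)
  refine ⟨⟨M, hM'⟩, fun z hz => (integrable_const M).mono' (hm z).aestronglyMeasurable (hae z hz),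
    continuousOn_of_dominated (bound := fun _ => M) (fun z _ => (hm z).aestronglyMeasurable) hae
      (integrable_const M) (hμ.mono fun p hp => ?_)⟩
  exact hc.comp (f := fun z => (z, p)) (by fun_prop) fun z hz =>
    ⟨hz, mem_closedBall_zero_iff.2 hp⟩

theorem hasW_integral_param {μ : Measure ℂ} [IsFiniteMeasure μ] {ρ : ℝ} (hμ : ∀ᵐ p ∂μ, ‖p‖ ≤ ρ)
    {F a b : ℂ → ℂ → ℂ} (hFm : ∀ z, Measurable (F z)) (ham : ∀ z, Measurable (a z))
    (hbm : ∀ z, Measurable (b z))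
    (hFc : ContinuousOn (fun x : ℂ × ℂ => F x.1 x.2) (closedBall 0 1 ×ˢ closedBall 0 ρ))
    (hac : ContinuousOn (fun x : ℂ × ℂ => a x.1 x.2) (closedBall 0 1 ×ˢ closedBall 0 ρ))
    (hbc : ContinuousOn (fun x : ℂ × ℂ => b x.1 x.2) (closedBall 0 1 ×ˢ closedBall 0 ρ))
    (hd : ∀ z ∈ closedBall (0 : ℂ) 1, ∀ p, ‖p‖ ≤ ρ → HasW (fun z => F z p) (a z p) (b z p) z)
    {z : ℂ} (hz : z ∈ ball (0 : ℂ) 1) :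
    HasW (fun z => ∫ p, F z p ∂μ) (∫ p, a z p ∂μ) (∫ p, b z p ∂μ) z := by
  obtain ⟨M, hM⟩ := (integral_param hμ ham hac).1
  obtain ⟨N, hN⟩ := (integral_param hμ hbm hbc).1
  have hs : closedBall (0 : ℂ) 1 ∈ 𝓝 z :=
    mem_of_superset (isOpen_ball.mem_nhds hz) ball_subset_closedBall
  refine hasW_integral hs (bound := fun _ => M + N) (fun z => (hFm z).aestronglyMeasurable)
    ((integral_param hμ hFm hFc).2.1 z (ball_subset_closedBall hz)) (ham z).aestronglyMeasurable
    (hbm z).aestronglyMeasurable (hμ.mono fun p hp w hw => ?_) (integrable_const _)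
    (hμ.mono fun p hp w hw => hd w hw p hp)
  exact add_le_add (hM w hw p (mem_closedBall_zero_iff.2 hp))
    (hN w hw p (mem_closedBall_zero_iff.2 hp))

/-- The kernel controlling a Carleson measure on boxes. -/
noncomputable def boxKer (p z : ℂ) : ℝ :=
  (1 - normSq p) ^ 3 * √(1 - normSq p) / ‖1 - conj p * z‖ ^ 4

theorem sum_dyadic {d X : ℝ} (hX : 0 < X) (hXd : X ≤ 3 * d) (hd : d ≤ 2) {N : ℕ}
    (hN : 24 / X < 4 ^ (N + 1)) :
    √d ≤ 24 * ∑ n ∈ Finset.range (N + 1), 2 ^ n * (d ^ 2 * (4 ^ n)⁻¹ / (d + (4 ^ n)⁻¹) ^ 2) := by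
  have hd0 : 0 < d := by linarith
  obtain ⟨n, hn1, hn2⟩ := exists_nat_pow_near (x := 2 / d) (y := (4 : ℝ))
    ((one_le_div hd0).2 hd) (by norm_num)
  have h4 : (0 : ℝ) < 4 ^ n := by positivity
  have hnN : n ∈ Finset.range (N + 1) := by
    rw [Finset.mem_range]
    refine (pow_lt_pow_iff_right₀ (a := (4 : ℝ)) (by norm_num)).1 (lt_of_le_of_lt ?_ hN)
    refine hn1.trans ?_
    rw [div_le_div_iff₀ hd0 hX]
    linarith
  refine le_trans ?_ (mul_le_mul_of_nonneg_left (Finset.single_le_sum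
    (f := fun n => 2 ^ n * (d ^ 2 * (4 ^ n)⁻¹ / (d + (4 ^ n)⁻¹) ^ 2))
    (fun i _ => by positivity) hnN) (by norm_num))
  set t : ℝ := (4 ^ n)⁻¹ with ht
  have ht0 : 0 < t := by positivity
  have hs : √t * 2 ^ n = 1 := by
    rw [ht, Real.sqrt_inv, show (4 : ℝ) ^ n = (2 ^ n) ^ 2 by rw [← pow_mul, mul_comm, pow_mul]; norm_num,
      Real.sqrt_sq (by positivity)]
    field_simp
  have ht1 : t ≤ 2 * d := by
    rw [pow_succ, div_lt_iff₀ hd0] at hn2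
    rw [ht, inv_eq_one_div, div_le_iff₀ h4]
    linarith
  have ht2 : d / 2 ≤ t := by
    rw [le_div_iff₀ hd0] at hn1
    rw [ht, inv_eq_one_div, le_div_iff₀ h4]
    linarith
  have h2 : (2 : ℝ) ^ n = 1 / √t := by
    rw [eq_div_iff (by positivity)]; linarith
  have e1 : √t * √t = t := Real.mul_self_sqrt ht0.le
  have e2 : √d * √d = d := Real.mul_self_sqrt hd0.le
  have e3 : (0:ℝ) < √t := Real.sqrt_pos.2 ht0
  have e4 : √d ≤ 2 * √t := by
    rw [Real.sqrt_le_iff]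
    refine ⟨by positivity, ?_⟩
    nlinarith
  have h5 : (d + t) ^ 2 ≤ 9 * d ^ 2 := by nlinarith
  have h6 : d ^ 2 * t / (9 * d ^ 2) ≤ d ^ 2 * t / (d + t) ^ 2 := by gcongr
  have h7 : d ^ 2 * t / (9 * d ^ 2) = t / 9 := by field_simp
  have h8 : 1 / √t * (t / 9) = √t / 9 := by
    nth_rw 2 [← e1]; field_simp
  rw [h2]
  calc √d ≤ 24 * (1 / √t * (t / 9)) := by rw [h8]; linarith
    _ ≤ _ := by rw [← h7]; gcongr

theorem one_sub_normSq_le (p z : ℂ) (hz : ‖z‖ ≤ 1) : 1 - normSq p ≤ 2 * ‖1 - conj p * z‖ := by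
  rcases le_total 1 ‖p‖ with h | h
  · have : 1 ≤ normSq p := by rw [normSq_eq_norm_sq]; nlinarith
    linarith [norm_nonneg (1 - conj p * z)]
  · have h1 : 1 - ‖p‖ * ‖z‖ ≤ ‖1 - conj p * z‖ := by
      simpa [norm_mul] using norm_sub_norm_le (1 : ℂ) (conj p * z)
    have h2 : ‖p‖ * ‖z‖ ≤ ‖p‖ := mul_le_of_le_one_right (norm_nonneg p) hz
    rw [normSq_eq_norm_sq]
    nlinarith [norm_nonneg p]

theorem one_sub_normSq_moeb_nonneg {p w : ℂ} (hp : ‖p‖ < 1) (hw : ‖w‖ ≤ 1) :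
    0 ≤ 1 - normSq (moeb p w) := by
  have := norm_moeb_le hp hw
  rw [normSq_eq_norm_sq]
  nlinarith [norm_nonneg (moeb p w)]

theorem measurable_moeb (w : ℂ) : Measurable fun p => moeb p w := by
  have := continuous_conj.measurable
  unfold moeb
  fun_prop

theorem integrable_one_sub_normSq_moeb {μ : Measure ℂ} [IsFiniteMeasure μ]
    (hμ : ∀ᵐ p ∂μ, ‖p‖ < 1) {w : ℂ} (hw : ‖w‖ ≤ 1) :
    Integrable (fun p => 1 - normSq (moeb p w)) μ := by
  have h1 := measurable_moeb w
  have h2 : Measurable normSq := continuous_normSq.measurable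
  refine (integrable_const (1 : ℝ)).mono' ((h2.comp h1).const_sub 1).aestronglyMeasurable
    (hμ.mono fun p hp => ?_)
  rw [Real.norm_of_nonneg (one_sub_normSq_moeb_nonneg hp hw)]
  linarith [normSq_nonneg (moeb p w)]

theorem boxKer_nonneg {p : ℂ} (hp : ‖p‖ < 1) (z : ℂ) : 0 ≤ boxKer p z := by
  have : 0 ≤ 1 - normSq p := by rw [normSq_eq_norm_sq]; nlinarith [norm_nonneg p]
  unfold boxKer
  positivity

theorem integral_boxKer_le {μ : Measure ℂ} [IsFiniteMeasure μ] (hμ : ∀ᵐ p ∂μ, ‖p‖ < 1) {K : ℝ}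
    (hK : ∀ w ∈ ball (0 : ℂ) 1, ∫ p, (1 - normSq (moeb p w)) ∂μ ≤ K) {z : ℂ}
    (hz : z ∈ closedBall (0 : ℂ) 1) {X : ℝ} (hX : 0 < X) (hX2 : X ≤ 2)
    (hXd : ∀ᵐ p ∂μ, X ≤ 3 * ‖1 - conj p * z‖) :
    √X * ∫ p, boxKer p z ∂μ ≤ 1920 * K := by
  have hz1 := mem_closedBall_zero_iff.1 hz
  have hK0 : 0 ≤ K := le_trans (integral_nonneg_of_ae (hμ.mono fun p hp =>
    one_sub_normSq_moeb_nonneg hp (by simp))) (hK 0 (mem_ball_self one_pos))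
  obtain ⟨N, hN1, hN2⟩ := exists_nat_pow_near (x := 24 / X) (y := (4 : ℝ))
    ((one_le_div hX).2 (by linarith)) (by norm_num)
  have ht : ∀ n : ℕ, 0 < ((4 : ℝ) ^ n)⁻¹ ∧ ((4 : ℝ) ^ n)⁻¹ ≤ 1 := fun n =>
    ⟨by positivity, inv_le_one_of_one_le₀ (one_le_pow₀ (by norm_num))⟩
  set w : ℕ → ℂ := fun n => ((1 - ((4 : ℝ) ^ n)⁻¹ : ℝ) : ℂ) * z with hw_def
  have hw : ∀ n, w n ∈ ball (0 : ℂ) 1 := fun n => by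
    obtain ⟨h1, h2⟩ := ht n
    rw [mem_ball_zero_iff, hw_def, norm_mul, norm_real, Real.norm_of_nonneg (by linarith)]
    nlinarith [norm_nonneg z]
  have hint : ∀ n, Integrable (fun p => 1 - normSq (moeb p (w n))) μ := fun n =>
    integrable_one_sub_normSq_moeb hμ (mem_ball_zero_iff.1 (hw n)).le
  have hpt : ∀ᵐ p ∂μ, boxKer p z ≤
      192 * ∑ n ∈ Finset.range (N + 1), 2 ^ n * (1 - normSq (moeb p (w n))) := by
    filter_upwards [hμ, hXd] with p hp hd
    set d := ‖1 - conj p * z‖ with hd_def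
    set y := 1 - normSq p with hy_def
    have hy : 0 < y := by rw [hy_def, normSq_eq_norm_sq]; nlinarith [norm_nonneg p]
    have hd0 : 0 < d := by linarith
    have hyd : y ≤ 2 * d := one_sub_normSq_le p z hz1
    have hd2 : d ≤ 2 := by
      refine (norm_sub_le _ _).trans ?_
      rw [norm_one, norm_mul, RCLike.norm_conj]
      nlinarith [norm_nonneg p, norm_nonneg z]
    have hterm : ∀ n, y / d ^ 2 * (d ^ 2 * (4 ^ n)⁻¹ / (d + (4 ^ n)⁻¹) ^ 2) ≤
        1 - normSq (moeb p (w n)) := by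
      intro n
      obtain ⟨h1, h2⟩ := ht n
      set t : ℝ := ((4 : ℝ) ^ n)⁻¹
      have hw1 := (mem_ball_zero_iff.1 (hw n)).le
      rw [one_sub_normSq_moeb hp hw1, normSq_eq_norm_sq (1 - conj p * w n)]
      have e1 : ‖1 - conj p * w n‖ ≤ d + t := by
        have : 1 - conj p * w n = (1 - conj p * z) + (t : ℂ) * (conj p * z) := by
          rw [show w n = ((1 - t : ℝ) : ℂ) * z from rfl]; push_cast; ring
        rw [this]
        refine (norm_add_le _ _).trans ?_
        rw [norm_mul, norm_real, Real.norm_of_nonneg h1.le, norm_mul, RCLike.norm_conj]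
        have : ‖p‖ * ‖z‖ ≤ 1 := by nlinarith [norm_nonneg p, norm_nonneg z]
        nlinarith
      have e2 : t ≤ 1 - normSq (w n) := by
        have : ‖w n‖ ≤ 1 - t := by
          rw [hw_def, norm_mul, norm_real, Real.norm_of_nonneg (by linarith)]
          nlinarith [norm_nonneg z]
        rw [normSq_eq_norm_sq]
        nlinarith [norm_nonneg (w n)]
      have e3 : 0 < ‖1 - conj p * w n‖ := norm_pos_iff.2 (one_sub_conj_mul_ne_zero hp hw1)
      calc _ = y * t / (d + t) ^ 2 := by field_simp
        _ ≤ _ := div_le_div₀ (mul_nonneg hy.le (by linarith)) (by gcongr) (by positivity)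
            (by gcongr)
    have hs := sum_dyadic hX hd hd2 hN2
    have h1 : boxKer p z ≤ 8 * (y / d ^ 2 * √d) := by
      have e1 : √y ≤ 2 * √d := by
        rw [Real.sqrt_le_iff]
        refine ⟨by positivity, ?_⟩
        rw [mul_pow, Real.sq_sqrt hd0.le]; linarith
      have e2 : y ^ 2 ≤ (2 * d) ^ 2 := by gcongr
      calc boxKer p z = y * (y ^ 2 * √y) / d ^ 4 := by
            rw [boxKer, ← hd_def, ← hy_def]; ring
        _ ≤ y * ((2 * d) ^ 2 * (2 * √d)) / d ^ 4 := by gcongr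
        _ = _ := by field_simp; ring
    refine h1.trans ?_
    calc 8 * (y / d ^ 2 * √d) ≤ 8 * (y / d ^ 2 * (24 * ∑ n ∈ Finset.range (N + 1),
          2 ^ n * (d ^ 2 * (4 ^ n)⁻¹ / (d + (4 ^ n)⁻¹) ^ 2))) := by gcongr
      _ = 192 * ∑ n ∈ Finset.range (N + 1), 2 ^ n * (y / d ^ 2 *
          (d ^ 2 * (4 ^ n)⁻¹ / (d + (4 ^ n)⁻¹) ^ 2)) := by
          simp only [Finset.mul_sum]
          exact Finset.sum_congr rfl fun n _ => by ring
      _ ≤ _ := by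
          gcongr with n hn
          exact hterm n
  have hle : ∫ p, boxKer p z ∂μ ≤ 192 * (2 ^ (N + 1) * K) := by
    calc ∫ p, boxKer p z ∂μ ≤ ∫ p, 192 * ∑ n ∈ Finset.range (N + 1),
          2 ^ n * (1 - normSq (moeb p (w n))) ∂μ :=
          integral_mono_of_nonneg (hμ.mono fun p hp => boxKer_nonneg hp z)
            ((integrable_finsetSum _ fun n _ => (hint n).const_mul _).const_mul _) hpt
      _ = 192 * ∑ n ∈ Finset.range (N + 1), 2 ^ n * ∫ p, (1 - normSq (moeb p (w n))) ∂μ := by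
          rw [integral_const_mul, integral_finsetSum _ fun n _ => (hint n).const_mul _]
          simp only [integral_const_mul]
      _ ≤ 192 * ∑ n ∈ Finset.range (N + 1), 2 ^ n * K := by
          gcongr with n hn
          exact hK _ (hw n)
      _ ≤ _ := by
          rw [← Finset.sum_mul]
          have : ∑ n ∈ Finset.range (N + 1), (2 : ℝ) ^ n ≤ 2 ^ (N + 1) := by
            rw [geom_sum_eq (by norm_num)]; norm_num
          gcongr
  have h2N : √X * 2 ^ N ≤ 5 := by
    have e1 : ((2 : ℝ) ^ N) ^ 2 = 4 ^ N := by rw [← pow_mul, mul_comm, pow_mul]; norm_num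
    rw [le_div_iff₀ hX] at hN1
    refine abs_le_of_sq_le_sq' ?_ (by norm_num) |>.2
    rw [mul_pow, Real.sq_sqrt hX.le, e1]
    linarith
  calc _ ≤ √X * (192 * (2 ^ (N + 1) * K)) := by gcongr
    _ = 384 * (√X * 2 ^ N) * K := by ring
    _ ≤ 384 * 5 * K := by gcongr
    _ = _ := by ring

theorem HasW.conj_real {F : ℂ → ℝ} {a b z : ℂ} (h : HasW (fun w => (F w : ℂ)) a b z) :
    a = conj b := by
  have h1 := h.conj
  simp only [conj_ofReal] at h1
  have h2 := HasFDerivAt.unique h h1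
  have e1 := congrArg (fun L => L 1) h2
  have e2 := congrArg (fun L => L I) h2
  simp only [wirt_apply, map_one, mul_one, conj_I] at e1 e2
  have e3 : a - b = conj b - conj a := by
    have : (a - b) * I = (conj b - conj a) * I := by linear_combination e2
    exact mul_right_cancel₀ I_ne_zero this
  linear_combination (e1 + e3) / 2

theorem hasDerivAt_inv_den {c z : ℂ} (h : 1 - c * z ≠ 0) :
    HasDerivAt (fun z => (1 - c * z)⁻¹) (c * (1 - c * z)⁻¹ ^ 2) z := by
  have h1 : HasDerivAt (fun z => 1 - c * z) (-c) z := by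
    simpa using ((hasDerivAt_id z).const_mul c).const_sub 1
  refine (h1.fun_inv h).congr_deriv ?_
  rw [neg_neg, inv_pow, div_eq_mul_inv]

/-- The square root of `1 + η - |z|²`. -/
noncomputable def rootX (η : ℝ) (z : ℂ) : ℝ := √(1 + η - normSq z)

theorem hasW_rootX {η : ℝ} {z : ℂ} (h : 0 < 1 + η - normSq z) :
    HasW (fun z => (rootX η z : ℂ)) (-conj z / (2 * rootX η z)) (-z / (2 * rootX η z)) z := by
  have h1 : HasDerivAt (fun t : ℝ => √(1 + η - t)) (-1 / (2 * √(1 + η - normSq z))) (normSq z) :=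
    ((hasDerivAt_id (normSq z)).const_sub (1 + η)).sqrt h.ne'
  refine (hasW_normSq (χ := fun t => √(1 + η - t)) h1 (hasDerivAt_id z)).congr_coeff ?_ ?_
  · simp only [rootX, id]; push_cast; ring
  · simp only [rootX, id]; push_cast; simp; ring

/-- The weight potential attached to one point `p`. -/
noncomputable def wgt (η : ℝ) (p z : ℂ) : ℝ :=
  96 * (normSq ((z - p) * (1 - conj p * z)⁻¹) - 1) -
    (1 - normSq p) ^ 3 * √(1 - normSq p) * (rootX η z * normSq ((1 - conj p * z)⁻¹ ^ 2))

noncomputable def wgtB (η : ℝ) (p z : ℂ) : ℂ :=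
  96 * ((z - p) * (1 - conj p * z)⁻¹ * conj ((1 - normSq p : ℝ) * (1 - conj p * z)⁻¹ ^ 2)) -
    ((1 - normSq p) ^ 3 * √(1 - normSq p) : ℝ) *
      (-z / (2 * rootX η z) * ((1 - conj p * z)⁻¹ ^ 2 * conj ((1 - conj p * z)⁻¹ ^ 2)) +
        rootX η z * ((1 - conj p * z)⁻¹ ^ 2 * conj (2 * conj p * (1 - conj p * z)⁻¹ ^ 3)))

noncomputable def wgtQ (η : ℝ) (p z : ℂ) : ℝ :=
  96 * normSq ((1 - normSq p : ℝ) * (1 - conj p * z)⁻¹ ^ 2) +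
    (1 - normSq p) ^ 3 * √(1 - normSq p) *
      ((1 / (2 * rootX η z) + normSq z / (4 * rootX η z ^ 3)) * normSq ((1 - conj p * z)⁻¹ ^ 2) +
        (conj z * ((1 - conj p * z)⁻¹ ^ 2 * conj (2 * conj p * (1 - conj p * z)⁻¹ ^ 3))).re /
          rootX η z - rootX η z * normSq (2 * conj p * (1 - conj p * z)⁻¹ ^ 3))

noncomputable def wgtE (η : ℝ) (p z : ℂ) : ℂ :=
  96 * ((z - p) * (1 - conj p * z)⁻¹ *
      conj (2 * conj p * (1 - normSq p : ℝ) * (1 - conj p * z)⁻¹ ^ 3)) -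
    ((1 - normSq p) ^ 3 * √(1 - normSq p) : ℝ) *
      (-z ^ 2 / (4 * rootX η z ^ 3) * ((1 - conj p * z)⁻¹ ^ 2 * conj ((1 - conj p * z)⁻¹ ^ 2)) +
        -z / rootX η z * ((1 - conj p * z)⁻¹ ^ 2 * conj (2 * conj p * (1 - conj p * z)⁻¹ ^ 3)) +
        rootX η z * ((1 - conj p * z)⁻¹ ^ 2 * conj (6 * conj p ^ 2 * (1 - conj p * z)⁻¹ ^ 4)))

section
variable {η : ℝ} {p z : ℂ}

theorem hasDerivAt_moeb_inv (h : 1 - conj p * z ≠ 0) :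
    HasDerivAt (fun z => (z - p) * (1 - conj p * z)⁻¹)
      ((1 - normSq p : ℝ) * (1 - conj p * z)⁻¹ ^ 2) z := by
  refine (((hasDerivAt_id z).sub_const p).fun_mul (hasDerivAt_inv_den h)).congr_deriv ?_
  rw [ofReal_sub, normSq_eq_conj_mul_self, id]
  generalize conj p = c at *
  field_simp
  push_cast
  ring

theorem hasDerivAt_den_pow (h : 1 - conj p * z ≠ 0) (n : ℕ) :
    HasDerivAt (fun z => (1 - conj p * z)⁻¹ ^ (n + 1))
      ((n + 1) * conj p * (1 - conj p * z)⁻¹ ^ (n + 2)) z := by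
  refine ((hasDerivAt_inv_den h).fun_pow (n + 1)).congr_deriv ?_
  generalize (1 - conj p * z)⁻¹ = φ
  push_cast
  ring

theorem hasW_wgt (h : 1 - conj p * z ≠ 0) (hX : 0 < 1 + η - normSq z) :
    HasW (fun z => (wgt η p z : ℂ)) (conj (wgtB η p z)) (wgtB η p z) z := by
  have hb := hasW_of_hasDerivAt (hasDerivAt_moeb_inv h)
  have hq := hasW_of_hasDerivAt (hasDerivAt_den_pow h 1)
  have hS := hasW_rootX hX
  have h1 := ((hasW_const 96 z).mul ((hb.mul hb.conj).sub (hasW_const 1 z))).sub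
    ((hasW_const ((1 - normSq p) ^ 3 * √(1 - normSq p) : ℝ) z).mul (hS.mul (hq.mul hq.conj)))
  have h2 : HasW (fun z => (wgt η p z : ℂ)) _ (wgtB η p z) z :=
    (h1.congr (Eventually.of_forall fun w => ?_)).congr_coeff rfl ?_
  · have := h2.conj_real
    rwa [this] at h2
  · simp only [wgt, mul_conj]
    push_cast
    ring
  · simp only [wgtB]
    norm_num

theorem hasW_wgtB (h : 1 - conj p * z ≠ 0) (hX : 0 < 1 + η - normSq z) :
    HasW (fun z => wgtB η p z) (wgtQ η p z) (wgtE η p z) z := by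
  have hS0 : (rootX η z : ℂ) ≠ 0 := ofReal_ne_zero.2 (Real.sqrt_pos.2 hX).ne'
  have hb := hasW_of_hasDerivAt (hasDerivAt_moeb_inv h)
  have hq := hasW_of_hasDerivAt (hasDerivAt_den_pow h 1)
  have hq3 := (hasW_const 2 z).mul (hasW_of_hasDerivAt (hasDerivAt_den_pow h 2))
  have hS := hasW_rootX hX
  have hT := (hasW_id z).neg.div ((hasW_const 2 z).mul hS) (mul_ne_zero two_ne_zero hS0)
  have h1 := ((hasW_const 96 z).mul (hb.mul ((hasW_const ((1 - normSq p : ℝ) : ℂ) z).mul hq).conj)).sub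
    ((hasW_const ((1 - normSq p) ^ 3 * √(1 - normSq p) : ℝ) z).mul ((hT.mul (hq.mul hq.conj)).add
      (hS.mul (hq.mul ((hasW_const (2 * conj p) z).mul (hasW_of_hasDerivAt (hasDerivAt_den_pow h 2))).conj))))
  refine (h1.congr (Eventually.of_forall fun w => ?_)).congr_coeff ?_ ?_
  · simp only [wgtB]
  · simp only [wgtQ]
    push_cast
    simp only [re_eq_add_conj, ← mul_conj]
    clear hb hq hq3 hS hT h1
    generalize (1 - conj p * z)⁻¹ = φ
    generalize (rootX η z : ℂ) = S at *
    generalize (√(1 - normSq p) : ℂ) = s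
    simp only [map_mul, map_pow, map_add, map_sub, map_one, map_zero, map_ofNat, conj_conj]
    generalize conj φ = ψ, conj z = z', conj p = c
    norm_num
    field_simp
    ring
  · simp only [wgtE]
    clear hb hq hq3 hS hT h1
    push_cast
    generalize (1 - conj p * z)⁻¹ = φ
    generalize (rootX η z : ℂ) = S at *
    generalize (√(1 - normSq p) : ℂ) = s
    simp only [map_mul, map_pow, map_add, map_sub, map_one, map_zero, map_ofNat, conj_conj]
    generalize conj φ = ψ, conj z = z', conj p = c
    norm_num
    field_simp
    ring

theorem boxKer_le_wgtQ (hη : 0 ≤ η) (hp : ‖p‖ < 1) (hz : ‖z‖ ≤ 1) (hX : 0 < 1 + η - normSq z)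
    (hXd : 1 + η - normSq z ≤ 3 * ‖1 - conj p * z‖) :
    boxKer p z / (8 * rootX η z ^ 3) ≤ wgtQ η p z := by
  have hS0 : 0 < rootX η z := Real.sqrt_pos.2 hX
  have hS2 : rootX η z ^ 2 = 1 + η - normSq z := Real.sq_sqrt hX.le
  have hy : 0 < 1 - normSq p := by rw [normSq_eq_norm_sq]; nlinarith [norm_nonneg p]
  have hyd := one_sub_normSq_le p z hz
  have hd : 0 < ‖1 - conj p * z‖ := norm_pos_iff.2 (one_sub_conj_mul_ne_zero hp hz)
  have hre : -(‖z‖ * (2 * ‖p‖ * ‖(1 - conj p * z)⁻¹‖ ^ 5)) ≤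
      (conj z * ((1 - conj p * z)⁻¹ ^ 2 * conj (2 * conj p * (1 - conj p * z)⁻¹ ^ 3))).re := by
    refine le_trans (le_of_eq ?_) (neg_le_of_abs_le (abs_re_le_norm _))
    simp only [norm_mul, norm_pow, RCLike.norm_conj, norm_ofNat, neg_inj]
    ring
  unfold wgtQ boxKer
  have hN : ‖(1 - conj p * z)⁻¹‖ = 1 / ‖1 - conj p * z‖ := by rw [norm_inv, one_div]
  set R := (conj z * ((1 - conj p * z)⁻¹ ^ 2 * conj (2 * conj p * (1 - conj p * z)⁻¹ ^ 3))).re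
  simp only [normSq_eq_norm_sq, norm_mul, norm_pow, RCLike.norm_conj, norm_ofNat, norm_real,
    hN, Real.norm_eq_abs, sq_abs, mul_pow] at *
  set d := ‖1 - conj p * z‖
  set S := rootX η z
  set r := ‖z‖
  set P := ‖p‖
  set s := √(1 - P ^ 2)
  set y := 1 - P ^ 2
  have hs0 : 0 ≤ s := Real.sqrt_nonneg _
  have hs2 : s ^ 2 = y := Real.sq_sqrt hy.le
  have hP : P ^ 2 ≤ 1 := by nlinarith [norm_nonneg p]
  have h1 : S * s ≤ 4 * d := by
    refine abs_le_of_sq_le_sq' ?_ (by positivity) |>.2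
    rw [mul_pow, hs2, hS2]
    nlinarith
  have h2 : S * y * s ≤ 8 * d ^ 2 := by
    calc S * y * s = (S * s) * y := by ring
      _ ≤ (4 * d) * (2 * d) := by gcongr
      _ = _ := by ring
  have h3 : 12 * S * (y ^ 3 * s) / d ^ 6 ≤ 96 * y ^ 2 / d ^ 4 := by
    calc _ = 12 * y ^ 2 / d ^ 6 * (S * y * s) := by ring
      _ ≤ 12 * y ^ 2 / d ^ 6 * (8 * d ^ 2) := by gcongr
      _ = _ := by field_simp; norm_num
  have h4 : 1 / (8 * S ^ 3) * (1 / d ^ 4) - 12 * S / d ^ 6 ≤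
      (1 / (2 * S) + r ^ 2 / (4 * S ^ 3)) * (1 / d ^ 4) + R / S - S * (4 * P ^ 2 * (1 / d ^ 6)) := by
    have h5 : -(r * (2 * P * (1 / d) ^ 5)) / S ≤ R / S := by gcongr
    have h6 : 0 ≤ (r * d - 8 * S ^ 2 * P) ^ 2 / (8 * S ^ 3 * d ^ 6) := by positivity
    have h7 : 0 ≤ (4 * S ^ 2 + r ^ 2 - 1) / (8 * S ^ 3 * d ^ 4) := by
      refine div_nonneg ?_ (by positivity)
      rw [hS2]; nlinarith
    have h8 : 0 ≤ 12 * S * (1 - P ^ 2) / d ^ 6 := by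
      refine div_nonneg (mul_nonneg (by positivity) hy.le) (by positivity)
    have h9 : (1 / (2 * S) + r ^ 2 / (4 * S ^ 3)) * (1 / d ^ 4) - (r * (2 * P * (1 / d) ^ 5)) / S -
        S * (4 * P ^ 2 * (1 / d ^ 6)) - (1 / (8 * S ^ 3) * (1 / d ^ 4) - 12 * S / d ^ 6) =
        (r * d - 8 * S ^ 2 * P) ^ 2 / (8 * S ^ 3 * d ^ 6) +
        (4 * S ^ 2 + r ^ 2 - 1) / (8 * S ^ 3 * d ^ 4) + 12 * S * (1 - P ^ 2) / d ^ 6 := by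
      field_simp
      ring
    rw [neg_div] at h5
    linarith
  have hw : 0 ≤ y ^ 3 * s := by positivity
  calc y ^ 3 * s / d ^ 4 / (8 * S ^ 3)
      = y ^ 3 * s * (1 / (8 * S ^ 3) * (1 / d ^ 4) - 12 * S / d ^ 6) +
        12 * S * (y ^ 3 * s) / d ^ 6 := by field_simp; ring
    _ ≤ y ^ 3 * s * ((1 / (2 * S) + r ^ 2 / (4 * S ^ 3)) * (1 / d ^ 4) + R / S -
        S * (4 * P ^ 2 * (1 / d ^ 6))) + 96 * y ^ 2 / d ^ 4 := by gcongr
    _ = _ := by field_simp; ring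
end

theorem wgt_eq {η : ℝ} {p z : ℂ} : wgt η p z =
    -(96 * (1 - normSq (moeb p z)) + rootX η z * boxKer p z) := by
  have h : normSq ((1 - conj p * z)⁻¹ ^ 2) = 1 / ‖1 - conj p * z‖ ^ 4 := by
    rw [normSq_eq_norm_sq, norm_pow, norm_inv, inv_pow, inv_pow, ← pow_mul, one_div]
  rw [wgt, h, ← div_eq_mul_inv, ← moeb, boxKer]
  ring

section
variable {μ : Measure ℂ} [IsFiniteMeasure μ] {ρ η K τ : ℝ} {β : ℂ → ℝ} {h : ℂ → ℂ}

theorem measurable_boxKer (z : ℂ) : Measurable fun p => boxKer p z := by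
  have := continuous_conj
  unfold boxKer
  fun_prop

theorem embedding_aux (hρ : ρ < 1) (hμ : ∀ᵐ p ∂μ, ‖p‖ ≤ ρ)
    (hK : ∀ w ∈ ball (0 : ℂ) 1, ∫ p, (1 - normSq (moeb p w)) ∂μ ≤ K)
    (hβ : ContinuousOn β (closedBall 0 1))
    (hβB : ∀ z ∈ ball (0 : ℂ) 1, β z * √(1 - normSq z) ≤ ∫ p, boxKer p z ∂μ)
    (hh : Differentiable ℂ h) (hτ : 0 < τ) (hη : 0 < η) (hη1 : η ≤ 1 - ρ) (hρ0 : 0 ≤ ρ) :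
    ∫ z in ball (0 : ℂ) 1, (√(1 - normSq z) / rootX η z) ^ 3 * (β z * ‖h z‖) ≤
      4 * Real.exp (2016 * K) * ∫ θ in (0:ℝ)..2 * π, √(normSq (h (cexp (θ * I))) + τ) := by
  have hcc := continuous_conj
  have hcm := continuous_conj.measurable
  have hμ1 : ∀ᵐ p ∂μ, ‖p‖ < 1 := hμ.mono fun p hp => hp.trans_lt hρ
  have hX : ∀ z ∈ closedBall (0 : ℂ) 1, 0 < 1 + η - normSq z := fun z hz => by
    rw [normSq_eq_norm_sq]; nlinarith [mem_closedBall_zero_iff.1 hz, norm_nonneg z]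
  have hXd : ∀ z ∈ closedBall (0 : ℂ) 1, ∀ p, ‖p‖ ≤ ρ →
      1 + η - normSq z ≤ 3 * ‖1 - conj p * z‖ := fun z hz p hp => by
    have hz := mem_closedBall_zero_iff.1 hz
    have h1 : 1 - ‖p‖ * ‖z‖ ≤ ‖1 - conj p * z‖ := by
      simpa [norm_mul] using norm_sub_norm_le (1 : ℂ) (conj p * z)
    have h2 : ‖p‖ * ‖z‖ ≤ ρ * ‖z‖ := by gcongr
    have h3 : ρ * ‖z‖ ≤ ρ := mul_le_of_le_one_right hρ0 hz
    have h4 : ρ * ‖z‖ ≤ ‖z‖ := mul_le_of_le_one_left (norm_nonneg z) hρ.le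
    rw [normSq_eq_norm_sq]
    nlinarith [sq_nonneg (1 - ‖z‖)]
  have hne : ∀ z ∈ closedBall (0 : ℂ) 1, ∀ p, ‖p‖ ≤ ρ → 1 - conj p * z ≠ 0 := fun z hz p hp =>
    one_sub_conj_mul_ne_zero (hp.trans_lt hρ) (mem_closedBall_zero_iff.1 hz)
  set S := closedBall (0 : ℂ) 1 ×ˢ closedBall (0 : ℂ) ρ with hS
  have hφ : ContinuousOn (fun x : ℂ × ℂ => (1 - conj x.2 * x.1)⁻¹) S :=
    ContinuousOn.inv₀ (by fun_prop) fun x hx => hne x.1 hx.1 x.2 (mem_closedBall_zero_iff.1 hx.2)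
  have hr : ContinuousOn (fun x : ℂ × ℂ => rootX η x.1) S := by unfold rootX; fun_prop
  have hr0 : ∀ x ∈ S, rootX η x.1 ≠ 0 := fun x hx => (Real.sqrt_pos.2 (hX x.1 hx.1)).ne'
  have hri : ContinuousOn (fun x : ℂ × ℂ => (rootX η x.1)⁻¹) S := hr.inv₀ hr0
  have hric : ContinuousOn (fun x : ℂ × ℂ => ((rootX η x.1)⁻¹ : ℂ)) S := by
    simpa [Function.comp_def] using continuous_ofReal.comp_continuousOn hri
  have cF : ContinuousOn (fun x : ℂ × ℂ => (wgt η x.2 x.1 : ℂ)) S := by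
    unfold wgt; fun_prop
  have cB : ContinuousOn (fun x : ℂ × ℂ => wgtB η x.2 x.1) S := by
    unfold wgtB; simp only [div_eq_mul_inv, mul_inv]; fun_prop
  have cQ : ContinuousOn (fun x : ℂ × ℂ => (wgtQ η x.2 x.1 : ℂ)) S := by
    unfold wgtQ; simp only [div_eq_mul_inv, mul_inv, ← inv_pow]; fun_prop
  have cE : ContinuousOn (fun x : ℂ × ℂ => wgtE η x.2 x.1) S := by
    unfold wgtE; simp only [div_eq_mul_inv, mul_inv, ← inv_pow]; fun_prop
  have mF : ∀ z, Measurable fun p => (wgt η p z : ℂ) := fun z => by unfold wgt; fun_prop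
  have mB : ∀ z, Measurable fun p => wgtB η p z := fun z => by unfold wgtB; fun_prop
  have mQ : ∀ z, Measurable fun p => (wgtQ η p z : ℂ) := fun z => by
    unfold wgtQ
    have := measurable_re
    fun_prop
  have mE : ∀ z, Measurable fun p => wgtE η p z := fun z => by unfold wgtE; fun_prop
  have mC : ∀ z, Measurable fun p => conj (wgtB η p z) := fun z => hcm.comp (mB z)
  have cC : ContinuousOn (fun x : ℂ × ℂ => conj (wgtB η x.2 x.1)) S := hcc.comp_continuousOn cB
  have hWV : ∀ z ∈ ball (0 : ℂ) 1, HasW (fun z => ((∫ p, wgt η p z ∂μ : ℝ) : ℂ))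
      (conj (∫ p, wgtB η p z ∂μ)) (∫ p, wgtB η p z ∂μ) z := fun z hz => by
    have := hasW_integral_param (F := fun z p => (wgt η p z : ℂ)) hμ mF mC mB cF cC cB
      (fun z hz p hp => hasW_wgt (hne z hz p hp) (hX z hz)) hz
    simpa only [integral_complex_ofReal, integral_conj] using this
  have hWB : ∀ z ∈ ball (0 : ℂ) 1, HasW (fun z => ∫ p, wgtB η p z ∂μ)
      ((∫ p, wgtQ η p z ∂μ : ℝ) : ℂ) (∫ p, wgtE η p z ∂μ) z := fun z hz => by
    have := hasW_integral_param (F := fun z p => wgtB η p z) hμ mB mQ mE cB cQ cE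
      (fun z hz p hp => hasW_wgtB (hne z hz p hp) (hX z hz)) hz
    simpa only [integral_complex_ofReal] using this
  have hVc : ContinuousOn (fun z => ∫ p, wgt η p z ∂μ) (closedBall 0 1) := by
    have := continuous_re.comp_continuousOn (integral_param hμ mF cF).2.2
    simpa [Function.comp_def, integral_complex_ofReal] using this
  have hQc : ContinuousOn (fun z => ∫ p, wgtQ η p z ∂μ) (closedBall 0 1) := by
    have := continuous_re.comp_continuousOn (integral_param hμ mQ cQ).2.2
    simpa [Function.comp_def, integral_complex_ofReal] using this
  have hQi : ∀ z ∈ closedBall (0 : ℂ) 1, Integrable (fun p => wgtQ η p z) μ := fun z hz => by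
    simpa using ((integral_param hμ mQ cQ).2.1 z hz).re
  have hki : ∀ z ∈ closedBall (0 : ℂ) 1, Integrable (fun p => boxKer p z) μ := fun z hz => by
    have : ContinuousOn (fun x : ℂ × ℂ => (boxKer x.2 x.1 : ℂ)) S := by
      have : (fun x : ℂ × ℂ => (boxKer x.2 x.1 : ℂ)) = fun x => (((1 - normSq x.2) ^ 3 *
          √(1 - normSq x.2) * ‖(1 - conj x.2 * x.1)⁻¹‖ ^ 4 : ℝ) : ℂ) := by
        funext x; rw [boxKer, norm_inv, inv_pow, div_eq_mul_inv]
      rw [this]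
      fun_prop
    have h2 := (integral_param (F := fun z p => (boxKer p z : ℂ)) hμ
      (fun z => measurable_ofReal.comp (measurable_boxKer z)) this).2.1 z hz
    simpa using h2.re
  have hS0 : ∀ z ∈ closedBall (0 : ℂ) 1, 0 < rootX η z := fun z hz => Real.sqrt_pos.2 (hX z hz)
  have hQ1 : ∀ z ∈ closedBall (0 : ℂ) 1,
      (∫ p, boxKer p z ∂μ) / (8 * rootX η z ^ 3) ≤ ∫ p, wgtQ η p z ∂μ := fun z hz => by
    rw [← integral_div]
    exact integral_mono_ae ((hki z hz).div_const _) (hQi z hz) (hμ.mono fun p hp =>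
      boxKer_le_wgtQ hη.le (hp.trans_lt hρ) (mem_closedBall_zero_iff.1 hz) (hX z hz)
        (hXd z hz p hp))
  have hk0 : ∀ z, 0 ≤ ∫ p, boxKer p z ∂μ := fun z =>
    integral_nonneg_of_ae (hμ1.mono fun p hp => boxKer_nonneg hp z)
  have hV : ∀ z ∈ closedBall (0 : ℂ) 1, ∫ p, wgt η p z ∂μ =
      -(96 * ∫ p, (1 - normSq (moeb p z)) ∂μ + rootX η z * ∫ p, boxKer p z ∂μ) := fun z hz => by
    simp only [wgt_eq]
    rw [integral_neg, integral_add ((integrable_one_sub_normSq_moeb hμ1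
      (mem_closedBall_zero_iff.1 hz)).const_mul _) ((hki z hz).const_mul _), integral_const_mul,
      integral_const_mul]
  have hK0 : 0 ≤ K := le_trans (integral_nonneg_of_ae (hμ1.mono fun p hp =>
    one_sub_normSq_moeb_nonneg hp (by simp))) (hK 0 (mem_ball_self one_pos))
  have hm0 : ∀ z ∈ closedBall (0 : ℂ) 1, 0 ≤ ∫ p, (1 - normSq (moeb p z)) ∂μ := fun z hz =>
    integral_nonneg_of_ae (hμ1.mono fun p hp =>
      one_sub_normSq_moeb_nonneg hp (mem_closedBall_zero_iff.1 hz))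
  have hm1 : ∀ z ∈ closedBall (0 : ℂ) 1, ∫ p, (1 - normSq (moeb p z)) ∂μ ≤ K := fun z hz => by
    rcases (mem_closedBall_zero_iff.1 hz).lt_or_eq with h1 | h1
    · exact hK z (mem_ball_zero_iff.2 h1)
    · rw [integral_eq_zero_of_ae]
      · exact hK0
      · refine hμ1.mono fun p hp => ?_
        simp only [Pi.zero_apply]
        rw [one_sub_normSq_moeb hp h1.le, normSq_eq_norm_sq z, h1]
        simp
  have hmain := uchiyama_weight (B := 2016 * K) hτ hh hVc (integral_param hμ mB cB).2.2 hQc hWV hWB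
    (fun z hz => le_trans (div_nonneg (hk0 z) (by have := hS0 z (ball_subset_closedBall hz); positivity))
      (hQ1 z (ball_subset_closedBall hz)))
    (fun z hz => by
      rw [hV z hz]
      have := hm0 z hz
      have := mul_nonneg (hS0 z hz).le (hk0 z)
      linarith)
    (fun z hz => by
      rw [hV z hz]
      have := hm1 z hz
      have : rootX η z * ∫ p, boxKer p z ∂μ ≤ 1920 * K :=
        integral_boxKer_le hμ1 hK hz (hX z hz) (by linarith [normSq_nonneg z])
          (hμ.mono fun p hp => hXd z hz p hp)
      linarith)
  have hhc := hh.continuous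
  have hrc : ContinuousOn (fun z => rootX η z) (closedBall 0 1) := by unfold rootX; fun_prop
  have key : ∫ z in ball (0 : ℂ) 1, (√(1 - normSq z) / rootX η z) ^ 3 * (β z * ‖h z‖) ≤
      ∫ z in ball (0 : ℂ) 1, 8 * ((1 - normSq z) *
        ((∫ p, wgtQ η p z ∂μ) * √(normSq (h z) + τ))) := by
    refine setIntegral_mono_on (integrableOn_ball_of_continuousOn ?_)
      (integrableOn_ball_of_continuousOn ?_) measurableSet_ball fun z hz => ?_
    · exact ((ContinuousOn.div (by fun_prop) hrc fun z hz => (hS0 z hz).ne').pow 3).mul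
        (hβ.mul (by fun_prop))
    · exact continuousOn_const.mul (ContinuousOn.mul (by fun_prop) (hQc.mul (by fun_prop)))
    · have hz' := ball_subset_closedBall hz
      have h0 := one_sub_normSq_nonneg hz
      have h1 := hQ1 z hz'
      have h2 := hβB z hz
      have h3 := hS0 z hz'
      have h4 : ‖h z‖ ≤ √(normSq (h z) + τ) := by
        rw [normSq_eq_norm_sq]
        exact Real.le_sqrt_of_sq_le (by linarith)
      have h5 : √(1 - normSq z) ^ 2 = 1 - normSq z := Real.sq_sqrt h0
      calc (√(1 - normSq z) / rootX η z) ^ 3 * (β z * ‖h z‖)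
          = 8 * (√(1 - normSq z) ^ 2 * ((β z * √(1 - normSq z)) / (8 * rootX η z ^ 3) * ‖h z‖)) := by
            field_simp
        _ ≤ 8 * (√(1 - normSq z) ^ 2 * ((∫ p, wgtQ η p z ∂μ) * √(normSq (h z) + τ))) := by
            have h6 : (β z * √(1 - normSq z)) / (8 * rootX η z ^ 3) ≤ ∫ p, wgtQ η p z ∂μ :=
              le_trans (by gcongr) h1
            have h7 : 0 ≤ ∫ p, wgtQ η p z ∂μ := le_trans (div_nonneg (hk0 z) (by positivity)) h1
            gcongr
        _ = _ := by rw [h5]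
  rw [integral_const_mul] at key
  calc _ ≤ _ := key
    _ ≤ 8 * _ := mul_le_mul_of_nonneg_left hmain (by norm_num)
    _ = _ := by ring

theorem embedding (hρ : ρ < 1) (hρ0 : 0 ≤ ρ) (hμ : ∀ᵐ p ∂μ, ‖p‖ ≤ ρ)
    (hK : ∀ w ∈ ball (0 : ℂ) 1, ∫ p, (1 - normSq (moeb p w)) ∂μ ≤ K)
    (hβ : ContinuousOn β (closedBall 0 1))
    (hβB : ∀ z ∈ ball (0 : ℂ) 1, β z * √(1 - normSq z) ≤ ∫ p, boxKer p z ∂μ)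
    (hh : Differentiable ℂ h) :
    ∫ z in ball (0 : ℂ) 1, β z * ‖h z‖ ≤
      4 * Real.exp (2016 * K) * ∫ θ in (0:ℝ)..2 * π, ‖h (cexp (θ * I))‖ := by
  have hhc := hh.continuous
  refine le_of_sqrt_limit hhc (by positivity) fun τ hτ => ?_
  have hlim : Tendsto (fun η : ℝ => ∫ z in ball (0 : ℂ) 1,
      (√(1 - normSq z) / rootX η z) ^ 3 * (β z * ‖h z‖)) (𝓝[>] 0)
      (𝓝 (∫ z in ball (0 : ℂ) 1, β z * ‖h z‖)) := by
    have hint : IntegrableOn (fun z => β z * ‖h z‖) (ball (0 : ℂ) 1) :=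
      integrableOn_ball_of_continuousOn (hβ.mul (by fun_prop))
    refine tendsto_integral_filter_of_dominated_convergence (fun z => ‖β z * ‖h z‖‖) ?_ ?_
      hint.norm ?_
    · refine Eventually.of_forall fun η => AEStronglyMeasurable.mul ?_ hint.aestronglyMeasurable
      refine Measurable.aestronglyMeasurable ?_
      unfold rootX
      have := continuous_normSq.measurable
      fun_prop
    · refine eventually_mem_nhdsWithin.mono fun η hη => ?_
      filter_upwards [ae_restrict_mem measurableSet_ball] with z hz
      rw [norm_mul]
      refine mul_le_of_le_one_left (norm_nonneg _) ?_
      have h0 := one_sub_normSq_nonneg hz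
      rw [norm_pow, rootX, Real.norm_of_nonneg (div_nonneg (Real.sqrt_nonneg _) (Real.sqrt_nonneg _))]
      refine pow_le_one₀ (div_nonneg (Real.sqrt_nonneg _) (Real.sqrt_nonneg _))
        (div_le_one_of_le₀ (Real.sqrt_le_sqrt ?_) (Real.sqrt_nonneg _))
      have : (0 : ℝ) < η := hη
      linarith
    · filter_upwards [ae_restrict_mem measurableSet_ball] with z hz
      have h0 : 0 < 1 - normSq z := by
        rw [normSq_eq_norm_sq]; nlinarith [mem_ball_zero_iff.1 hz, norm_nonneg z]
      have h1 : √(1 - normSq z) ≠ 0 := (Real.sqrt_pos.2 h0).ne'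
      have h2 : Continuous fun η : ℝ => rootX η z := by unfold rootX; fun_prop
      have h3 : rootX 0 z = √(1 - normSq z) := by rw [rootX, add_zero]
      have h4 : Tendsto (fun η : ℝ => (√(1 - normSq z) / rootX η z) ^ 3 * (β z * ‖h z‖)) (𝓝 0)
          (𝓝 ((√(1 - normSq z) / rootX 0 z) ^ 3 * (β z * ‖h z‖))) :=
        ((tendsto_const_nhds.div h2.continuousAt (by simpa only [h3] using h1)).pow 3).mul_const _
      rw [h3, div_self h1, one_pow, one_mul] at h4
      exact h4.mono_left nhdsWithin_le_nhds
  refine le_of_tendsto hlim ?_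
  filter_upwards [eventually_mem_nhdsWithin, nhdsWithin_le_nhds (Iic_mem_nhds (sub_pos.2 hρ))]
    with η h1 h2
  exact embedding_aux hρ hμ hK hβ hβB hh hτ h1 h2 hρ0
end

/-- The points whose dilation by `ρ` does not move them hyperbolically far from the boundary. -/
def deepSet (ρ : ℝ) : Set ℂ := {a | a ∈ ball (0 : ℂ) 1 ∧ 1 - normSq (ρ * a) ≤ 4 * (1 - normSq a)}

theorem measurableSet_deepSet (ρ : ℝ) : MeasurableSet (deepSet ρ) := by
  have : deepSet ρ = ball 0 1 ∩ {a | 1 - normSq (ρ * a) ≤ 4 * (1 - normSq a)} := rfl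
  rw [this]
  refine measurableSet_ball.inter (measurableSet_le ?_ ?_)
  · exact (by fun_prop : Continuous fun a : ℂ => 1 - normSq (ρ * a)).measurable
  · exact (by fun_prop : Continuous fun a : ℂ => 4 * (1 - normSq a)).measurable

theorem ker_mul_sqrt_le {ρ : ℝ} (hρ0 : 0 < ρ) (hρ : ρ < 1) {a z : ℂ} (ha : ‖a‖ < 1)
    (hz : ‖z‖ ≤ 1) : ker a (ρ * z) * √(1 - normSq z) ≤ 8 * boxKer (ρ * a) z := by
  have hρa : ‖(ρ : ℂ) * a‖ < 1 := by
    rw [norm_mul, norm_real, Real.norm_of_nonneg hρ0.le]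
    nlinarith [norm_nonneg a]
  have hden : conj a * (ρ * z) = conj (ρ * a) * z := by rw [map_mul, conj_ofReal]; ring
  have hd : 0 < ‖1 - conj (ρ * a) * z‖ := norm_pos_iff.2 (one_sub_conj_mul_ne_zero hρa hz)
  have hy' : 1 - ‖a‖ ^ 2 ≤ 1 - normSq (ρ * a) := by
    rw [normSq_eq_norm_sq, norm_mul, norm_real, Real.norm_of_nonneg hρ0.le, mul_pow]
    linarith [mul_le_of_le_one_left (sq_nonneg ‖a‖) (by nlinarith : ρ ^ 2 ≤ 1)]
  rw [ker, hden]
  split_ifs with h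
  · have hx : 1 - normSq z ≤ 2 * ‖1 - conj (ρ * a) * z‖ := by
      have := one_sub_normSq_le z (ρ * a) hρa.le
      rwa [← norm_conj, map_sub, map_one, map_mul, conj_conj, mul_comm z] at this
    rw [boxKer]
    set d := ‖1 - conj (ρ * a) * z‖
    set y := 1 - normSq (ρ * a)
    have hy0 : 0 < y := by linarith
    have h1 : √(1 - normSq z) ≤ 2 * √y := by
      rw [Real.sqrt_le_iff]
      refine ⟨by positivity, ?_⟩
      rw [mul_pow, Real.sq_sqrt hy0.le]; linarith
    have h2 : d ^ 2 ≤ 4 * y ^ 2 := by nlinarith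
    calc (1 - ‖a‖ ^ 2) / d ^ 2 * √(1 - normSq z) ≤ y / d ^ 2 * (2 * √y) := by gcongr
      _ = 2 * (y * √y) / d ^ 4 * d ^ 2 := by field_simp
      _ ≤ 2 * (y * √y) / d ^ 4 * (4 * y ^ 2) := by gcongr
      _ = _ := by ring
  · rw [zero_mul]
    exact mul_nonneg (by norm_num) (boxKer_nonneg hρa z)

theorem ker_eq_zero_of_not_deep {ρ : ℝ} {a z : ℂ} (ha : ‖a‖ < 1)
    (hz : ‖z‖ ≤ 1) (h : a ∉ deepSet ρ) : ker a (ρ * z) = 0 := by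
  rw [ker, if_neg]
  intro h1
  refine h ⟨mem_ball_zero_iff.2 ha, ?_⟩
  have hden : conj a * (ρ * z) = conj (ρ * a) * z := by rw [map_mul, conj_ofReal]; ring
  rw [hden] at h1
  have := one_sub_normSq_le (ρ * a) z hz
  rw [normSq_eq_norm_sq a]
  linarith

theorem embedding_ker {κ : ℂ → ℝ} {b h : ℂ → ℂ} {K ρ : ℝ} (hρ0 : 0 < ρ) (hρ : ρ < 1)
    (hκ : ContinuousOn κ (closedBall 0 1)) (hκ0 : ∀ z, 0 ≤ κ z) (hK0 : 0 ≤ K)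
    (hK : ∀ w ∈ ball (0 : ℂ) 1, ∫ z in ball (0 : ℂ) 1, κ z * (1 - normSq (moeb z w)) ≤ K)
    (hb : ContinuousOn b (ball 0 1))
    (hbK : ∀ z ∈ ball (0 : ℂ) 1, ‖b z‖ ≤ K * ∫ x in ball (0 : ℂ) 1, κ x * ker x z)
    (hh : Differentiable ℂ h) :
    ∫ z in ball (0 : ℂ) 1, ‖b (ρ * z)‖ * ‖h z‖ ≤
      32 * (K + 1) * Real.exp (8064 * K) * ∫ θ in (0:ℝ)..2 * π, ‖h (cexp (θ * I))‖ := by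
  have hsub : deepSet ρ ⊆ ball 0 1 := fun a ha => ha.1
  have hE := measurableSet_deepSet ρ
  have hEm : ∀ᵐ a ∂volume.restrict (deepSet ρ), a ∈ deepSet ρ := ae_restrict_mem hE
  have hκi : IntegrableOn κ (ball 0 1) := integrableOn_ball_of_continuousOn hκ
  have hκE : Integrable κ (volume.restrict (deepSet ρ)) := hκi.mono_set hsub
  set ν := (volume.restrict (deepSet ρ)).withDensity fun a => ENNReal.ofReal (κ a) with hν
  have : IsFiniteMeasure ν := isFiniteMeasure_withDensity_ofReal hκE.2
  have hνint : ∀ F : ℂ → ℝ, ∫ a, F a ∂ν = ∫ a in deepSet ρ, κ a * F a := fun F => by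
    rw [hν, integral_withDensity_eq_integral_toReal_smul₀ hκE.aemeasurable.ennreal_ofReal
      (Eventually.of_forall fun _ => ENNReal.ofReal_lt_top)]
    simp only [ENNReal.toReal_ofReal (hκ0 _), smul_eq_mul]
  have hνE : ∀ᵐ a ∂ν, a ∈ deepSet ρ := withDensity_absolutelyContinuous _ _ hEm
  have hmul : Measurable fun a : ℂ => (ρ : ℂ) * a := by fun_prop
  have hmap : ∀ {F : ℂ → ℝ}, Measurable F →
      ∫ p, F p ∂(ν.map fun a => (ρ : ℂ) * a) = ∫ a in deepSet ρ, κ a * F (ρ * a) := fun hF => by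
    rw [integral_map hmul.aemeasurable hF.aestronglyMeasurable, hνint]
  have hnorm : ∀ a ∈ ball (0 : ℂ) 1, ‖(ρ : ℂ) * a‖ ≤ ρ := fun a ha => by
    rw [norm_mul, norm_real, Real.norm_of_nonneg hρ0.le]
    nlinarith [mem_ball_zero_iff.1 ha]
  have hμ : ∀ᵐ p ∂(ν.map fun a => (ρ : ℂ) * a), ‖p‖ ≤ ρ := by
    rw [ae_map_iff hmul.aemeasurable (measurableSet_le measurable_norm measurable_const)]
    exact hνE.mono fun a ha => hnorm a ha.1
  have hball : ∀ᵐ a ∂volume.restrict (ball (0 : ℂ) 1), a ∈ ball (0 : ℂ) 1 :=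
    ae_restrict_mem measurableSet_ball
  have hKμ : ∀ w ∈ ball (0 : ℂ) 1,
      ∫ p, (1 - normSq (moeb p w)) ∂(ν.map fun a => (ρ : ℂ) * a) ≤ 4 * K := by
    intro w hw
    have hw1 := mem_ball_zero_iff.1 hw
    have hρw : ‖(ρ : ℂ) * w‖ < 1 := (hnorm w hw).trans_lt hρ
    have hmm : Measurable fun p => 1 - normSq (moeb p w) :=
      (continuous_normSq.measurable.comp (measurable_moeb w)).const_sub 1
    have hmm' : Measurable fun p => 1 - normSq (moeb p (ρ * w)) :=
      (continuous_normSq.measurable.comp (measurable_moeb _)).const_sub 1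
    have hbig : IntegrableOn (fun a => 4 * (κ a * (1 - normSq (moeb a (ρ * w))))) (ball 0 1) := by
      refine Integrable.const_mul (hκi.mono' (hκi.aestronglyMeasurable.mul
        hmm'.aestronglyMeasurable) (hball.mono fun a ha => ?_)) _
      have h0 := one_sub_normSq_moeb_nonneg (mem_ball_zero_iff.1 ha) hρw.le
      change ‖κ a * (1 - normSq (moeb a (ρ * w)))‖ ≤ κ a
      rw [Real.norm_of_nonneg (mul_nonneg (hκ0 a) h0)]
      exact mul_le_of_le_one_right (hκ0 a) (by linarith [normSq_nonneg (moeb a (ρ * w))])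
    rw [hmap hmm]
    calc _ ≤ ∫ a in deepSet ρ, 4 * (κ a * (1 - normSq (moeb a (ρ * w)))) := by
          refine integral_mono_of_nonneg ?_ (hbig.mono_set hsub) ?_
          · exact hEm.mono fun a ha => mul_nonneg (hκ0 a)
              (one_sub_normSq_moeb_nonneg ((hnorm a ha.1).trans_lt hρ) hw1.le)
          · refine hEm.mono fun a ha => ?_
            have ha1 := mem_ball_zero_iff.1 ha.1
            have e0 : conj ((ρ : ℂ) * a) * w = conj a * (ρ * w) := by
              rw [map_mul, conj_ofReal]; ring
            have e1 : 0 < normSq (1 - conj a * (ρ * w)) :=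
              normSq_pos.2 (one_sub_conj_mul_ne_zero ha1 hρw.le)
            have e2 : 1 - normSq (moeb (ρ * a) w) ≤ 4 * (1 - normSq (moeb a (ρ * w))) := by
              rw [one_sub_normSq_moeb ((hnorm a ha.1).trans_lt hρ) hw1.le,
                one_sub_normSq_moeb ha1 hρw.le, e0, ← mul_div_assoc]
              refine div_le_div_of_nonneg_right ?_ e1.le
              have h1 := ha.2
              have h2 : 1 - normSq w ≤ 1 - normSq (ρ * w) := by
                rw [normSq_eq_norm_sq, normSq_eq_norm_sq]
                have : ‖(ρ : ℂ) * w‖ ≤ ‖w‖ := by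
                  rw [norm_mul, norm_real, Real.norm_of_nonneg hρ0.le]
                  exact mul_le_of_le_one_left (norm_nonneg w) hρ.le
                nlinarith [norm_nonneg ((ρ : ℂ) * w)]
              have h3 := one_sub_normSq_nonneg hw
              have h4 := one_sub_normSq_nonneg ha.1
              rw [← mul_assoc]
              gcongr
            calc κ a * (1 - normSq (moeb (ρ * a) w)) ≤
                κ a * (4 * (1 - normSq (moeb a (ρ * w)))) := mul_le_mul_of_nonneg_left e2 (hκ0 a)
              _ = _ := by ring
      _ ≤ ∫ a in ball (0 : ℂ) 1, 4 * (κ a * (1 - normSq (moeb a (ρ * w)))) := by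
          refine setIntegral_mono_set hbig (hball.mono fun a ha => ?_) hsub.eventuallyLE
          exact mul_nonneg (by norm_num) (mul_nonneg (hκ0 a)
            (one_sub_normSq_moeb_nonneg (mem_ball_zero_iff.1 ha) hρw.le))
      _ ≤ _ := by
          rw [integral_const_mul]
          have := hK (ρ * w) (mem_ball_zero_iff.2 hρw)
          linarith
  have hβ : ContinuousOn (fun z : ℂ => ‖b (ρ * z)‖ / (8 * (K + 1))) (closedBall 0 1) := by
    refine ContinuousOn.div_const (hb.comp (by fun_prop) fun z hz => ?_).norm _
    rw [mem_ball_zero_iff, norm_mul, norm_real, Real.norm_of_nonneg hρ0.le]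
    nlinarith [mem_closedBall_zero_iff.1 hz, norm_nonneg z]
  have hβB : ∀ z ∈ ball (0 : ℂ) 1, ‖b (ρ * z)‖ / (8 * (K + 1)) * √(1 - normSq z) ≤
      ∫ p, boxKer p z ∂(ν.map fun a => (ρ : ℂ) * a) := by
    intro z hz
    have hz1 := mem_ball_zero_iff.1 hz
    rw [hmap (measurable_boxKer z)]
    have h1 := hbK (ρ * z) (mem_ball_zero_iff.2 ((hnorm z hz).trans_lt hρ))
    have h2 : ∫ x in ball (0 : ℂ) 1, κ x * ker x (ρ * z) =
        ∫ x in deepSet ρ, κ x * ker x (ρ * z) := by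
      have := setIntegral_eq_of_subset_of_forall_sdiff_eq_zero (μ := volume)
        (f := fun x => κ x * ker x (ρ * z)) measurableSet_ball hsub ?_
      · exact this
      intro a ha
      rw [ker_eq_zero_of_not_deep (mem_ball_zero_iff.1 ha.1) hz1.le ha.2, mul_zero]
    have hint : IntegrableOn (fun a => κ a * boxKer (ρ * a) z) (deepSet ρ) := by
      refine (hκE.mul_const ((1 - ρ) ^ 4)⁻¹).mono' (hκE.aestronglyMeasurable.mul
        ((measurable_boxKer z).comp hmul).aestronglyMeasurable) (hEm.mono fun a ha => ?_)
      have hp := hnorm a ha.1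
      change ‖κ a * boxKer (ρ * a) z‖ ≤ κ a * ((1 - ρ) ^ 4)⁻¹
      rw [Real.norm_of_nonneg (mul_nonneg (hκ0 a) (boxKer_nonneg (hp.trans_lt hρ) z))]
      refine mul_le_mul_of_nonneg_left ?_ (hκ0 a)
      have e1 : 1 - ρ ≤ ‖1 - conj ((ρ : ℂ) * a) * z‖ := by
        have := norm_sub_norm_le (1 : ℂ) (conj ((ρ : ℂ) * a) * z)
        rw [norm_one, norm_mul, RCLike.norm_conj] at this
        nlinarith [norm_nonneg ((ρ : ℂ) * a), norm_nonneg z]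
      have e2 : 0 ≤ 1 - normSq ((ρ : ℂ) * a) := by
        rw [normSq_eq_norm_sq]; nlinarith [norm_nonneg ((ρ : ℂ) * a)]
      have e3 : 1 - normSq ((ρ : ℂ) * a) ≤ 1 := by linarith [normSq_nonneg ((ρ : ℂ) * a)]
      have e4 : 0 < 1 - ρ := by linarith
      rw [boxKer, inv_eq_one_div]
      refine div_le_div₀ zero_le_one ?_ (by positivity) (by gcongr)
      exact mul_le_one₀ (pow_le_one₀ e2 e3) (Real.sqrt_nonneg _) (Real.sqrt_le_one.2 e3)
    have h3 : (∫ x in deepSet ρ, κ x * ker x (ρ * z)) * √(1 - normSq z) ≤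
        8 * ∫ a in deepSet ρ, κ a * boxKer (ρ * a) z := by
      rw [← integral_mul_const, ← integral_const_mul]
      refine integral_mono_of_nonneg ?_ (hint.const_mul 8) (hEm.mono fun a ha => ?_)
      · exact hEm.mono fun a ha => mul_nonneg (mul_nonneg (hκ0 a)
          (ker_nonneg (mem_ball_zero_iff.1 ha.1).le)) (Real.sqrt_nonneg _)
      · have := mul_le_mul_of_nonneg_left
          (ker_mul_sqrt_le hρ0 hρ (mem_ball_zero_iff.1 ha.1) hz1.le) (hκ0 a)
        calc _ = κ a * (ker a (ρ * z) * √(1 - normSq z)) := by ring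
          _ ≤ _ := this
          _ = _ := by ring
    have h4 : 0 ≤ ∫ a in deepSet ρ, κ a * boxKer (ρ * a) z :=
      integral_nonneg_of_ae (hEm.mono fun a ha => mul_nonneg (hκ0 a)
        (boxKer_nonneg ((hnorm a ha.1).trans_lt hρ) z))
    rw [div_mul_eq_mul_div, div_le_iff₀ (by positivity)]
    calc ‖b (ρ * z)‖ * √(1 - normSq z)
        ≤ K * (∫ x in deepSet ρ, κ x * ker x (ρ * z)) * √(1 - normSq z) := by
          rw [h2] at h1; gcongr
      _ = K * ((∫ x in deepSet ρ, κ x * ker x (ρ * z)) * √(1 - normSq z)) := by ring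
      _ ≤ K * (8 * ∫ a in deepSet ρ, κ a * boxKer (ρ * a) z) := by gcongr
      _ ≤ _ := by nlinarith
  have := embedding hρ hρ0.le hμ hKμ hβ hβB hh
  have e : ∀ z, ‖b (ρ * z)‖ / (8 * (K + 1)) * ‖h z‖ = (8 * (K + 1))⁻¹ * (‖b (ρ * z)‖ * ‖h z‖) :=
    fun z => by ring
  simp only [e] at this
  rw [integral_const_mul, inv_mul_le_iff₀ (by positivity)] at this
  refine this.trans (le_of_eq ?_)
  rw [show 2016 * (4 * K) = 8064 * K by ring]
  ring

theorem finite_zeros {g : ℂ → ℂ} {r : ℝ} (hr : 1 < r) (hg : DifferentiableOn ℂ g (ball 0 r))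
    {w : ℂ} (hw : w ∈ ball (0 : ℂ) r) (hgw : g w ≠ 0) :
    {z ∈ closedBall (0 : ℂ) 1 | g z = 0}.Finite ∧
      ∀ a ∈ closedBall (0 : ℂ) 1, ¬ ∀ᶠ z in 𝓝 a, g z = 0 := by
  have han : AnalyticOnNhd ℂ g (ball 0 r) := hg.analyticOnNhd isOpen_ball
  have hpc : IsPreconnected (ball (0 : ℂ) r) := (convex_ball 0 r).isPreconnected
  have hsub : closedBall (0 : ℂ) 1 ⊆ ball 0 r := closedBall_subset_ball hr
  have key : ∀ a ∈ closedBall (0 : ℂ) 1, ¬ ∃ᶠ z in 𝓝[≠] a, g z = 0 := fun a ha h =>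
    hgw (han.eqOn_zero_of_preconnected_of_frequently_eq_zero hpc (hsub ha) h hw)
  refine ⟨?_, fun a ha h => key a ha (h.filter_mono nhdsWithin_le_nhds).frequently⟩
  by_contra h
  obtain ⟨a, ha, hacc⟩ := Set.Infinite.exists_accPt_of_subset_isCompact h
    (isCompact_closedBall 0 1) (sep_subset _ _)
  exact key a ha ((accPt_iff_frequently_nhdsNE.1 hacc).mono fun z hz => hz.2)

theorem exists_pow_factor {g : ℂ → ℂ} {r : ℝ} (hg : DifferentiableOn ℂ g (ball 0 r)) {a : ℂ}
    (ha : a ∈ ball (0 : ℂ) r) (h0 : ¬ ∀ᶠ z in 𝓝 a, g z = 0) :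
    ∃ (n : ℕ) (G : ℂ → ℂ), DifferentiableOn ℂ G (ball 0 r) ∧ G a ≠ 0 ∧
      ∀ z ∈ ball (0 : ℂ) r, g z = (z - a) ^ n * G z := by
  have han : AnalyticAt ℂ g a := hg.analyticAt (isOpen_ball.mem_nhds ha)
  obtain ⟨n, k, hk, hka, hgk⟩ := han.exists_eventuallyEq_pow_smul_nonzero_iff.2 h0
  have hev : (Function.update (fun z => g z / (z - a) ^ n) a (k a)) =ᶠ[𝓝 a] k := by
    filter_upwards [hgk] with z hz
    rcases eq_or_ne z a with rfl | hza
    · simp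
    · rw [Function.update_of_ne hza, hz, smul_eq_mul,
        mul_div_cancel_left₀ _ (pow_ne_zero _ (sub_ne_zero.2 hza))]
  refine ⟨n, Function.update (fun z => g z / (z - a) ^ n) a (k a), fun z hz => ?_, by simpa,
    fun z hz => ?_⟩
  · rcases eq_or_ne z a with rfl | hza
    · exact (hk.differentiableAt.congr_of_eventuallyEq hev).differentiableWithinAt
    · have hd : DifferentiableAt ℂ (fun z => g z / (z - a) ^ n) z :=
        ((hg z hz).differentiableAt (isOpen_ball.mem_nhds hz)).fun_div (by fun_prop)
          (pow_ne_zero _ (sub_ne_zero.2 hza))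
      refine (hd.congr_of_eventuallyEq ?_).differentiableWithinAt
      filter_upwards [isOpen_ne.mem_nhds hza] with w hw
      rw [Function.update_of_ne hw]
  · rcases eq_or_ne z a with rfl | hza
    · have := hgk.self_of_nhds
      rw [Function.update_self]
      rwa [smul_eq_mul] at this
    · rw [Function.update_of_ne hza, mul_div_cancel₀ _ (pow_ne_zero _ (sub_ne_zero.2 hza))]

theorem exists_factor_aux {r : ℝ} (hr : 1 < r) (Z : Finset ℂ) : ∀ g : ℂ → ℂ,
    DifferentiableOn ℂ g (ball 0 r) → (∀ a ∈ closedBall (0 : ℂ) 1, ¬ ∀ᶠ z in 𝓝 a, g z = 0) →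
    (∀ a ∈ closedBall (0 : ℂ) 1, g a = 0 → a ∈ Z) → (∀ a ∈ Z, a ∈ closedBall (0 : ℂ) 1) →
    ∃ (l : List ℂ) (G : ℂ → ℂ), (∀ a ∈ l, a ∈ closedBall (0 : ℂ) 1) ∧
      DifferentiableOn ℂ G (ball 0 r) ∧ (∀ z ∈ closedBall (0 : ℂ) 1, G z ≠ 0) ∧
      ∀ z ∈ ball (0 : ℂ) r, g z = (l.map fun a => z - a).prod * G z := by
  induction Z using Finset.induction_on with
  | empty =>
    intro g hg _ h1 _
    exact ⟨[], g, by simp, hg, fun z hz h => by simpa using h1 z hz h, by simp⟩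
  | insert a Z _ ih =>
    intro g hg h0 h1 h2
    have ha := h2 a (Finset.mem_insert_self a Z)
    have hsub : closedBall (0 : ℂ) 1 ⊆ ball 0 r := closedBall_subset_ball hr
    obtain ⟨n, k, hk, hka, hgk⟩ := exists_pow_factor hg (hsub ha) (h0 a ha)
    have h0k : ∀ b ∈ closedBall (0 : ℂ) 1, ¬ ∀ᶠ z in 𝓝 b, k z = 0 := fun b hb h => h0 b hb <| by
      filter_upwards [h, isOpen_ball.mem_nhds (hsub hb)] with z hz hz1
      rw [hgk z hz1, hz, mul_zero]
    have h1k : ∀ b ∈ closedBall (0 : ℂ) 1, k b = 0 → b ∈ Z := fun b hb h => by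
      refine Finset.mem_of_mem_insert_of_ne (h1 b hb ?_) ?_
      · rw [hgk b (hsub hb), h, mul_zero]
      · rintro rfl; exact hka h
    obtain ⟨l, G, hl, hG, hG0, hlG⟩ := ih k hk h0k h1k
      (fun b hb => h2 b (Finset.mem_insert_of_mem hb))
    refine ⟨List.replicate n a ++ l, G, fun b hb => ?_, hG, hG0, fun z hz => ?_⟩
    · rcases List.mem_append.1 hb with hb | hb
      · rwa [List.eq_of_mem_replicate hb]
      · exact hl b hb
    · rw [hgk z hz, hlG z hz, List.map_append, List.prod_append, List.map_replicate,
        List.prod_replicate, mul_assoc]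

theorem hasW_dslope {r : ℝ} {q a b : ℂ → ℂ} {p : ℂ} (hp : p ∈ ball (0 : ℂ) r)
    (hq : ∀ z ∈ ball (0 : ℂ) r, HasW q (a z) (b z) z) (hb : ∀ᶠ z in 𝓝 p, b z = 0) :
    ∀ z ∈ ball (0 : ℂ) r, ∃ α, HasW (dslope q p) α (b z / (z - p)) z := by
  intro z hz
  rcases eq_or_ne z p with rfl | hzp
  · have hev := hb.and (isOpen_ball.mem_nhds hp)
    obtain ⟨s, hs0, hs⟩ := Metric.eventually_nhds_iff_ball.1 hev
    have hd : DifferentiableOn ℂ q (ball z s) := fun w hw => by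
      have := hq w (hs w hw).2
      rw [(hs w hw).1] at this
      exact this.hasDerivAt.differentiableAt.differentiableWithinAt
    have hd' := (Complex.differentiableOn_dslope (ball_mem_nhds z hs0)).2 hd
    have := (hd'.differentiableAt (ball_mem_nhds z hs0)).hasDerivAt
    exact ⟨_, by simpa using hasW_of_hasDerivAt this⟩
  · have h1 := ((hq z hz).sub (hasW_const (q p) z)).div ((hasW_id z).sub (hasW_const p z))
      (sub_ne_zero.2 hzp)
    refine ⟨_, (h1.congr_coeff rfl ?_).congr ?_⟩
    · have := sub_ne_zero.2 hzp
      field_simp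
      ring
    · filter_upwards [isOpen_ne.mem_nhds hzp] with w hw
      rw [dslope_of_ne _ hw, slope_def_field]

theorem exists_division_aux {r : ℝ} (l : List ℂ) : ∀ q a b : ℂ → ℂ,
    (∀ p ∈ l, p ∈ ball (0 : ℂ) r) → (∀ z ∈ ball (0 : ℂ) r, HasW q (a z) (b z) z) →
    (∀ p ∈ l, ∀ᶠ z in 𝓝 p, b z = 0) →
    ∃ (H : Polynomial ℂ) (v α : ℂ → ℂ), ∀ z ∈ ball (0 : ℂ) r,
      (l.map fun p => z - p).prod * v z = H.eval z - q z ∧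
      HasW v (α z) (-(b z / (l.map fun p => z - p).prod)) z := by
  induction l with
  | nil =>
    intro q a b _ hq _
    exact ⟨0, fun z => -q z, fun z => -a z, fun z hz => ⟨by simp, by simpa using (hq z hz).neg⟩⟩
  | cons p l ih =>
    intro q a b hl hq hb
    have hq1 := hasW_dslope (hl p List.mem_cons_self) hq (hb p List.mem_cons_self)
    choose! a1 ha1 using hq1
    obtain ⟨H, v, α, h⟩ := ih (dslope q p) a1 (fun z => b z / (z - p))
      (fun x hx => hl x (List.mem_cons_of_mem p hx)) ha1
      (fun x hx => (hb x (List.mem_cons_of_mem p hx)).mono fun z hz => by rw [hz, zero_div])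
    refine ⟨(Polynomial.X - Polynomial.C p) * H + Polynomial.C (q p), v, α, fun z hz => ⟨?_, ?_⟩⟩
    · have h1 := sub_smul_dslope q p z
      rw [smul_eq_mul] at h1
      rw [List.map_cons, List.prod_cons, mul_assoc, (h z hz).1]
      simp only [Polynomial.eval_add, Polynomial.eval_mul, Polynomial.eval_sub, Polynomial.eval_X,
        Polynomial.eval_C]
      linear_combination -h1
    · refine (h z hz).2.congr_coeff rfl ?_
      rw [List.map_cons, List.prod_cons, div_div]

theorem exists_division {r : ℝ} (hr : 1 < r) {g q a b : ℂ → ℂ} {w : ℂ}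
    (hg : DifferentiableOn ℂ g (ball 0 r)) (hw : w ∈ ball (0 : ℂ) r) (hgw : g w ≠ 0)
    (hq : ∀ z ∈ ball (0 : ℂ) r, HasW q (a z) (b z) z)
    (hb : ∀ p ∈ closedBall (0 : ℂ) 1, g p = 0 → ∀ᶠ z in 𝓝 p, b z = 0) :
    ∃ (H : Polynomial ℂ) (v α : ℂ → ℂ), ∀ z ∈ closedBall (0 : ℂ) 1,
      (∀ᶠ x in 𝓝 z, g x * v x = H.eval x - q x) ∧ HasW v (α z) (-(b z / g z)) z := by
  obtain ⟨hfin, h0⟩ := finite_zeros hr hg hw hgw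
  obtain ⟨l, G, hl, hG, hG0, hlG⟩ := exists_factor_aux hr hfin.toFinset g hg h0
    (fun a ha hga => hfin.mem_toFinset.2 ⟨ha, hga⟩) (fun a ha => (hfin.mem_toFinset.1 ha).1)
  have hsub : closedBall (0 : ℂ) 1 ⊆ ball 0 r := closedBall_subset_ball hr
  have hl0 : ∀ p ∈ l, g p = 0 := fun p hp => by
    rw [hlG p (hsub (hl p hp)), List.prod_eq_zero (List.mem_map.2 ⟨p, hp, sub_self p⟩), zero_mul]
  obtain ⟨H, v, α, h⟩ := exists_division_aux l q a b (fun p hp => hsub (hl p hp)) hq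
    (fun p hp => hb p (hl p hp) (hl0 p hp))
  have hdG : ∀ z ∈ closedBall (0 : ℂ) 1, DifferentiableAt ℂ G z := fun z hz =>
    hG.differentiableAt (isOpen_ball.mem_nhds (hsub hz))
  have key : ∀ z ∈ closedBall (0 : ℂ) 1, ∃ β, HasW (fun x => v x / G x) β (-(b z / g z)) z :=
    fun z hz => by
      have h1 := (h z (hsub hz)).2.div (hasW_of_hasDerivAt (hdG z hz).hasDerivAt) (hG0 z hz)
      refine ⟨_, h1.congr_coeff rfl ?_⟩
      rw [hlG z (hsub hz), ← div_div]
      have := hG0 z hz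
      field_simp
      ring
  choose! β hβ using key
  refine ⟨H, fun x => v x / G x, β, fun z hz => ⟨?_, hβ z hz⟩⟩
  filter_upwards [isOpen_ball.mem_nhds (hsub hz), (hdG z hz).continuousAt.eventually_ne (hG0 z hz)]
    with x hx hx0
  rw [hlG x hx, ← (h x hx).1]
  field_simp

theorem norm_dslope_exp_le (w : ℂ) : ‖dslope cexp 0 w‖ ≤ Real.exp ‖w‖ := by
  rcases eq_or_ne w 0 with rfl | hw
  · simp [Complex.deriv_exp]
  · rw [dslope_of_ne _ hw, slope_def_field, exp_zero, sub_zero, norm_div,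
      div_le_iff₀ (norm_pos_iff.2 hw), mul_comm]
    have := Complex.norm_exp_sub_sum_le_norm_mul_exp w 1
    simpa using this

theorem norm_le_of_sphere {F : ℂ → ℂ} {B : ℝ}
    (hF : ∀ z ∈ closedBall (0 : ℂ) 1, DifferentiableAt ℂ F z)
    (hB : ∀ z ∈ sphere (0 : ℂ) 1, ‖F z‖ ≤ B) : ∀ z ∈ closedBall (0 : ℂ) 1, ‖F z‖ ≤ B := by
  intro z hz
  have hcl : closure (ball (0 : ℂ) 1) = closedBall 0 1 := closure_ball 0 one_ne_zero
  refine norm_le_of_forall_mem_frontier_norm_le isBounded_ball ?_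
    (fun x hx => hB x (frontier_ball_subset_sphere hx)) (hcl ▸ hz)
  refine DifferentiableOn.diffContOnCl fun x hx => (hF x (hcl ▸ hx)).differentiableWithinAt

theorem exists_bounded_solution {r η K C : ℝ} {f g q a b : ℂ → ℂ} {w : ℂ} (hr : 1 < r)
    (hη : 0 < η) (hf : DifferentiableOn ℂ f (ball 0 r)) (hg : DifferentiableOn ℂ g (ball 0 r))
    (hf1 : ∀ z ∈ closedBall (0 : ℂ) 1, ‖f z‖ ≤ 1) (hg1 : ∀ z ∈ closedBall (0 : ℂ) 1, ‖g z‖ ≤ 1)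
    (hw : w ∈ ball (0 : ℂ) r) (hgw : g w ≠ 0)
    (hq : ∀ z ∈ ball (0 : ℂ) r, HasW q (a z) (b z) z)
    (hqη : ∀ z ∈ ball (0 : ℂ) r, ‖g z‖ < η → b z = 0 ∧ cexp (q z) = f z)
    (hqK : ∀ z ∈ closedBall (0 : ℂ) 1, |(q z).re| ≤ K)
    (hβ : ContinuousOn (fun z => b z / g z) (closedBall 0 1))
    (hC : ∀ p : Polynomial ℂ, ‖∫ z in ball (0 : ℂ) 1, b z / g z * p.eval z‖ ≤
      C * ∫ θ in (0:ℝ)..2 * π, ‖p.eval (cexp (θ * I))‖) :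
    ∃ G : ℂ → ℂ, DifferentiableOn ℂ G (ball 0 1) ∧
      (∀ z ∈ ball (0 : ℂ) 1, ‖G z‖ ≤
        (Real.exp (K + (2 * C + 1)) + 1) / η + (2 * C + 1) * Real.exp (2 * C + 1)) ∧
      ∀ z ∈ ball (0 : ℂ) 1, Real.exp (-(K + (2 * C + 1))) ≤ ‖f z + g z * G z‖ := by
  have hsub : closedBall (0 : ℂ) 1 ⊆ ball 0 r := closedBall_subset_ball hr
  have hfd : ∀ z ∈ closedBall (0 : ℂ) 1, DifferentiableAt ℂ f z := fun z hz =>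
    hf.differentiableAt (isOpen_ball.mem_nhds (hsub hz))
  have hgd : ∀ z ∈ closedBall (0 : ℂ) 1, DifferentiableAt ℂ g z := fun z hz =>
    hg.differentiableAt (isOpen_ball.mem_nhds (hsub hz))
  have hsmall : ∀ z ∈ closedBall (0 : ℂ) 1, ‖g z‖ < η →
      ∀ᶠ x in 𝓝 z, ‖g x‖ < η ∧ x ∈ ball (0 : ℂ) r := fun z hz h =>
    ((hgd z hz).continuousAt.norm.eventually_lt_const h).and (isOpen_ball.mem_nhds (hsub hz))
  obtain ⟨H, v, α, h⟩ := exists_division hr hg hw hgw hq fun p hp hp0 =>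
    (hsmall p hp (by rwa [hp0, norm_zero])).mono fun x hx => (hqη x hx.2 hx.1).1
  have hpW : ∀ (p : Polynomial ℂ) z, HasW (fun x => p.eval x) (p.derivative.eval z) 0 z :=
    fun p z => hasW_of_hasDerivAt (p.hasDerivAt z)
  have hvp : ∀ p : Polynomial ℂ,
      ‖∫ θ in (0:ℝ)..2 * π, v (cexp (θ * I)) * (cexp (θ * I) * p.eval (cexp (θ * I)))‖ ≤
        2 * C * ∫ θ in (0:ℝ)..2 * π, ‖p.eval (cexp (θ * I))‖ := fun p => by
    have hW := fun z hz => (h z hz).2.mul (hpW p z)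
    have hst := stokes (F := fun x => v x * p.eval x)
      (fun z hz => (hW z hz).continuousAt.continuousWithinAt)
      (b := fun z => -(b z / g z * p.eval z))
      (fun z hz => (hW z (ball_subset_closedBall hz)).congr_coeff rfl (by ring))
      (hβ.mul p.continuous.continuousOn).neg
    have e : ∀ θ : ℝ, v (cexp (θ * I)) * (cexp (θ * I) * p.eval (cexp (θ * I))) =
      cexp (θ * I) * (v (cexp (θ * I)) * p.eval (cexp (θ * I))) := fun θ => by ring
    simp only [e]
    rw [hst, integral_neg, norm_mul, norm_neg, mul_assoc, Complex.norm_ofNat]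
    exact mul_le_mul_of_nonneg_left (hC p) zero_le_two
  obtain ⟨p, hp⟩ := exists_poly_near
    (fun z hz => (h z (sphere_subset_closedBall hz)).2.continuousAt.continuousWithinAt) hvp
  set B := 2 * C + 1 with hB
  have hB0 : 0 ≤ B := by
    have := hp 1 (by simp)
    exact (norm_nonneg _).trans this
  set V : ℂ → ℂ := fun z => v z + p.eval z with hV
  set Φ : ℂ → ℂ := fun z => H.eval z + g z * p.eval z with hΦ
  have hVΦ : ∀ z ∈ closedBall (0 : ℂ) 1, ∀ᶠ x in 𝓝 z, Φ x = q x + g x * V x := fun z hz => by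
    filter_upwards [(h z hz).1] with x hx
    simp only [hΦ, hV, mul_add, hx]
    ring
  have hΦd : ∀ z ∈ closedBall (0 : ℂ) 1, DifferentiableAt ℂ Φ z := fun z hz => by
    have := hgd z hz
    have := p.differentiable z
    have := H.differentiable z
    fun_prop
  have hre : ∀ z ∈ sphere (0 : ℂ) 1, |(Φ z).re| ≤ K + B := fun z hz => by
    have hz' := sphere_subset_closedBall hz
    rw [(hVΦ z hz').self_of_nhds, add_re]
    refine (abs_add_le _ _).trans (add_le_add (hqK z hz') ((abs_re_le_norm _).trans ?_))
    rw [norm_mul]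
    exact (mul_le_of_le_one_left (norm_nonneg _) (hg1 z hz')).trans (hp z hz)
  have hexp : ∀ z ∈ closedBall (0 : ℂ) 1, ‖cexp (Φ z)‖ ≤ Real.exp (K + B) :=
    norm_le_of_sphere (fun z hz => (hΦd z hz).cexp) fun z hz => by
      rw [norm_exp]
      exact Real.exp_le_exp.2 (le_of_abs_le (hre z hz))
  have hexp' : ∀ z ∈ closedBall (0 : ℂ) 1, ‖cexp (-Φ z)‖ ≤ Real.exp (K + B) :=
    norm_le_of_sphere (fun z hz => (hΦd z hz).fun_neg.cexp) fun z hz => by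
      rw [norm_exp, neg_re]
      exact Real.exp_le_exp.2 ((neg_le_abs _).trans (hre z hz))
  set G : ℂ → ℂ := fun z => if g z = 0 then f z * V z * dslope cexp 0 (g z * V z) else
    (cexp (Φ z) - f z) / g z with hG
  have hGs : ∀ z ∈ closedBall (0 : ℂ) 1, ‖g z‖ < η →
      ∀ᶠ x in 𝓝 z, G x = f x * V x * dslope cexp 0 (g x * V x) := fun z hz hzη => by
    filter_upwards [hsmall z hz hzη, hVΦ z hz] with x hx hxΦ
    simp only [hG]
    split_ifs with h0
    · rfl
    · have h1 := sub_smul_dslope cexp 0 (g x * V x)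
      rw [sub_zero, exp_zero, smul_eq_mul] at h1
      rw [div_eq_iff h0, hxΦ, exp_add, (hqη x hx.2 hx.1).2]
      linear_combination -(f x) * h1
  have hGb : ∀ x, g x ≠ 0 → G x = (cexp (Φ x) - f x) / g x := fun x hx => if_neg hx
  have hGd : ∀ z ∈ closedBall (0 : ℂ) 1, DifferentiableAt ℂ G z := fun z hz => by
    by_cases h0 : g z = 0
    · have hzη : ‖g z‖ < η := by rwa [h0, norm_zero]
      refine DifferentiableAt.congr_of_eventuallyEq ?_ (hGs z hz hzη)
      have h1 := (h z hz).2
      rw [(hqη z (hsub hz) hzη).1, zero_div, neg_zero] at h1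
      have h2 : DifferentiableAt ℂ V z :=
        h1.hasDerivAt.differentiableAt.fun_add p.differentiable.differentiableAt
      have h3 : Differentiable ℂ (dslope cexp 0) := by
        rw [← differentiableOn_univ]
        exact (Complex.differentiableOn_dslope univ_mem).2 differentiable_exp.differentiableOn
      exact ((hfd z hz).fun_mul h2).fun_mul
        ((h3 (g z * V z)).comp z ((hgd z hz).fun_mul h2))
    · refine DifferentiableAt.congr_of_eventuallyEq ?_
        (((hgd z hz).continuousAt.eventually_ne h0).mono hGb)
      exact ((hΦd z hz).cexp.fun_sub (hfd z hz)).fun_div (hgd z hz) h0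
  have hid : ∀ z ∈ closedBall (0 : ℂ) 1, f z + g z * G z = cexp (Φ z) := fun z hz => by
    by_cases h0 : g z = 0
    · have hzη : ‖g z‖ < η := by rwa [h0, norm_zero]
      rw [(hVΦ z hz).self_of_nhds, h0, zero_mul, zero_mul, add_zero, add_zero,
        (hqη z (hsub hz) hzη).2]
    · rw [hGb z h0]
      field_simp
      ring
  refine ⟨G, fun z hz => (hGd z (ball_subset_closedBall hz)).differentiableWithinAt,
    fun z hz => norm_le_of_sphere hGd (fun z hz => ?_) z (ball_subset_closedBall hz),
    fun z hz => ?_⟩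
  · have hz' := sphere_subset_closedBall hz
    have hBe := Real.exp_pos B
    by_cases hzη : ‖g z‖ < η
    · rw [(hGs z hz' hzη).self_of_nhds, norm_mul, norm_mul]
      have h1 := norm_dslope_exp_le (g z * V z)
      have h2 : ‖g z * V z‖ ≤ B := by
        rw [norm_mul]
        exact (mul_le_of_le_one_left (norm_nonneg _) (hg1 z hz')).trans (hp z hz)
      have h3 : ‖f z‖ * ‖V z‖ ≤ B :=
        (mul_le_of_le_one_left (norm_nonneg _) (hf1 z hz')).trans (hp z hz)
      have h4 : 0 ≤ (Real.exp (K + B) + 1) / η := by positivity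
      calc _ ≤ B * Real.exp B :=
            mul_le_mul h3 (h1.trans (Real.exp_le_exp.2 h2)) (norm_nonneg _) hB0
        _ ≤ _ := by linarith
    · have h0 : g z ≠ 0 := by
        rintro h0
        rw [h0, norm_zero] at hzη
        exact hzη hη
      rw [hGb z h0, norm_div]
      have h1 : ‖cexp (Φ z) - f z‖ ≤ Real.exp (K + B) + 1 :=
        (norm_sub_le _ _).trans (add_le_add (hexp z hz') (hf1 z hz'))
      have h2 : ‖cexp (Φ z) - f z‖ / ‖g z‖ ≤ (Real.exp (K + B) + 1) / η :=
        div_le_div₀ (by positivity) h1 hη (not_lt.1 hzη)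
      have h3 : 0 ≤ B * Real.exp B := by positivity
      linarith
  · have hz' := ball_subset_closedBall hz
    rw [hid z hz', Real.exp_neg, inv_le_comm₀ (Real.exp_pos _) (norm_pos_iff.2 (exp_ne_zero _)),
      ← norm_inv, ← exp_neg]
    exact hexp' z hz'

theorem eventually_eq_of_deriv_zero {U : Set ℂ} (hU : IsOpen U) {c : ℂ → ℂ}
    (hc : ∀ z ∈ U, HasDerivAt c 0 z) {z : ℂ} (hz : z ∈ U) : ∀ᶠ x in 𝓝 z, c x = c z := by
  obtain ⟨s, hs, hsU⟩ := Metric.isOpen_iff.1 hU z hz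
  filter_upwards [ball_mem_nhds z hs] with x hx
  exact isOpen_ball.is_const_of_deriv_eq_zero (convex_ball z s).isPreconnected
    (fun w hw => (hc w (hsU hw)).differentiableAt.differentiableWithinAt)
    (fun w hw => (hc w (hsU hw)).deriv) hx (mem_ball_self hs)

theorem exists_corrected {ε δ : ℝ} (hε : 0 < ε) (hδ : 0 < δ) : ∃ C₀ : ℝ, 0 ≤ C₀ ∧
    ∀ (r K : ℝ) (f g ψ a b : ℂ → ℂ), 0 ≤ K → DifferentiableOn ℂ f (ball 0 r) →
      DifferentiableOn ℂ g (ball 0 r) → (∀ z ∈ ball (0 : ℂ) r, ‖f z‖ ≤ 1) →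
      (∀ z ∈ ball (0 : ℂ) r, ‖g z‖ ≤ 1) → (∀ z ∈ ball (0 : ℂ) r, HasW ψ (a z) (b z) z) →
      (∀ z ∈ ball (0 : ℂ) r, |(ψ z).re| ≤ K) →
      (∀ z ∈ ball (0 : ℂ) r, ‖g z‖ < ε → b z = 0 ∧ a z = deriv f z / f z ∧ δ ≤ ‖f z‖) →
      ∃ q aq E aE bE : ℂ → ℂ, ContinuousOn aE (ball 0 r) ∧ ∀ z ∈ ball (0 : ℂ) r,
        HasW q (aq z) (b z + g z * E z) z ∧ HasW E (aE z) (bE z) z ∧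
        (‖g z‖ < ε / 2 → E z = 0 ∧ cexp (q z) = f z) ∧
        |(q z).re| ≤ 2 * (K + C₀) ∧ ‖E z‖ ≤ C₀ * (K + C₀) * ‖deriv g z‖ ∧
        ‖aE z‖ ≤ C₀ * (K + C₀) * ‖deriv g z‖ ^ 2 := by
  have hs : (ε / 2) ^ 2 < (3 * ε / 4) ^ 2 := by nlinarith
  obtain ⟨β, β', β'', Cβ, hβ, hβ', hβc, hβ0, hβ1, hβl, hβr, hβl', hβr', hCβ, hCβ'⟩ :=
    exists_cutoff hs
  have hCβ0 : 0 ≤ Cβ := (abs_nonneg _).trans (hCβ 0)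
  set C₀ := max (|Real.log δ| + π) Cβ with hC₀
  have hC0 : 0 ≤ C₀ := le_max_of_le_right hCβ0
  have hβr'' : ∀ s, (3 * ε / 4) ^ 2 < s → β'' s = 0 := fun s hs' => by
    refine (hβ' s).unique ((hasDerivAt_const s (0:ℝ)).congr_of_eventuallyEq ?_)
    filter_upwards [lt_mem_nhds hs'] with x hx using hβr' x hx.le
  refine ⟨C₀, hC0, fun r K f g ψ a b hK hf hg hf1 hg1 hψ hψK hU => ?_⟩
  have hfd : ∀ z ∈ ball (0 : ℂ) r, HasDerivAt f (deriv f z) z := fun z hz =>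
    (hf.differentiableAt (isOpen_ball.mem_nhds hz)).hasDerivAt
  have hgd : ∀ z ∈ ball (0 : ℂ) r, HasDerivAt g (deriv g z) z := fun z hz =>
    (hg.differentiableAt (isOpen_ball.mem_nhds hz)).hasDerivAt
  have hgd' : ∀ z ∈ ball (0 : ℂ) r, HasDerivAt (deriv g) (deriv (deriv g) z) z := fun z hz =>
    ((hg.deriv isOpen_ball).differentiableAt (isOpen_ball.mem_nhds hz)).hasDerivAt
  set U : Set ℂ := {z | z ∈ ball (0 : ℂ) r ∧ ‖g z‖ < ε} with hUdef
  have hUo : IsOpen U := by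
    rw [isOpen_iff_mem_nhds]
    intro z hz
    filter_upwards [isOpen_ball.mem_nhds hz.1,
      (hgd z hz.1).continuousAt.norm.eventually_lt_const hz.2] with x h1 h2 using ⟨h1, h2⟩
  set c : ℂ → ℂ := fun z => cexp (ψ z) / f z with hc
  have hf0 : ∀ z ∈ U, f z ≠ 0 := fun z hz => by
    rw [← norm_pos_iff]
    exact hδ.trans_le (hU z hz.1 hz.2).2.2
  have hcd : ∀ z ∈ U, HasDerivAt c 0 z := fun z hz => by
    obtain ⟨h1, h2, -⟩ := hU z hz.1 hz.2
    have hψd := hψ z hz.1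
    rw [h1, h2] at hψd
    refine (hψd.hasDerivAt.cexp.fun_div (hfd z hz.1) (hf0 z hz)).congr_deriv ?_
    have := hf0 z hz
    field_simp
    ring
  set R : ℂ → ℂ := fun z => -log (c z) with hR
  have hRloc : ∀ z ∈ U, ∀ᶠ x in 𝓝 z, R x = R z := fun z hz =>
    (eventually_eq_of_deriv_zero hUo hcd hz).mono fun x hx => by simp only [hR, hx]
  have hRW : ∀ z ∈ U, HasW R 0 0 z := fun z hz => (hasW_const (R z) z).congr (hRloc z hz)
  have hRexp : ∀ z ∈ U, cexp (ψ z + R z) = f z := fun z hz => by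
    have h0 := hf0 z hz
    rw [hR, exp_add, exp_neg, exp_log (div_ne_zero (exp_ne_zero _) h0), inv_div]
    have := exp_ne_zero (ψ z)
    field_simp
  have hRK : ∀ z ∈ U, ‖R z‖ ≤ K + C₀ := fun z hz => by
    have h0 := norm_pos_iff.2 (hf0 z hz)
    have h1 : |Real.log ‖f z‖| ≤ |Real.log δ| := by
      have h2 := Real.log_nonpos h0.le (hf1 z hz.1)
      have h3 := Real.log_le_log hδ (hU z hz.1 hz.2).2.2
      rw [abs_of_nonpos h2, abs_of_nonpos (h3.trans h2)]
      linarith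
    have h2 : (log (c z)).re = (ψ z).re - Real.log ‖f z‖ := by
      rw [log_re, hc, norm_div, Real.log_div (norm_ne_zero_iff.2 (exp_ne_zero _)) h0.ne', norm_exp,
        Real.log_exp]
    have h3 : |(log (c z)).im| ≤ π := by rw [log_im]; exact abs_arg_le_pi _
    calc ‖R z‖ = ‖log (c z)‖ := norm_neg _
      _ ≤ _ := norm_le_abs_re_add_abs_im _
      _ ≤ (K + |Real.log δ|) + π := by
          rw [h2]
          exact add_le_add ((abs_sub _ _).trans (add_le_add (hψK z hz.1) h1)) h3
      _ ≤ _ := by linarith [le_max_left (|Real.log δ| + π) Cβ]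
  have hCC : Cβ ≤ C₀ := le_max_right _ _
  have hlarge : ∀ z ∈ ball (0 : ℂ) r, z ∉ U → ∀ᶠ x in 𝓝 z, (3 * ε / 4) ^ 2 < normSq (g x) :=
    fun z hz hzU => by
      have h1 : ε ≤ ‖g z‖ := not_lt.1 fun h => hzU ⟨hz, h⟩
      have h2 : (3 * ε / 4) ^ 2 < ‖g z‖ ^ 2 := by nlinarith
      rw [← normSq_eq_norm_sq] at h2
      exact (continuous_normSq.continuousAt.comp (hgd z hz).continuousAt).eventually_const_lt h2
  set E : ℂ → ℂ := fun z => ((-β' (normSq (g z)) : ℝ) : ℂ) * conj (deriv g z) * R z with hE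
  set aE : ℂ → ℂ := fun z => ((-β'' (normSq (g z)) : ℝ) : ℂ) * conj (g z) * deriv g z *
    conj (deriv g z) * R z with haE
  set q : ℂ → ℂ := fun z => ψ z + ((1 - β (normSq (g z)) : ℝ) : ℂ) * R z with hq
  have hEl : ∀ z ∈ ball (0 : ℂ) r, z ∉ U → E =ᶠ[𝓝 z] fun _ => 0 := fun z hz hzU => by
    filter_upwards [hlarge z hz hzU] with x hx
    simp [hE, hβr' _ hx.le]
  have haEl : ∀ z ∈ ball (0 : ℂ) r, z ∉ U → aE =ᶠ[𝓝 z] fun _ => 0 := fun z hz hzU => by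
    filter_upwards [hlarge z hz hzU] with x hx
    simp [haE, hβr'' _ hx]
  have hql : ∀ z ∈ ball (0 : ℂ) r, z ∉ U → q =ᶠ[𝓝 z] ψ := fun z hz hzU => by
    filter_upwards [hlarge z hz hzU] with x hx
    simp [hq, hβr _ hx.le]
  have hqW : ∀ z ∈ ball (0 : ℂ) r, ∃ aq, HasW q aq (b z + g z * E z) z := fun z hz => by
    by_cases hzU : z ∈ U
    · have h1 := hasW_normSq (χ := fun s => 1 - β s) ((hβ (normSq (g z))).const_sub 1) (hgd z hz)
      refine ⟨_, ((hψ z hz).add (h1.mul (hRW z hzU))).congr_coeff rfl ?_⟩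
      simp only [hE]
      ring
    · refine ⟨_, ((hψ z hz).congr (hql z hz hzU)).congr_coeff rfl ?_⟩
      rw [(hEl z hz hzU).self_of_nhds, mul_zero, add_zero]
  choose! aq haq using hqW
  have hEW : ∀ z ∈ ball (0 : ℂ) r, ∃ bE, HasW E (aE z) bE z := fun z hz => by
    by_cases hzU : z ∈ U
    · have h1 := hasW_normSq (χ := fun s => -β' s) (hβ' (normSq (g z))).fun_neg (hgd z hz)
      have h2 := (hasW_of_hasDerivAt (hgd' z hz)).conj
      refine ⟨_, ((h1.mul h2).mul (hRW z hzU)).congr_coeff ?_ rfl⟩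
      simp only [haE, map_zero]
      ring
    · refine ⟨0, ((hasW_const 0 z).congr (hEl z hz hzU)).congr_coeff ?_ rfl⟩
      rw [(haEl z hz hzU).self_of_nhds]
  choose! bE hbE using hEW
  refine ⟨q, aq, E, aE, bE, fun z hz => ?_, fun z hz => ⟨haq z hz, hbE z hz, fun hzε => ?_, ?_,
    ?_, ?_⟩⟩
  · refine ContinuousAt.continuousWithinAt ?_
    by_cases hzU : z ∈ U
    · have h1 := (hgd z hz).continuousAt
      have h2 := (hgd' z hz).continuousAt
      have h3 := (hRW z hzU).continuousAt
      have h4 : ContinuousAt (fun x => ((-β'' (normSq (g x)) : ℝ) : ℂ)) z :=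
        continuous_ofReal.continuousAt.comp
          (hβc.neg.continuousAt.comp (continuous_normSq.continuousAt.comp h1))
      have h5 := continuous_conj
      exact (((h4.mul (h5.continuousAt.comp h1)).mul h2).mul (h5.continuousAt.comp h2)).mul h3
    · exact continuousAt_const.congr (haEl z hz hzU).symm
  · have hn : normSq (g z) ≤ (ε / 2) ^ 2 := by
      rw [normSq_eq_norm_sq]
      gcongr
    refine ⟨by simp [hE, hβl' _ hn], ?_⟩
    have hzU : z ∈ U := ⟨hz, by linarith⟩
    rw [← hRexp z hzU, hq]
    simp [hβl _ hn]
  · by_cases hzU : z ∈ U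
    · have h1 : (q z).re = (ψ z).re + (1 - β (normSq (g z))) * (R z).re := by
        simp only [hq, add_re, re_ofReal_mul]
      have h2 : |(1 - β (normSq (g z))) * (R z).re| ≤ K + C₀ := by
        rw [abs_mul, abs_of_nonneg (sub_nonneg.2 (hβ1 _))]
        exact (mul_le_of_le_one_left (abs_nonneg _) (by linarith [hβ0 (normSq (g z))])).trans
          ((abs_re_le_norm _).trans (hRK z hzU))
      rw [h1]
      linarith [abs_add_le (ψ z).re ((1 - β (normSq (g z))) * (R z).re), hψK z hz]
    · rw [(hql z hz hzU).self_of_nhds]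
      linarith [hψK z hz]
  · by_cases hzU : z ∈ U
    · simp only [hE]
      rw [norm_mul, norm_mul, RCLike.norm_conj, norm_real, Real.norm_eq_abs, abs_neg,
        mul_right_comm]
      have := (hCβ (normSq (g z))).trans hCC
      have := hRK z hzU
      gcongr
    · rw [(hEl z hz hzU).self_of_nhds, norm_zero]
      positivity
  · by_cases hzU : z ∈ U
    · simp only [haE]
      rw [norm_mul, norm_mul, norm_mul, norm_mul, RCLike.norm_conj, RCLike.norm_conj, norm_real,
        Real.norm_eq_abs, abs_neg]
      have h1 := (hCβ' (normSq (g z))).trans hCC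
      have h2 := hRK z hzU
      have h3 := hg1 z hz
      calc _ = |β'' (normSq (g z))| * ‖R z‖ * ‖deriv g z‖ ^ 2 * ‖g z‖ := by ring
        _ ≤ |β'' (normSq (g z))| * ‖R z‖ * ‖deriv g z‖ ^ 2 * 1 := by gcongr
        _ ≤ _ := by rw [mul_one]; gcongr
    · rw [(haEl z hz hzU).self_of_nhds, norm_zero]
      positivity

theorem exists_bounded_dilated {δ : ℝ} (hδ : 0 < δ) (hδ1 : δ ≤ 1) : ∃ C : ℝ, 0 < C ∧
    ∀ (f g : ℂ → ℂ) (R ρ : ℝ), 1 < R → DifferentiableOn ℂ f (ball 0 R) →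
      DifferentiableOn ℂ g (ball 0 R) →
      (∀ z ∈ closedBall (0 : ℂ) 1, ‖f z‖ ≤ 1) → (∀ z ∈ closedBall (0 : ℂ) 1, ‖g z‖ ≤ 1) →
      (∀ z ∈ closedBall (0 : ℂ) 1, δ ≤ ‖f z‖ + ‖g z‖) → 0 < ρ → ρ < 1 →
      ∃ G : ℂ → ℂ, DifferentiableOn ℂ G (ball 0 1) ∧ (∀ z ∈ ball (0 : ℂ) 1, ‖G z‖ ≤ C) ∧
        ∀ z ∈ ball (0 : ℂ) 1, 1 / C ≤ ‖f (ρ * z) + g (ρ * z) * G z‖ := by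
  obtain ⟨ε, K, hε, hεδ, hK, hpsi⟩ := exists_psi hδ hδ1
  obtain ⟨C₀, hC₀, hcor⟩ := exists_corrected hε (half_pos hδ)
  set C₁ := C₀ * (K + C₀) with hC₁
  have hC10 : 0 ≤ C₁ := by positivity
  set C₂ := ε⁻¹ * (32 * (K + 1) * Real.exp (8064 * K)) + (10 * C₁ + 2 * C₁) with hC₂
  have hC20 : 0 ≤ C₂ := by positivity
  set M := (Real.exp (2 * (K + C₀) + (2 * C₂ + 1)) + 1) / (ε / 2) +
    (2 * C₂ + 1) * Real.exp (2 * C₂ + 1) with hM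
  have hM0 : 0 ≤ M := by positivity
  have hδi : 0 < 1 / δ := by positivity
  have hep := Real.exp_pos (2 * (K + C₀) + (2 * C₂ + 1))
  refine ⟨M + Real.exp (2 * (K + C₀) + (2 * C₂ + 1)) + 1 / δ, by positivity,
    fun f g R ρ hR hf hg hf1 hg1 hfg hρ0 hρ => ?_⟩
  have hCδ : 1 / (M + Real.exp (2 * (K + C₀) + (2 * C₂ + 1)) + 1 / δ) ≤ δ := by
    rw [div_le_iff₀ (by positivity)]
    have : δ * (1 / δ) = 1 := by field_simp
    nlinarith
  have hr : 1 < ρ⁻¹ := (one_lt_inv₀ hρ0).2 hρ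
  have hmap : ∀ z ∈ ball (0 : ℂ) ρ⁻¹, (ρ : ℂ) * z ∈ ball (0 : ℂ) 1 := fun z hz => by
    rw [mem_ball_zero_iff] at hz ⊢
    rw [norm_mul, norm_real, Real.norm_of_nonneg hρ0.le]
    rwa [← lt_inv_mul_iff₀ hρ0, mul_one]
  have hsub : closedBall (0 : ℂ) 1 ⊆ ball 0 ρ⁻¹ := closedBall_subset_ball hr
  have hsub' : ball (0 : ℂ) 1 ⊆ ball 0 ρ⁻¹ := ball_subset_closedBall.trans hsub
  have hcl : ∀ z ∈ ball (0 : ℂ) ρ⁻¹, (ρ : ℂ) * z ∈ closedBall (0 : ℂ) 1 := fun z hz =>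
    ball_subset_closedBall (hmap z hz)
  by_cases hg0 : ∀ z ∈ ball (0 : ℂ) ρ⁻¹, g (ρ * z) = 0
  · refine ⟨fun _ => 0, differentiableOn_const 0, fun z hz => ?_, fun z hz => ?_⟩
    · rw [norm_zero]; positivity
    · have h1 := hfg _ (hcl z (hsub' hz))
      rw [hg0 z (hsub' hz), norm_zero, add_zero] at h1
      rw [mul_zero, add_zero]
      exact hCδ.trans h1
  push Not at hg0
  obtain ⟨w, hw, hgw⟩ := hg0
  obtain ⟨κ, ψ, a, b, hκ, hκ0, hκK, hb, hψ⟩ := hpsi f g R hR hf hg hf1 hg1 hfg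
  have hbR : ball (0 : ℂ) 1 ⊆ ball 0 R := ball_subset_ball hR.le
  have hdil : ∀ z, HasDerivAt (fun z : ℂ => (ρ : ℂ) * z) ρ z := fun z => by
    simpa using (hasDerivAt_id z).const_mul (ρ : ℂ)
  have hcomp : ∀ {k : ℂ → ℂ}, DifferentiableOn ℂ k (ball 0 R) → ∀ z ∈ ball (0 : ℂ) ρ⁻¹,
      HasDerivAt (fun z => k (ρ * z)) (deriv k (ρ * z) * ρ) z := fun hk z hz =>
    (hk.differentiableAt (isOpen_ball.mem_nhds (hbR (hmap z hz)))).hasDerivAt.comp z (hdil z)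
  have hcomp' : ∀ {k : ℂ → ℂ}, DifferentiableOn ℂ k (ball 0 R) →
      DifferentiableOn ℂ (fun z => k (ρ * z)) (ball 0 ρ⁻¹) := fun hk z hz =>
    (hcomp hk z hz).differentiableAt.differentiableWithinAt
  have hgd : ∀ z ∈ ball (0 : ℂ) ρ⁻¹,
      HasDerivAt (fun z => g (ρ * z)) (deriv (fun z => g (ρ * z)) z) z := fun z hz =>
    (hcomp hg z hz).differentiableAt.hasDerivAt
  have hgd' : ∀ z ∈ ball (0 : ℂ) ρ⁻¹, HasDerivAt (deriv fun z => g (ρ * z))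
      (deriv (deriv fun z => g (ρ * z)) z) z := fun z hz =>
    (((hcomp' hg).deriv isOpen_ball).differentiableAt (isOpen_ball.mem_nhds hz)).hasDerivAt
  obtain ⟨q, aq, E, aE, bE, haE, hq⟩ := hcor ρ⁻¹ K (fun z => f (ρ * z)) (fun z => g (ρ * z))
    (fun z => ψ (ρ * z)) (fun z => a (ρ * z) * ρ) (fun z => b (ρ * z) * conj (ρ : ℂ)) hK
    (hcomp' hf) (hcomp' hg) (fun z hz => hf1 _ (hcl z hz)) (fun z hz => hg1 _ (hcl z hz))
    (fun z hz => (hψ _ (hmap z hz)).1.comp_hol (hdil z)) (fun z hz => (hψ _ (hmap z hz)).2.1)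
    (fun z hz hzε => by
      obtain ⟨h1, h2⟩ := (hψ _ (hmap z hz)).2.2.2 hzε
      refine ⟨by rw [h1, zero_mul], ?_, ?_⟩
      · rw [(hcomp hf z hz).deriv, h2]; ring
      · linarith [hfg _ (hcl z hz)])
  have hsplit : ∀ z ∈ ball (0 : ℂ) ρ⁻¹,
      (b (ρ * z) * conj (ρ : ℂ) + g (ρ * z) * E z) / g (ρ * z) =
        b (ρ * z) * conj (ρ : ℂ) / g (ρ * z) + E z := fun z hz => by
    by_cases h0 : g (ρ * z) = 0
    · have h1 := ((hq z hz).2.2.1 (by rw [h0, norm_zero]; exact half_pos hε)).1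
      simp [h0, h1]
    · field_simp
  have hEc : ContinuousOn E (closedBall 0 1) := fun z hz =>
    (hq z (hsub hz)).2.1.continuousAt.continuousWithinAt
  have hbc : ∀ z ∈ ball (0 : ℂ) ρ⁻¹, ContinuousAt (fun z => b (ρ * z)) z := fun z hz =>
    (hb.continuousAt (isOpen_ball.mem_nhds (hmap z hz))).comp (hdil z).continuousAt
  have hgc : ∀ z ∈ ball (0 : ℂ) ρ⁻¹, ContinuousAt (fun z => g (ρ * z)) z := fun z hz =>
    (hgd z hz).continuousAt
  have hbgc : ContinuousOn (fun z => b (ρ * z) * conj (ρ : ℂ) / g (ρ * z)) (closedBall 0 1) := by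
    intro z hz
    refine ContinuousAt.continuousWithinAt ?_
    by_cases h0 : ‖g (ρ * z)‖ < ε
    · refine continuousAt_const (y := (0 : ℂ)).congr ?_
      filter_upwards [isOpen_ball.mem_nhds (hsub hz),
        (hgc z (hsub hz)).norm.eventually_lt_const h0] with x hx hx0
      rw [((hψ _ (hmap x hx)).2.2.2 hx0).1, zero_mul, zero_div]
    · refine ((hbc z (hsub hz)).mul continuousAt_const).div (hgc z (hsub hz)) fun h => h0 ?_
      rwa [h, norm_zero]
  have hbgn : ∀ z ∈ ball (0 : ℂ) ρ⁻¹,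
      ‖b (ρ * z) * conj (ρ : ℂ) / g (ρ * z)‖ ≤ ε⁻¹ * ‖b (ρ * z)‖ := fun z hz => by
    by_cases h0 : ‖g (ρ * z)‖ < ε
    · rw [((hψ _ (hmap z hz)).2.2.2 h0).1, zero_mul, zero_div, norm_zero, mul_zero]
    · rw [norm_div, norm_mul, RCLike.norm_conj, norm_real, Real.norm_of_nonneg hρ0.le,
        inv_mul_eq_div]
      exact div_le_div₀ (norm_nonneg _) (mul_le_of_le_one_right (norm_nonneg _) hρ.le) hε
        (not_lt.1 h0)
  have hball : ∀ᵐ z ∂volume.restrict (ball (0 : ℂ) 1), z ∈ ball (0 : ℂ) 1 :=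
    ae_restrict_mem measurableSet_ball
  obtain ⟨G, hG, hGM, hGl⟩ := exists_bounded_solution (C := C₂) (K := 2 * (K + C₀)) hr
    (half_pos hε) (hcomp' hf) (hcomp' hg) (fun z hz => hf1 _ (hcl z (hsub hz)))
    (fun z hz => hg1 _ (hcl z (hsub hz))) hw hgw (fun z hz => (hq z hz).1)
    (fun z hz hzε => by
      obtain ⟨h1, h2⟩ := (hq z hz).2.2.1 hzε
      refine ⟨?_, h2⟩
      rw [((hψ _ (hmap z hz)).2.2.2 (lt_trans hzε (half_lt_self hε))).1, h1, zero_mul, mul_zero,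
        add_zero])
    (fun z hz => (hq z (hsub hz)).2.2.2.1)
    ((hbgc.add hEc).congr fun z hz => hsplit z (hsub hz))
    (fun p => by
      have hpc : ContinuousOn (fun z => p.eval z) (closedBall 0 1) := p.continuous.continuousOn
      have hi1 : IntegrableOn (fun z => b (ρ * z) * conj (ρ : ℂ) / g (ρ * z) * p.eval z)
          (ball 0 1) := integrableOn_ball_of_continuousOn (hbgc.mul hpc)
      have hi2 : IntegrableOn (fun z => E z * p.eval z) (ball 0 1) :=
        integrableOn_ball_of_continuousOn (hEc.mul hpc)
      have hi3 : IntegrableOn (fun z => ε⁻¹ * (‖b (ρ * z)‖ * ‖p.eval z‖)) (ball 0 1) := by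
        refine integrableOn_ball_of_continuousOn (continuousOn_const.mul (ContinuousOn.mul ?_
          hpc.norm))
        exact fun z hz => (hbc z (hsub hz)).norm.continuousWithinAt
      have h1 : ‖∫ z in ball (0 : ℂ) 1, b (ρ * z) * conj (ρ : ℂ) / g (ρ * z) * p.eval z‖ ≤
          ε⁻¹ * (32 * (K + 1) * Real.exp (8064 * K)) *
            ∫ θ in (0:ℝ)..2 * π, ‖p.eval (cexp (θ * I))‖ := by
        refine (norm_integral_le_of_norm_le hi3 (hball.mono fun z hz => ?_)).trans ?_
        · rw [norm_mul, ← mul_assoc]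
          exact mul_le_mul_of_nonneg_right (hbgn z (hsub' hz)) (norm_nonneg _)
        · rw [integral_const_mul, mul_assoc]
          exact mul_le_mul_of_nonneg_left (embedding_ker hρ0 hρ hκ hκ0 hK hκK hb
            (fun z hz => (hψ z hz).2.2.1) p.differentiable) (by positivity)
      have h2 := wolff (h := fun z => p.eval z) p.differentiable (fun z hz => hgd z (hsub hz))
        (fun z hz => hgd' z (hsub hz)) (fun z hz => hg1 _ (hcl z (hsub hz)))
        (fun z hz => (hq z (hsub hz)).2.1) (haE.mono hsub) hC10 hC10
        (fun z hz => (hq z (hsub' hz)).2.2.2.2.1) (fun z hz => (hq z (hsub' hz)).2.2.2.2.2)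
      have h3 : ∫ z in ball (0 : ℂ) 1,
          (b (ρ * z) * conj (ρ : ℂ) + g (ρ * z) * E z) / g (ρ * z) * p.eval z =
          (∫ z in ball (0 : ℂ) 1, b (ρ * z) * conj (ρ : ℂ) / g (ρ * z) * p.eval z) +
            ∫ z in ball (0 : ℂ) 1, E z * p.eval z := by
        rw [← integral_add hi1 hi2]
        refine setIntegral_congr_fun measurableSet_ball fun z hz => ?_
        rw [hsplit z (hsub' hz), add_mul]
      rw [h3, hC₂, add_mul]
      exact (norm_add_le _ _).trans (add_le_add h1 h2))
  refine ⟨G, hG, fun z hz => (hGM z hz).trans (by rw [← hM]; linarith), fun z hz =>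
    le_trans ?_ (hGl z hz)⟩
  rw [Real.exp_neg, ← one_div]
  exact one_div_le_one_div_of_le hep (by linarith)

theorem norm_taylor_le {G : ℂ → ℂ} {s C : ℝ} {z w : ℂ} (hs : 0 < s)
    (hG : DifferentiableOn ℂ G (ball z s)) (hC : ∀ x ∈ ball z s, ‖G x‖ ≤ C) (hw : w ∈ ball z s) :
    ‖deriv G z‖ ≤ 2 * C / s ∧
      ‖G w - G z - (w - z) * deriv G z‖ ≤ 2 * (2 * C / s) / s * ‖w - z‖ ^ 2 := by
  have hz : z ∈ ball z s := mem_ball_self hs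
  have h1 : ∀ x ∈ ball z s, ‖dslope G z x‖ ≤ 2 * C / s := fun x hx => by
    refine Complex.norm_dslope_le_div_of_mapsTo_ball hG (fun y hy => ?_) hx
    rw [mem_closedBall_iff_norm]
    linarith [norm_sub_le (G y) (G z), hC y hy, hC z hz]
  have hd : DifferentiableOn ℂ (dslope G z) (ball z s) :=
    (Complex.differentiableOn_dslope (ball_mem_nhds z hs)).2 hG
  have h2 : ‖dslope (dslope G z) z w‖ ≤ 2 * (2 * C / s) / s := by
    refine Complex.norm_dslope_le_div_of_mapsTo_ball hd (fun y hy => ?_) hw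
    rw [mem_closedBall_iff_norm]
    linarith [norm_sub_le (dslope G z y) (dslope G z z), h1 y hy, h1 z hz]
  have e1 := sub_smul_dslope G z w
  have e2 := sub_smul_dslope (dslope G z) z w
  rw [dslope_same, smul_eq_mul] at e2
  rw [smul_eq_mul] at e1
  refine ⟨by simpa using h1 z hz, ?_⟩
  have e3 : G w - G z - (w - z) * deriv G z = dslope (dslope G z) z w * (w - z) ^ 2 := by
    linear_combination -e1 - (w - z) * e2
  rw [e3, norm_mul, norm_pow]
  gcongr

theorem exists_ultralimit {u : ℕ → ℂ} {C : ℝ} (hu : ∀ n, ‖u n‖ ≤ C) :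
    ∃ l, Tendsto u (hyperfilter ℕ) (𝓝 l) := by
  obtain ⟨l, -, hl⟩ := (isCompact_closedBall (0 : ℂ) C).ultrafilter_le_nhds'
    ((hyperfilter ℕ).map u) (Ultrafilter.mem_map.2 (univ_mem' fun n => by simpa using hu n))
  exact ⟨l, hl⟩

theorem exists_holomorphic_ultralimit {G : ℕ → ℂ → ℂ} {C : ℝ}
    (hG : ∀ n, DifferentiableOn ℂ (G n) (ball 0 1)) (hC : ∀ n, ∀ z ∈ ball (0 : ℂ) 1, ‖G n z‖ ≤ C) :
    ∃ L : ℂ → ℂ, DifferentiableOn ℂ L (ball 0 1) ∧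
      ∀ z ∈ ball (0 : ℂ) 1, Tendsto (fun n => G n z) (hyperfilter ℕ) (𝓝 (L z)) := by
  have hlim : ∀ z ∈ ball (0 : ℂ) 1, ∃ l, Tendsto (fun n => G n z) (hyperfilter ℕ) (𝓝 l) :=
    fun z hz => exists_ultralimit fun n => hC n z hz
  choose! L hL using hlim
  refine ⟨L, fun z hz => ?_, hL⟩
  obtain ⟨s, hs, hsub⟩ := Metric.isOpen_iff.1 isOpen_ball z hz
  have key := fun n w hw => norm_taylor_le (w := w) hs ((hG n).mono hsub)
    (fun x hx => hC n x (hsub hx)) hw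
  obtain ⟨D, hD⟩ := exists_ultralimit fun n => (key n z (mem_ball_self hs)).1
  refine HasDerivAt.differentiableAt (f' := D) ?_ |>.differentiableWithinAt
  rw [hasDerivAt_iff_isLittleO]
  refine Asymptotics.IsBigO.trans_isLittleO ?_ (Asymptotics.isLittleO_pow_sub_sub z one_lt_two)
  refine Asymptotics.IsBigO.of_bound (2 * (2 * C / s) / s) ?_
  filter_upwards [ball_mem_nhds z hs] with w hw
  rw [smul_eq_mul, norm_pow, norm_norm]
  exact le_of_tendsto (((hL w (hsub hw)).sub (hL z hz)).sub (hD.const_mul (w - z))).norm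
    (Eventually.of_forall fun n => (key n w hw).2)

end Treil

/-- **Treil's theorem.** For every `δ > 0` there is `C > 0` (depending only on `δ`)
such that for all bounded holomorphic `f g` on the open unit disk `𝔻` with
`‖f‖_∞ ≤ 1`, `‖g‖_∞ ≤ 1` and `|f(z)| + |g(z)| ≥ δ` on `𝔻`, there is a holomorphic
`G` on `𝔻` with `‖G‖_∞ ≤ C` and `|f(z) + g(z)·G(z)| ≥ 1/C` on `𝔻`
(so `Φ = f + g·G` is invertible in `H^∞` with `‖Φ⁻¹‖_∞ ≤ C`). -/
theorem treil_Hinf_disk :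
    ∀ δ : ℝ, 0 < δ →
      ∃ C : ℝ, 0 < C ∧
        ∀ f g : ℂ → ℂ,
          DifferentiableOn ℂ f (Metric.ball 0 1) →
          DifferentiableOn ℂ g (Metric.ball 0 1) →
          (∀ z ∈ Metric.ball (0 : ℂ) 1, ‖f z‖ ≤ 1) →
          (∀ z ∈ Metric.ball (0 : ℂ) 1, ‖g z‖ ≤ 1) →
          (∀ z ∈ Metric.ball (0 : ℂ) 1, δ ≤ ‖f z‖ + ‖g z‖) →
          ∃ G : ℂ → ℂ,
            DifferentiableOn ℂ G (Metric.ball 0 1) ∧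
            (∀ z ∈ Metric.ball (0 : ℂ) 1, ‖G z‖ ≤ C) ∧
            (∀ z ∈ Metric.ball (0 : ℂ) 1, 1 / C ≤ ‖f z + g z * G z‖) := by
  intro δ hδ
  obtain ⟨C, hC, h⟩ := Treil.exists_bounded_dilated (lt_min hδ one_pos) (min_le_right δ 1)
  refine ⟨C, hC, fun f g hf hg hf1 hg1 hfg => ?_⟩
  obtain ⟨ρ, -, hρ, hρt⟩ := exists_seq_strictMono_tendsto' (zero_lt_one (α := ℝ))
  have hdil : ∀ n, MapsTo (fun z : ℂ => (ρ n : ℂ) * z) (ball 0 (ρ n)⁻¹) (ball 0 1) := fun n z hz => by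
    rw [mem_ball_zero_iff] at hz ⊢
    rw [norm_mul, norm_real, Real.norm_of_nonneg (hρ n).1.le]
    rwa [← lt_inv_mul_iff₀ (hρ n).1, mul_one]
  have hinv : ∀ n, 1 < (ρ n)⁻¹ := fun n => (one_lt_inv₀ (hρ n).1).2 (hρ n).2
  have hdil' : ∀ n, ∀ z ∈ closedBall (0 : ℂ) 1, (ρ n : ℂ) * z ∈ ball (0 : ℂ) 1 := fun n z hz =>
    hdil n (closedBall_subset_ball (hinv n) hz)
  have key := fun n => h (fun z => f (ρ n * z)) (fun z => g (ρ n * z)) (ρ n)⁻¹ (ρ n) (hinv n)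
    (hf.comp (by fun_prop) (hdil n)) (hg.comp (by fun_prop) (hdil n))
    (fun z hz => hf1 _ (hdil' n z hz)) (fun z hz => hg1 _ (hdil' n z hz))
    (fun z hz => (min_le_left δ 1).trans (hfg _ (hdil' n z hz))) (hρ n).1 (hρ n).2
  choose G hG hGC hGl using key
  obtain ⟨L, hL, hGL⟩ := Treil.exists_holomorphic_ultralimit hG hGC
  refine ⟨L, hL, fun z hz => ?_, fun z hz => ?_⟩
  · exact le_of_tendsto (hGL z hz).norm (Eventually.of_forall fun n => hGC n z hz)
  · have hρz : Tendsto (fun n => (ρ n : ℂ) * (ρ n * z)) (hyperfilter ℕ) (𝓝 z) := by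
      have h1 : Tendsto (fun n => (ρ n : ℂ)) (hyperfilter ℕ) (𝓝 ((1 : ℝ) : ℂ)) :=
        ((continuous_ofReal.tendsto 1).comp hρt).mono_left Nat.hyperfilter_le_atTop
      simpa using h1.mul (h1.mul_const z)
    have hfz := (hf.continuousOn.continuousAt (isOpen_ball.mem_nhds hz)).tendsto.comp hρz
    have hgz := (hg.continuousOn.continuousAt (isOpen_ball.mem_nhds hz)).tendsto.comp hρz
    exact ge_of_tendsto (hfz.add (hgz.mul (hGL z hz))).norm
      (Eventually.of_forall fun n => hGl n z hz)
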